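/- Let d₀, d₁, d₂, d₃ be non-negative integers all of the same parity, and let X → ℙ² be a very general complex projective quadric surface bundle of type (d₀, d₁, d₂, d₃). If d₀ + d₁ + d₂ + d₃ ≠ 6, then: (1) X is rational if d₀ + d₁ + d₂ + d₃ ≤ 4 or if d_i = d_j = 0 for some i ≠ j; (2) X is not stably rational otherwise. -/

import Mathlib

/-!
Rationality, stable rationality and stable birationality, expressed via function fields:
a variety `X` over `k` with function field `F` (a `k`-algebra via `c : k →+* F`) is rational
iff `F ≅ k(t₁,…,t_n)` over `k`, and stably rational iff `F(t₁,…,t_m) ≅ k(t₁,…,t_n)` over `k`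
for some `m, n`. Two varieties are stably birational iff their function fields become
isomorphic after adjoining finitely many indeterminates.
-/

noncomputable section

/-- The rational function field `k(t₁, …, t_n)`. -/
def ratFuncField (k : Type) [Field k] (n : ℕ) : Type :=
  FractionRing (MvPolynomial (Fin n) k)

instance (k : Type) [Field k] (n : ℕ) : Field (ratFuncField k n) := by
  unfold ratFuncField; infer_instance

/-- The canonical map `k → k(t₁, …, t_n)`. -/
def ratFuncFieldMap (k : Type) [Field k] (n : ℕ) : k →+* ratFuncField k n :=
  (algebraMap (MvPolynomial (Fin n) k) (FractionRing (MvPolynomial (Fin n) k))).comp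
    (MvPolynomial.C)

/-- Given a function field `F` over `k` (via `c : k →+* F`), the canonical map
`k → Frac(F[t₁,…,t_m]) = F(t₁,…,t_m)`. -/
def adjoinIndetsMap {k F : Type} [CommRing k] [CommRing F] (c : k →+* F) (m : ℕ) :
    k →+* FractionRing (MvPolynomial (Fin m) F) :=
  (algebraMap (MvPolynomial (Fin m) F) (FractionRing (MvPolynomial (Fin m) F))).comp
    ((MvPolynomial.C).comp c)

/-- A variety over `k` with function field `F` (via `c : k →+* F`) is rational iff
`F ≅ k(t₁,…,t_n)` as `k`-algebras for some `n`. -/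
def IsRationalFunctionField {k F : Type} [Field k] [CommRing F] (c : k →+* F) : Prop :=
  ∃ (n : ℕ) (e : F ≃+* ratFuncField k n), (e : F →+* ratFuncField k n).comp c =
    ratFuncFieldMap k n

/-- A variety over `k` with function field `F` (via `c : k →+* F`) is stably rational iff
`F(t₁,…,t_m) ≅ k(t₁,…,t_n)` as `k`-algebras for some `m, n`. -/
def IsStablyRationalFunctionField {k F : Type} [Field k] [CommRing F] (c : k →+* F) : Prop :=
  ∃ (m n : ℕ) (e : FractionRing (MvPolynomial (Fin m) F) ≃+* ratFuncField k n),
    (e : FractionRing (MvPolynomial (Fin m) F) →+* ratFuncField k n).comp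
      (adjoinIndetsMap c m) = ratFuncFieldMap k n

/-- Two varieties over `K` with function fields `L₁, L₂` (via `i₁ : K →+* L₁`,
`i₂ : K →+* L₂`) are stably birational over `K` iff `L₁(t₁,…,t_a) ≅ L₂(t₁,…,t_b)`
as `K`-algebras for some `a, b`. -/
def StablyBirationalOver {K L₁ L₂ : Type} [Field K] [CommRing L₁] [CommRing L₂]
    (i₁ : K →+* L₁) (i₂ : K →+* L₂) : Prop :=
  ∃ (a b : ℕ) (e : FractionRing (MvPolynomial (Fin a) L₁) ≃+*
      FractionRing (MvPolynomial (Fin b) L₂)),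
    (e : FractionRing (MvPolynomial (Fin a) L₁) →+*
      FractionRing (MvPolynomial (Fin b) L₂)).comp (adjoinIndetsMap i₁ a) =
      adjoinIndetsMap i₂ b

end

/-!
Very general members of linear families, and quadric surface bundles over `ℙ²` given by
symmetric matrices of homogeneous forms, described via affine charts and function fields.
-/

noncomputable section

/-- A polynomial function on a `ℂ`-vector space `P`: a function factoring through finitely
many linear coordinates via a polynomial. -/
def IsPolynomialFun {P : Type} [AddCommGroup P] [Module ℂ P] (f : P → ℂ) : Prop :=
  ∃ (N : ℕ) (l : Fin N → (P →ₗ[ℂ] ℂ)) (F : MvPolynomial (Fin N) ℂ),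
    ∀ p : P, f p = MvPolynomial.eval (fun i => l i p) F

/-- A property `Q` holds for a very general member of the linear parameter space `P` if it
holds away from a countable union of proper algebraic hypersurfaces, i.e. if there are
countably many nonzero polynomial functions on `P` such that `Q p` holds whenever none of
them vanishes at `p`. -/
def VeryGeneral {P : Type} [AddCommGroup P] [Module ℂ P] (Q : P → Prop) : Prop :=
  ∃ 𝒞 : Set (P → ℂ), 𝒞.Countable ∧ (∀ f ∈ 𝒞, IsPolynomialFun f ∧ f ≠ 0) ∧
    ∀ p : P, (∀ f ∈ 𝒞, f p ≠ 0) → Q p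

/-- Dehomogenization `ℂ[x,y,z] → ℂ[x,y] ⊆ ℂ[x,y,z₁,z₂,z₃]` at the chart `z = 1` of `ℙ²`
(the first two variables of `Fin 5` are the base coordinates). -/
def dehomP2 : MvPolynomial (Fin 3) ℂ →+* MvPolynomial (Fin 5) ℂ :=
  (MvPolynomial.aeval ![MvPolynomial.X 0, MvPolynomial.X 1, 1]).toRingHom

/-- Dehomogenization `ℂ[x,y,z] → ℂ[x,y]` at the chart `z = 1`. -/
def dehomP2' : MvPolynomial (Fin 3) ℂ →+* MvPolynomial (Fin 2) ℂ :=
  (MvPolynomial.aeval ![MvPolynomial.X 0, MvPolynomial.X 1, 1]).toRingHom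

/-- The defining polynomial `∑_{i,j} a_{ij}(x,y,1) z_i z_j` (with `z₀ = 1`) of the affine
chart of the quadric surface bundle `X = {∑ a_{ij} z_i z_j = 0} ⊆ ℙ(E)` over `ℙ²`. -/
def quadricBundleChartPoly (A : Fin 4 → Fin 4 → MvPolynomial (Fin 3) ℂ) :
    MvPolynomial (Fin 5) ℂ :=
  ∑ i : Fin 4, ∑ j : Fin 4, dehomP2 (A i j) *
    (![1, MvPolynomial.X 2, MvPolynomial.X 3, MvPolynomial.X 4] i) *
    (![1, MvPolynomial.X 2, MvPolynomial.X 3, MvPolynomial.X 4] j)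

/-- The coordinate ring of the affine chart (`z = 1` on `ℙ²` and `z₀ = 1` on the fibre)
of the quadric surface bundle `X ⊆ ℙ(E)` over `ℙ²` determined by the symmetric matrix
`(a_{ij})`. -/
def quadricBundleChartRing (A : Fin 4 → Fin 4 → MvPolynomial (Fin 3) ℂ) : Type :=
  MvPolynomial (Fin 5) ℂ ⧸ Ideal.span {quadricBundleChartPoly A}

instance (A : Fin 4 → Fin 4 → MvPolynomial (Fin 3) ℂ) :
    CommRing (quadricBundleChartRing A) :=
  Ideal.Quotient.commRing _

/-- The function field `ℂ(X)` of the quadric surface bundle `X` over `ℙ²` given by the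
matrix `(a_{ij})`, as the fraction ring of the affine chart. -/
def quadricBundleFunctionField (A : Fin 4 → Fin 4 → MvPolynomial (Fin 3) ℂ) : Type :=
  FractionRing (quadricBundleChartRing A)

instance (A : Fin 4 → Fin 4 → MvPolynomial (Fin 3) ℂ) :
    CommRing (quadricBundleFunctionField A) := by
  unfold quadricBundleFunctionField; infer_instance

/-- The canonical map `ℂ → ℂ(X)`. -/
def quadricBundleFFMap (A : Fin 4 → Fin 4 → MvPolynomial (Fin 3) ℂ) :
    ℂ →+* quadricBundleFunctionField A :=
  (algebraMap (quadricBundleChartRing A) (FractionRing (quadricBundleChartRing A))).comp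
    ((Ideal.Quotient.mk _).comp (MvPolynomial.C))

/-- The conditions for the symmetric matrix `(a_{ij})` of forms to define a quadric surface
bundle over `ℙ²`: the quadratic form is generically nondegenerate, and nonzero on every
fibre (so that `X → ℙ²` is flat). Homogeneity of the `a_{ij}` of the correct degrees is
part of the choice of parameter space. -/
def IsQuadricBundleP2 (A : Fin 4 → Fin 4 → MvPolynomial (Fin 3) ℂ) : Prop :=
  Matrix.det (Matrix.of fun i j => A i j + A j i) ≠ 0 ∧
  ∀ v : Fin 3 → ℂ, v ≠ 0 → ∃ i j, MvPolynomial.eval v (A i j + A j i) ≠ 0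

/-- The quadric surface bundle over `ℙ²` given by `(a_{ij})` admits a rational section:
there are rational functions `σ₀, …, σ₃` on `ℙ²`, not all zero, with
`∑ a_{ij} σ_i σ_j = 0`. -/
def HasRationalSectionP2 (A : Fin 4 → Fin 4 → MvPolynomial (Fin 3) ℂ) : Prop :=
  ∃ σ : Fin 4 → FractionRing (MvPolynomial (Fin 2) ℂ), σ ≠ 0 ∧
    ∑ i : Fin 4, ∑ j : Fin 4,
      (algebraMap (MvPolynomial (Fin 2) ℂ) (FractionRing (MvPolynomial (Fin 2) ℂ)))
        (dehomP2' (A i j)) * σ i * σ j = 0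

end

/-! ### Ternary forms over valued fields -/

section LocallyIsotropic

variable {K Γ : Type*} [Field K] [LinearOrderedCommGroupWithZero Γ]

/-- The ternary diagonal form `⟨x, y, z⟩` represents residually zero with respect to `v`. -/
def LocIso (v : Valuation K Γ) (x y z : K) : Prop :=
  ∃ a b c : K, v (x * a ^ 2 + y * b ^ 2 + z * c ^ 2) <
    max (v (x * a ^ 2)) (max (v (y * b ^ 2)) (v (z * c ^ 2)))

theorem LocIso.rotate {v : Valuation K Γ} {x y z : K} (h : LocIso v x y z) :
    LocIso v y z x := by
  obtain ⟨a, b, c, h⟩ := h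
  refine ⟨b, c, a, ?_⟩
  rw [show y * b ^ 2 + z * c ^ 2 + x * a ^ 2 = x * a ^ 2 + y * b ^ 2 + z * c ^ 2 by ring]
  rwa [← max_assoc, max_comm]

theorem LocIso.swap {v : Valuation K Γ} {x y z : K} (h : LocIso v x y z) :
    LocIso v y x z := by
  obtain ⟨a, b, c, h⟩ := h
  refine ⟨b, a, c, ?_⟩
  rw [show y * b ^ 2 + x * a ^ 2 + z * c ^ 2 = x * a ^ 2 + y * b ^ 2 + z * c ^ 2 by ring]
  rwa [max_left_comm]

theorem LocIso.of_isotropic {v : Valuation K Γ} {x y z a b c : K}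
    (hx : x ≠ 0) (hy : y ≠ 0) (hz : z ≠ 0) (h0 : ¬ (a = 0 ∧ b = 0 ∧ c = 0))
    (h : x * a ^ 2 + y * b ^ 2 + z * c ^ 2 = 0) : LocIso v x y z := by
  refine ⟨a, b, c, ?_⟩
  rw [h, map_zero]
  by_cases ha : a = 0
  · by_cases hb : b = 0
    · have hc : c ≠ 0 := fun hc => h0 ⟨ha, hb, hc⟩
      refine lt_max_of_lt_right (lt_max_of_lt_right ?_)
      simp [zero_lt_iff, hz, hc]
    · refine lt_max_of_lt_right (lt_max_of_lt_left ?_)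
      simp [zero_lt_iff, hy, hb]
  · refine lt_max_of_lt_left ?_
    simp [zero_lt_iff, hx, ha]

/-- The discriminant form whose value is tangent to the coordinate lines. -/
def conicForm {R : Type*} [CommRing R] (x y z : R) : R :=
  x ^ 2 + y ^ 2 + z ^ 2 - 2 * x * y - 2 * x * z - 2 * y * z

theorem conicForm_rotate {R : Type*} [CommRing R] (x y z : R) :
    conicForm x y z = conicForm y z x := by
  unfold conicForm; ring

theorem conicForm_swap {R : Type*} [CommRing R] (x y z : R) :
    conicForm x y z = conicForm y x z := by
  unfold conicForm; ring

theorem Valuation.le_of_not_locIso {v : Valuation K Γ} {x y z : K} (h : ¬ LocIso v x y z)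
    (a b c : K) : v (x * a ^ 2) ≤ v (x * a ^ 2 + y * b ^ 2 + z * c ^ 2) ∧
      v (y * b ^ 2) ≤ v (x * a ^ 2 + y * b ^ 2 + z * c ^ 2) ∧
      v (z * c ^ 2) ≤ v (x * a ^ 2 + y * b ^ 2 + z * c ^ 2) := by
  unfold LocIso at h
  push Not at h
  have := h a b c
  simpa using this

theorem Valuation.le_norm_of_not_locIso {v : Valuation K Γ} {x y z : K} (hz : z ≠ 0)
    (h : ¬ LocIso v x y z) (a b c d : K) :
    v (x * a ^ 2) ≤ v (x * a ^ 2 + y * b ^ 2 + z * c ^ 2 + x * y * z * d ^ 2) := by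
  set N := x * a ^ 2 + y * b ^ 2 + z * c ^ 2 + x * y * z * d ^ 2 with hN
  set s := x * a ^ 2 + y * b ^ 2 with hs
  have h1 : v (x * a ^ 2) ≤ v s := by
    have := (v.le_of_not_locIso h a b 0).1
    simpa [hs] using this
  by_cases hs0 : s = 0
  · rw [hs0, map_zero] at h1
    exact h1.trans zero_le
  have h2 := (v.le_of_not_locIso h (z * (c * a + y * d * b)) (z * (c * b - x * d * a)) s).2.2
  rw [show x * (z * (c * a + y * d * b)) ^ 2 + y * (z * (c * b - x * d * a)) ^ 2 + z * s ^ 2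
    = (z * s) * N by rw [hN, hs]; ring, show z * s ^ 2 = (z * s) * s by ring, map_mul,
    map_mul v (z * s)] at h2
  have h3 : 0 < v (z * s) := by simp [zero_lt_iff, hz, hs0]
  exact h1.trans (le_of_mul_le_mul_left h2 h3)

theorem Valuation.locIso_of_norm {v : Valuation K Γ} {x y z : K} (hx : x ≠ 0) (hy : y ≠ 0)
    (hz : z ≠ 0) {a b c d : K}
    (h : v (x * a ^ 2 + y * b ^ 2 + z * c ^ 2 + x * y * z * d ^ 2) < v (x * y * z * d ^ 2)) :
    LocIso v x y z := by
  by_contra hl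
  have h1 := v.le_norm_of_not_locIso hz hl a b c d
  have h2 := v.le_norm_of_not_locIso hx (fun h => hl h.rotate.rotate) b c a d
  have h3 := v.le_norm_of_not_locIso hy (fun h => hl h.rotate) c a b d
  rw [show y * b ^ 2 + z * c ^ 2 + x * a ^ 2 + y * z * x * d ^ 2 =
    x * a ^ 2 + y * b ^ 2 + z * c ^ 2 + x * y * z * d ^ 2 by ring] at h2
  rw [show z * c ^ 2 + x * a ^ 2 + y * b ^ 2 + z * x * y * d ^ 2 =
    x * a ^ 2 + y * b ^ 2 + z * c ^ 2 + x * y * z * d ^ 2 by ring] at h3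
  set N := x * a ^ 2 + y * b ^ 2 + z * c ^ 2 + x * y * z * d ^ 2 with hN
  have h4 : x * y * z * d ^ 2 = N - x * a ^ 2 - y * b ^ 2 - z * c ^ 2 := by rw [hN]; ring
  have h5 : v (x * y * z * d ^ 2) ≤ v N := by
    rw [h4]
    refine (v.map_sub _ _).trans (max_le ((v.map_sub _ _).trans (max_le ((v.map_sub _ _).trans
      (max_le le_rfl h1)) h2)) h3)
  exact absurd h (not_lt.2 h5)

theorem Valuation.locIso_of_conicForm_approx {v : Valuation K Γ} {x y z t : K} (hx : x ≠ 0)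
    (hy : y ≠ 0) (hz : z ≠ 0) (ht : v (conicForm x y z - t ^ 2) < v (t ^ 2)) {a b c d : K}
    (h0 : ¬ (a = 0 ∧ b = 0 ∧ c = 0 ∧ d = 0))
    (h : x * a ^ 2 + y * b ^ 2 + z * c ^ 2 + x * y * z * conicForm x y z * d ^ 2 = 0) :
    LocIso v x y z := by
  by_cases hd : d = 0
  · subst hd
    refine LocIso.of_isotropic hx hy hz (a := a) (b := b) (c := c) (by simpa using h0) ?_
    simpa using h
  · refine v.locIso_of_norm hx hy hz (a := a) (b := b) (c := c) (d := t * d) ?_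
    rw [show x * a ^ 2 + y * b ^ 2 + z * c ^ 2 + x * y * z * (t * d) ^ 2 =
      -(x * y * z * d ^ 2 * (conicForm x y z - t ^ 2)) by linear_combination h, v.map_neg,
      show x * y * z * (t * d) ^ 2 = x * y * z * d ^ 2 * t ^ 2 by ring, map_mul, map_mul v _ (t ^ 2)]
    refine mul_lt_mul_of_pos_left ht ?_
    simp [zero_lt_iff, hx, hy, hz, hd]

theorem Valuation.map_two_le_one (v : Valuation K Γ) : v 2 ≤ 1 := by
  rw [← one_add_one_eq_two]
  exact (v.map_add _ _).trans (by simp)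

theorem Valuation.locIso_of_conicForm_aux {v : Valuation K Γ} {i x y z : K} (hi : i ^ 2 = -1)
    (hx : x ≠ 0) (hy : y ≠ 0) (hz : z ≠ 0) (hxz : v x < v z) (hyz : v y ≤ v z) {a b c d : K}
    (h0 : ¬ (a = 0 ∧ b = 0 ∧ c = 0 ∧ d = 0))
    (h : x * a ^ 2 + y * b ^ 2 + z * c ^ 2 + x * y * z * conicForm x y z * d ^ 2 = 0) :
    LocIso v x y z := by
  have h2 := v.map_two_le_one
  have hz0 : 0 < v z := by simp [zero_lt_iff, hz]
  have key : ∀ p q : K, v p < v z → v q ≤ v z → v (2 * p * q) < v z ^ 2 := by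
    intro p q hp hq
    rw [map_mul, map_mul, sq]
    calc v 2 * v p * v q ≤ 1 * v p * v z := by gcongr
      _ = v p * v z := by rw [one_mul]
      _ < v z * v z := mul_lt_mul_of_pos_right hp hz0
  have keysq : ∀ p : K, v p < v z → v (p ^ 2) < v z ^ 2 := by
    intro p hp
    rw [map_pow]
    exact pow_lt_pow_left₀ hp zero_le (by norm_num)
  rcases hyz.lt_or_eq with hy' | hy'
  · refine v.locIso_of_conicForm_approx hx hy hz (t := z) ?_ h0 h
    rw [show conicForm x y z - z ^ 2 = x ^ 2 + y ^ 2 - 2 * x * y - 2 * x * z - 2 * y * z by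
      unfold conicForm; ring, map_pow v z]
    refine v.map_sub_lt (v.map_sub_lt (v.map_sub_lt (v.map_add_lt ?_ ?_) ?_) ?_) ?_
    exacts [keysq x hxz, keysq y hy', key x y hxz hyz, key x z hxz le_rfl, key y z hy' le_rfl]
  · by_cases hs : v (y - z) < v z
    · refine ⟨0, 1, i, ?_⟩
      rw [show x * 0 ^ 2 + y * 1 ^ 2 + z * i ^ 2 = y - z by rw [hi]; ring]
      refine lt_max_of_lt_right (lt_max_of_lt_right ?_)
      rwa [hi, mul_neg, mul_one, v.map_neg]
    · have hs' : v (y - z) = v z :=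
        le_antisymm ((v.map_sub _ _).trans (by simp [hy'])) (not_lt.1 hs)
      refine v.locIso_of_conicForm_approx hx hy hz (t := y - z) ?_ h0 h
      rw [show conicForm x y z - (y - z) ^ 2 = x ^ 2 - 2 * x * y - 2 * x * z by
        unfold conicForm; ring, map_pow v (y - z), hs']
      refine v.map_sub_lt (v.map_sub_lt ?_ ?_) ?_
      exacts [keysq x hxz, key x y hxz hyz, key x z hxz le_rfl]

/-- If the quaternary form `⟨x, y, z, xyzF⟩` is isotropic and `x, y, z` do not all have the same
value, then `⟨x, y, z⟩` is residually isotropic. -/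
theorem Valuation.locIso_of_conicForm {v : Valuation K Γ} {i x y z : K} (hi : i ^ 2 = -1)
    (hx : x ≠ 0) (hy : y ≠ 0) (hz : z ≠ 0) (hne : ¬ (v x = v y ∧ v y = v z)) {a b c d : K}
    (h0 : ¬ (a = 0 ∧ b = 0 ∧ c = 0 ∧ d = 0))
    (h : x * a ^ 2 + y * b ^ 2 + z * c ^ 2 + x * y * z * conicForm x y z * d ^ 2 = 0) :
    LocIso v x y z := by
  have main : ∀ x y z a b c : K, x ≠ 0 → y ≠ 0 → z ≠ 0 → ¬ (v x = v y ∧ v y = v z) →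
      v x ≤ v z → v y ≤ v z → ¬ (a = 0 ∧ b = 0 ∧ c = 0 ∧ d = 0) →
      x * a ^ 2 + y * b ^ 2 + z * c ^ 2 + x * y * z * conicForm x y z * d ^ 2 = 0 →
      LocIso v x y z := by
    intro x y z a b c hx hy hz hne h1 h2 h0 h
    rcases h1.lt_or_eq with h1' | h1'
    · exact v.locIso_of_conicForm_aux hi hx hy hz h1' h2 h0 h
    · rcases h2.lt_or_eq with h2' | h2'
      · refine (v.locIso_of_conicForm_aux hi hy hx hz h2' h1 (a := b) (b := a) (c := c) (d := d)
          (by tauto) ?_).swap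
        rw [conicForm_swap]
        linear_combination h
      · exact absurd ⟨h1'.trans h2'.symm, h2'⟩ hne
  rcases le_total (v x) (v z) with h1 | h1
  · rcases le_total (v y) (v z) with h2 | h2
    · exact main x y z a b c hx hy hz hne h1 h2 h0 h
    · refine (main z x y c a b hz hx hy ?_ h2 (h1.trans h2) ?_ ?_).rotate
      · rintro ⟨h3, h4⟩; exact hne ⟨h4, by rw [h3, ← h4]⟩
      · tauto
      · rw [conicForm_rotate]; linear_combination h
  · rcases le_total (v y) (v x) with h2 | h2
    · refine (main y z x b c a hy hz hx ?_ h2 h1 ?_ ?_).rotate.rotate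
      · rintro ⟨h3, h4⟩; exact hne ⟨by rw [h3, ← h4], h3⟩
      · tauto
      · rw [← conicForm_rotate]; linear_combination h
    · refine (main z x y c a b hz hx hy ?_ (h1.trans h2) h2 ?_ ?_).rotate
      · rintro ⟨h3, h4⟩; exact hne ⟨h4, by rw [h3, ← h4]⟩
      · tauto
      · rw [conicForm_rotate]; linear_combination h

theorem LocIso.of_mul_sq {v : Valuation K Γ} {x y z l a b c : K} (hl : l ≠ 0)
    (h : LocIso v (l * x * a ^ 2) (l * y * b ^ 2) (l * z * c ^ 2)) :
    LocIso v x y z := by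
  obtain ⟨r, s, t, h⟩ := h
  refine ⟨a * r, b * s, c * t, ?_⟩
  have hl' : 0 < v l := by simp [zero_lt_iff, hl]
  have e : ∀ x a r : K, l * x * a ^ 2 * r ^ 2 = l * (x * (a * r) ^ 2) := by intros; ring
  simp only [e, ← mul_add, v.map_mul l] at h
  simp only [lt_max_iff, mul_lt_mul_iff_right₀ hl'] at h ⊢
  exact h

end LocallyIsotropic

/-! ### A Legendre theorem for ternary forms over `κ[X]` -/

section Legendre

open Polynomial

/-- A polynomial representation of zero by `⟨a, b, c⟩`. -/
def TernIso {R : Type*} [CommRing R] (a b c : R) : Prop :=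
  ∃ u v w : R, ¬ (u = 0 ∧ v = 0 ∧ w = 0) ∧ a * u ^ 2 + b * v ^ 2 + c * w ^ 2 = 0

variable {κ : Type*} [Field κ]

theorem exists_mem_ker_of_finrank_lt {V : Type*} [AddCommGroup V] [Module κ V]
    {a b c : κ[X]} (ha : a ≠ 0) (hb : b ≠ 0) (hc : c ≠ 0)
    (fa fb fc : V →ₗ[κ] κ[X]) (hV : a.natDegree + b.natDegree + c.natDegree < Module.finrank κ V) :
    ∃ x : V, x ≠ 0 ∧ a ∣ fa x ∧ b ∣ fb x ∧ c ∣ fc x := by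
  have fin : ∀ a : κ[X], a ≠ 0 → Module.Finite κ (κ[X] ⧸ Ideal.span {a}) := fun a ha =>
    PowerBasis.finite (AdjoinRoot.powerBasis ha)
  have := fin a ha
  have := fin b hb
  have := fin c hc
  let q : ∀ a : κ[X], κ[X] →ₗ[κ] (κ[X] ⧸ Ideal.span {a}) := fun a =>
    (Ideal.Quotient.mkₐ κ (Ideal.span {a})).toLinearMap
  let L := ((q a).comp fa).prod (((q b).comp fb).prod ((q c).comp fc))
  have : Module.Finite κ V := Module.finite_of_finrank_pos (by omega)
  have hk : LinearMap.ker L ≠ ⊥ := by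
    apply LinearMap.ker_ne_bot_of_finrank_lt
    rw [Module.finrank_prod, Module.finrank_prod, finrank_quotient_span_eq_natDegree,
      finrank_quotient_span_eq_natDegree, finrank_quotient_span_eq_natDegree]
    omega
  obtain ⟨x, hx, hx0⟩ := Submodule.exists_mem_ne_zero_of_ne_bot hk
  refine ⟨x, hx0, ?_⟩
  rw [LinearMap.mem_ker] at hx
  have h1 : q a (fa x) = 0 := congrArg Prod.fst hx
  have h2 : q b (fb x) = 0 := congrArg (fun t => t.2.1) hx
  have h3 : q c (fc x) = 0 := congrArg (fun t => t.2.2) hx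
  have e : ∀ a y : κ[X], q a y = 0 → a ∣ y := by
    intro a y h
    exact Ideal.mem_span_singleton.1 (Ideal.Quotient.eq_zero_iff_mem.1 h)
  exact ⟨e _ _ h1, e _ _ h2, e _ _ h3⟩

theorem ternIso_of_small_solutions {V : Type*} [AddCommGroup V] [Module κ V]
    {a b c r s t : κ[X]} (ha : a ≠ 0) (hb : b ≠ 0) (hc : c ≠ 0)
    (hab : IsCoprime a b) (hac : IsCoprime a c) (hbc : IsCoprime b c)
    (hr : a ∣ b * r ^ 2 + c) (hs : b ∣ c * s ^ 2 + a) (ht : c ∣ a * t ^ 2 + b)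
    (f1 f2 f3 : V →ₗ[κ] κ[X])
    (hV : a.natDegree + b.natDegree + c.natDegree < Module.finrank κ V)
    (hinj : ∀ x, f1 x = 0 → f2 x = 0 → f3 x = 0 → x = 0)
    (hdeg : ∀ x, (a * f1 x ^ 2 + b * f2 x ^ 2 + c * f3 x ^ 2).degree <
      (a.natDegree + b.natDegree + c.natDegree : ℕ)) : TernIso a b c := by
  obtain ⟨x, hx0, h1, h2, h3⟩ := exists_mem_ker_of_finrank_lt ha hb hc
    (f2 - (LinearMap.mulLeft κ r).comp f3) (f3 - (LinearMap.mulLeft κ s).comp f1)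
    (f1 - (LinearMap.mulLeft κ t).comp f2) hV
  simp only [LinearMap.sub_apply, LinearMap.comp_apply, LinearMap.mulLeft_apply] at h1 h2 h3
  refine ⟨f1 x, f2 x, f3 x, fun h => hx0 (hinj x h.1 h.2.1 h.2.2), ?_⟩
  set u := f1 x with hu
  set v := f2 x with hv
  set w := f3 x with hw
  have d1 : a ∣ a * u ^ 2 + b * v ^ 2 + c * w ^ 2 := by
    obtain ⟨p, hp⟩ := h1
    obtain ⟨q, hq⟩ := hr
    refine ⟨u ^ 2 + b * p * (v + r * w) + q * w ^ 2, ?_⟩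
    linear_combination b * (v + r * w) * hp + w ^ 2 * hq
  have d2 : b ∣ a * u ^ 2 + b * v ^ 2 + c * w ^ 2 := by
    obtain ⟨p, hp⟩ := h2
    obtain ⟨q, hq⟩ := hs
    refine ⟨v ^ 2 + c * p * (w + s * u) + q * u ^ 2, ?_⟩
    linear_combination c * (w + s * u) * hp + u ^ 2 * hq
  have d3 : c ∣ a * u ^ 2 + b * v ^ 2 + c * w ^ 2 := by
    obtain ⟨p, hp⟩ := h3
    obtain ⟨q, hq⟩ := ht
    refine ⟨w ^ 2 + a * p * (u + t * v) + q * v ^ 2, ?_⟩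
    linear_combination a * (u + t * v) * hp + v ^ 2 * hq
  refine eq_zero_of_dvd_of_degree_lt
    (IsCoprime.mul_dvd (IsCoprime.mul_left hac hbc) (hab.mul_dvd d1 d2) d3) ?_
  refine (hdeg x).trans_le ?_
  rw [degree_mul, degree_mul, degree_eq_natDegree ha, degree_eq_natDegree hb,
    degree_eq_natDegree hc]
  push_cast
  exact le_rfl

theorem degree_mul_sq_lt {a u : κ[X]} {A n : ℕ} (hu : u.degree < A)
    (h : a.natDegree + 2 * A ≤ n + 1) : (a * u ^ 2).degree < n := by
  by_cases hu0 : u = 0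
  · simp [hu0]
  by_cases ha0 : a = 0
  · simp [ha0]
  rw [degree_eq_natDegree hu0, Nat.cast_lt] at hu
  rw [degree_eq_natDegree (mul_ne_zero ha0 (pow_ne_zero 2 hu0)), natDegree_mul ha0
    (pow_ne_zero 2 hu0), natDegree_pow, Nat.cast_lt]
  omega

theorem degree_add_three_lt {a b c : κ[X]} {n : ℕ} (ha : a.degree < n) (hb : b.degree < n)
    (hc : c.degree < n) : (a + b + c).degree < n :=
  (degree_add_le _ _).trans_lt (max_lt ((degree_add_le _ _).trans_lt (max_lt ha hb)) hc)

theorem ternIso_of_bounds {a b c r s t : κ[X]} (ha : a ≠ 0) (hb : b ≠ 0) (hc : c ≠ 0)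
    (hab : IsCoprime a b) (hac : IsCoprime a c) (hbc : IsCoprime b c)
    (hr : a ∣ b * r ^ 2 + c) (hs : b ∣ c * s ^ 2 + a) (ht : c ∣ a * t ^ 2 + b) (A B C : ℕ)
    (hA : a.natDegree + 2 * A ≤ a.natDegree + b.natDegree + c.natDegree + 1)
    (hB : b.natDegree + 2 * B ≤ a.natDegree + b.natDegree + c.natDegree + 1)
    (hC : c.natDegree + 2 * C ≤ a.natDegree + b.natDegree + c.natDegree + 1)
    (hABC : a.natDegree + b.natDegree + c.natDegree < A + B + C) : TernIso a b c := by
  refine ternIso_of_small_solutions ha hb hc hab hac hbc hr hs ht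
    (V := degreeLT κ A × degreeLT κ B × degreeLT κ C)
    ((degreeLT κ A).subtype.comp (LinearMap.fst _ _ _))
    ((degreeLT κ B).subtype.comp ((LinearMap.fst _ _ _).comp (LinearMap.snd _ _ _)))
    ((degreeLT κ C).subtype.comp ((LinearMap.snd _ _ _).comp (LinearMap.snd _ _ _))) ?_ ?_ ?_
  · rw [Module.finrank_prod, Module.finrank_prod, (degreeLTEquiv κ A).finrank_eq,
      (degreeLTEquiv κ B).finrank_eq, (degreeLTEquiv κ C).finrank_eq]
    simp only [Module.finrank_fin_fun]
    omega
  · rintro ⟨x, y, z⟩ h1 h2 h3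
    simp only [LinearMap.comp_apply, LinearMap.fst_apply, LinearMap.snd_apply,
      Submodule.subtype_apply, ZeroMemClass.coe_eq_zero] at h1 h2 h3
    rw [h1, h2, h3]; rfl
  · rintro ⟨x, y, z⟩
    exact degree_add_three_lt (degree_mul_sq_lt (mem_degreeLT.1 x.2) hA)
      (degree_mul_sq_lt (mem_degreeLT.1 y.2) hB) (degree_mul_sq_lt (mem_degreeLT.1 z.2) hC)

theorem degree_lt_of_top_coeff {a u : κ[X]} {A n : ℕ} {h t : κ} (hu : u.degree < A)
    (hn : a.natDegree + 2 * A = n) :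
    (a * (u + C (t * h) * X ^ A) ^ 2 - C (t ^ 2 * (a.leadingCoeff * h ^ 2)) * X ^ n).degree < (n : WithBot ℕ) := by

  have hle : (u + C (t * h) * X ^ A).natDegree ≤ A := by
    refine natDegree_add_le_of_degree_le ?_ (natDegree_C_mul_X_pow_le _ _)
    exact natDegree_le_of_degree_le hu.le
  have hcoeff : (u + C (t * h) * X ^ A).coeff A = t * h := by
    rw [coeff_add, coeff_C_mul, coeff_X_pow, if_pos rfl, mul_one,
      coeff_eq_zero_of_degree_lt hu, zero_add]
  set p := u + C (t * h) * X ^ A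
  have h1 : (p ^ 2).natDegree ≤ 2 * A := by
    rw [sq]; exact (natDegree_mul_le_of_le hle hle).trans (by omega)
  have h2 : (a * p ^ 2).natDegree ≤ n := by
    rw [← hn]; exact natDegree_mul_le_of_le le_rfl h1
  have h3 : (a * p ^ 2).coeff n = a.leadingCoeff * (t * h) ^ 2 := by
    rw [← hn, coeff_mul_add_eq_of_natDegree_le le_rfl h1, two_mul, sq,
      coeff_mul_add_eq_of_natDegree_le hle hle, hcoeff, ← sq]; rfl
  rw [degree_lt_iff_coeff_zero]
  intro m hm
  rw [coeff_sub, coeff_C_mul, coeff_X_pow]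
  rcases hm.eq_or_lt with rfl | hm
  · rw [h3, if_pos rfl]; ring
  · rw [coeff_eq_zero_of_natDegree_lt (h2.trans_lt hm), if_neg (by omega)]; ring

theorem ternIso_of_top {a b c r s t : κ[X]} (ha : a ≠ 0) (hb : b ≠ 0) (hc : c ≠ 0)
    (hab : IsCoprime a b) (hac : IsCoprime a c) (hbc : IsCoprime b c)
    (hr : a ∣ b * r ^ 2 + c) (hs : b ∣ c * s ^ 2 + a) (ht : c ∣ a * t ^ 2 + b) (A B C' : ℕ)
    (hA : 2 * A = b.natDegree + c.natDegree)
    (hB : 2 * B = a.natDegree + c.natDegree)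
    (hC : 2 * C' = a.natDegree + b.natDegree)
    (htop : TernIso a.leadingCoeff b.leadingCoeff c.leadingCoeff) : TernIso a b c := by
  obtain ⟨h1, h2, h3, h0, h⟩ := htop
  refine ternIso_of_small_solutions ha hb hc hab hac hbc hr hs ht
    (V := degreeLT κ A × degreeLT κ B × degreeLT κ C' × κ)
    ((degreeLT κ A).subtype.comp (LinearMap.fst _ _ _) +
      (LinearMap.toSpanSingleton κ κ[X] (C h1 * X ^ A)).comp ((LinearMap.snd _ _ _).comp
      ((LinearMap.snd _ _ _).comp (LinearMap.snd _ _ _))))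
    ((degreeLT κ B).subtype.comp ((LinearMap.fst _ _ _).comp (LinearMap.snd _ _ _)) +
      (LinearMap.toSpanSingleton κ κ[X] (C h2 * X ^ B)).comp ((LinearMap.snd _ _ _).comp
      ((LinearMap.snd _ _ _).comp (LinearMap.snd _ _ _))))
    ((degreeLT κ C').subtype.comp ((LinearMap.fst _ _ _).comp ((LinearMap.snd _ _ _).comp
      (LinearMap.snd _ _ _))) +
      (LinearMap.toSpanSingleton κ κ[X] (C h3 * X ^ C')).comp ((LinearMap.snd _ _ _).comp
      ((LinearMap.snd _ _ _).comp (LinearMap.snd _ _ _)))) ?_ ?_ ?_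
  · rw [Module.finrank_prod, Module.finrank_prod, Module.finrank_prod,
      (degreeLTEquiv κ A).finrank_eq, (degreeLTEquiv κ B).finrank_eq,
      (degreeLTEquiv κ C').finrank_eq]
    simp only [Module.finrank_fin_fun, Module.finrank_self]
    omega
  · rintro ⟨x, y, z, t⟩ e1 e2 e3
    simp only [LinearMap.add_apply, LinearMap.comp_apply, LinearMap.fst_apply,
      LinearMap.snd_apply, Submodule.subtype_apply, LinearMap.toSpanSingleton_apply,
      smul_eq_C_mul, ← mul_assoc, ← C_mul] at e1 e2 e3
    have key : ∀ (n : ℕ) (x : degreeLT κ n) (h : κ), (x : κ[X]) + C (t * h) * X ^ n = 0 →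
        t * h = 0 ∧ x = 0 := by
      intro n x h e
      have e' := congrArg (fun p => coeff p n) e
      simp only [coeff_add, coeff_C_mul, coeff_X_pow, if_true, mul_one, coeff_zero,
        coeff_eq_zero_of_degree_lt (mem_degreeLT.1 x.2), zero_add] at e'
      refine ⟨e', ?_⟩
      rw [e', C_0, zero_mul, add_zero] at e
      exact Subtype.ext e
    obtain ⟨t1, x1⟩ := key _ _ _ e1
    obtain ⟨t2, x2⟩ := key _ _ _ e2
    obtain ⟨t3, x3⟩ := key _ _ _ e3
    have ht0 : t = 0 := by
      by_contra ht0
      simp only [mul_eq_zero, ht0, false_or] at t1 t2 t3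
      exact h0 ⟨t1, t2, t3⟩
    rw [x1, x2, x3, ht0]; rfl
  · rintro ⟨x, y, z, t⟩
    simp only [LinearMap.add_apply, LinearMap.comp_apply, LinearMap.fst_apply,
      LinearMap.snd_apply, Submodule.subtype_apply, LinearMap.toSpanSingleton_apply,
      smul_eq_C_mul, ← mul_assoc, ← C_mul]
    set n := a.natDegree + b.natDegree + c.natDegree with hn
    have k1 := degree_lt_of_top_coeff (a := a) (n := n) (h := h1) (t := t)
      (mem_degreeLT.1 x.2) (by omega)
    have k2 := degree_lt_of_top_coeff (a := b) (n := n) (h := h2) (t := t)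
      (mem_degreeLT.1 y.2) (by omega)
    have k3 := degree_lt_of_top_coeff (a := c) (n := n) (h := h3) (t := t)
      (mem_degreeLT.1 z.2) (by omega)
    have k := degree_add_three_lt k1 k2 k3
    convert k using 2
    have hC := congrArg (fun y => C (t ^ 2 * y) * X ^ n) h
    simp only [mul_add, C_add, mul_zero, C_0, zero_mul, add_mul] at hC
    linear_combination hC

end Legendre

section Legendre2

open Polynomial

variable {κ : Type*} [Field κ]

theorem TernIso.rotate {R : Type*} [CommRing R] {a b c : R} (h : TernIso a b c) :
    TernIso b c a := by
  obtain ⟨u, v, w, h0, h⟩ := h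
  exact ⟨v, w, u, by tauto, by linear_combination h⟩

theorem TernIso.swap {R : Type*} [CommRing R] {a b c : R} (h : TernIso a b c) :
    TernIso b a c := by
  obtain ⟨u, v, w, h0, h⟩ := h
  exact ⟨v, u, w, by tauto, by linear_combination h⟩

theorem exists_dvd_mul_sq_add {R : Type*} [CommRing R] [IsDomain R] [IsPrincipalIdealRing R]
    {b c a : R} (ha : Squarefree a)
    (h : ∀ p, Irreducible p → p ∣ a → ∃ r, p ∣ b * r ^ 2 + c) : ∃ r, a ∣ b * r ^ 2 + c := by
  induction a using WfDvdMonoid.induction_on_irreducible with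
  | zero => exact absurd ha not_squarefree_zero
  | unit u hu => exact ⟨0, hu.dvd⟩
  | mul a p ha0 hp ih =>
    obtain ⟨r', hr'⟩ := ih (ha.squarefree_of_dvd (dvd_mul_left a p))
      fun q hq hqa => h q hq (hqa.mul_left p)
    obtain ⟨r, hr⟩ := h p hp (dvd_mul_right p a)
    have hcop : IsCoprime p a := by
      refine (hp.coprime_iff_not_dvd).2 fun hpa => hp.not_isUnit (ha p ?_)
      exact mul_dvd_mul_left p hpa
    obtain ⟨s, t, hst⟩ := hcop
    refine ⟨r * (t * a) + r' * (s * p), IsCoprime.mul_dvd ⟨s, t, hst⟩ ?_ ?_⟩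
    · obtain ⟨q, hq⟩ := hr
      refine ⟨q + b * ((r' - r) * s) * (r * (t * a) + r' * (s * p) + r), ?_⟩
      linear_combination hq + b * r * (r * (t * a) + r' * (s * p) + r) * hst
    · obtain ⟨q, hq⟩ := hr'
      refine ⟨q + b * ((r - r') * t) * (r * (t * a) + r' * (s * p) + r'), ?_⟩
      linear_combination hq + b * r' * (r * (t * a) + r' * (s * p) + r') * hst

open IsDedekindDomain WithZero

/-- The height one prime attached to an irreducible polynomial. -/
noncomputable def irredPlace (p : κ[X]) (hp : Irreducible p) : HeightOneSpectrum κ[X] where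
  asIdeal := Ideal.span {p}
  isPrime := (Ideal.span_singleton_prime hp.ne_zero).2 hp.prime
  ne_bot := by simpa using hp.ne_zero

/-- Two nonzero elements have values differing by a square. -/
def SameParity {K Γ : Type*} [Field K] [LinearOrderedCommGroupWithZero Γ] (v : Valuation K Γ)
    (a b : K) : Prop := ∃ s : K, s ≠ 0 ∧ v a = v (b * s ^ 2)

theorem valuation_irredPlace_self (p : κ[X]) (hp : Irreducible p) :
    (irredPlace p hp).valuation (RatFunc κ) (algebraMap κ[X] (RatFunc κ) p) = exp (-1) := by
  rw [HeightOneSpectrum.valuation_of_algebraMap, HeightOneSpectrum.intValuation_singleton _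
    hp.ne_zero rfl]

theorem valuation_irredPlace_lt_one_iff (p : κ[X]) (hp : Irreducible p) (f : κ[X]) :
    (irredPlace p hp).valuation (RatFunc κ) (algebraMap κ[X] (RatFunc κ) f) < 1 ↔ p ∣ f := by
  rw [HeightOneSpectrum.valuation_lt_one_iff_mem]
  exact Ideal.mem_span_singleton

theorem valuation_irredPlace_eq_one_iff (p : κ[X]) (hp : Irreducible p) (f : κ[X]) :
    (irredPlace p hp).valuation (RatFunc κ) (algebraMap κ[X] (RatFunc κ) f) = 1 ↔ ¬ p ∣ f := by
  rw [← valuation_irredPlace_lt_one_iff p hp, not_lt]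
  exact ⟨fun h => h.ge, fun h => le_antisymm (HeightOneSpectrum.valuation_le_one _ _) h⟩

theorem exp_neg_one_ne_sq (x : ℤᵐ⁰) : exp (-1 : ℤ) ≠ x ^ 2 := by
  intro h
  have hx : x ≠ 0 := by
    rintro rfl
    simp at h
  rw [← exp_log hx, ← exp_nsmul] at h
  have := exp_injective h
  simp at this
  omega

theorem exists_dvd_of_locIso {p a b c : κ[X]} (hp : Irreducible p) (hpa : p ∣ a)
    (hpa2 : ¬ p * p ∣ a) (hpb : ¬ p ∣ b) (hpc : ¬ p ∣ c)
    (h : LocIso ((irredPlace p hp).valuation (RatFunc κ)) (algebraMap κ[X] (RatFunc κ) a)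
      (algebraMap κ[X] (RatFunc κ) b) (algebraMap κ[X] (RatFunc κ) c)) :
    ∃ r, p ∣ b * r ^ 2 + c := by
  obtain ⟨u, v, w, h⟩ := h
  set V := (irredPlace p hp).valuation (RatFunc κ) with hV
  have hb : V (algebraMap κ[X] (RatFunc κ) b) = 1 := (valuation_irredPlace_eq_one_iff p hp b).2 hpb
  have hc : V (algebraMap κ[X] (RatFunc κ) c) = 1 := (valuation_irredPlace_eq_one_iff p hp c).2 hpc
  have ha : V (algebraMap κ[X] (RatFunc κ) a) = exp (-1) := by
    obtain ⟨a', rfl⟩ := hpa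
    rw [map_mul, map_mul, valuation_irredPlace_self, (valuation_irredPlace_eq_one_iff p hp a').2,
      mul_one]
    intro h
    exact hpa2 (mul_dvd_mul_left p h)
  have hparity : ∀ x y : RatFunc κ, y ≠ 0 → exp (-1) * V x ^ 2 ≠ V y ^ 2 := by
    intro x y hy h
    have hy' : V y ≠ 0 := by simpa using hy
    have hx' : V x ≠ 0 := by
      rintro hx
      rw [hx, zero_pow two_ne_zero, mul_zero] at h
      exact pow_ne_zero 2 hy' h.symm
    apply exp_neg_one_ne_sq (V y / V x)
    rw [div_pow, eq_div_iff (pow_ne_zero 2 hx'), h]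
  have e1 : V (algebraMap κ[X] (RatFunc κ) a * u ^ 2) = exp (-1) * V u ^ 2 := by simp [ha]
  have e2 : V (algebraMap κ[X] (RatFunc κ) b * v ^ 2) = V v ^ 2 := by simp [hb]
  have e3 : V (algebraMap κ[X] (RatFunc κ) c * w ^ 2) = V w ^ 2 := by simp [hc]
  set A := algebraMap κ[X] (RatFunc κ) a * u ^ 2 with hA
  set B := algebraMap κ[X] (RatFunc κ) b * v ^ 2 with hB
  set D := algebraMap κ[X] (RatFunc κ) c * w ^ 2 with hD
  -- the two even terms have equal value
  have hpar2 : ∀ y : RatFunc κ, V A = V y ^ 2 → y = 0 ∧ V A = 0 := by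
    intro y hy
    by_cases hy0 : y = 0
    · refine ⟨hy0, ?_⟩
      rw [hy, hy0]; simp
    · rw [e1] at hy
      exact absurd hy (hparity u y hy0)
  have sep : ∀ (t : RatFunc κ) (y : RatFunc κ), V t = V y ^ 2 → V (A + t) = max (V A) (V t) := by
    intro t y hty
    by_cases hne : V A = V t
    · obtain ⟨hy0, hA0⟩ := hpar2 y (hne.trans hty)
      have : A = 0 := by simpa using hA0
      rw [this]; simp
    · exact V.map_add_of_distinct_val hne
  have hBD : V B = V D := by
    by_contra hne
    have h1 : V (B + D) = max (V B) (V D) := V.map_add_of_distinct_val hne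
    have h2 : ∃ y, V (B + D) = V y ^ 2 := by
      rcases max_choice (V B) (V D) with h | h
      · exact ⟨v, by rw [h1, h, e2]⟩
      · exact ⟨w, by rw [h1, h, e3]⟩
    obtain ⟨y, hy⟩ := h2
    rw [add_assoc, sep _ y hy, h1] at h
    exact lt_irrefl _ h
  have hvw : V v = V w := by
    rw [e2, e3] at hBD
    exact (pow_left_inj₀ zero_le zero_le two_ne_zero).1 hBD
  have hAD : V A < V D := by
    by_contra hle
    rw [hBD, max_self, max_eq_left (not_lt.1 hle)] at h
    by_cases hAD : V A = V D
    · obtain ⟨hw, hA0⟩ := hpar2 w (hAD.trans e3)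
      rw [hA0] at h
      exact not_lt_zero h
    · have h3 : V (B + D) < V A := by
        refine (V.map_add _ _).trans_lt ?_
        rw [hBD, max_self]
        exact lt_of_le_of_ne (not_lt.1 hle) (Ne.symm hAD)
      rw [add_assoc, V.map_add_eq_of_lt_left h3] at h
      exact lt_irrefl _ h
  have hw0 : w ≠ 0 := by
    rintro rfl
    have : V D = 0 := by simp [hD]
    rw [this] at hAD
    exact not_lt_zero hAD
  have hBDlt : V (B + D) < V D := by
    have h3 : V (A + B + D) < V D := by
      rw [hBD, max_self, max_eq_right hAD.le] at h
      exact h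
    rw [show B + D = (A + B + D) - A by ring]
    exact V.map_sub_lt h3 hAD
  -- write `v / w` as a fraction
  set q := v / w with hq
  have hVq : V q = 1 := by
    rw [hq, map_div₀, hvw, div_self]
    simpa using hw0
  have hcop := RatFunc.isCoprime_num_denom q
  have hnd : algebraMap κ[X] (RatFunc κ) q.num = q * algebraMap κ[X] (RatFunc κ) q.denom := by
    have := RatFunc.num_div_denom q
    rw [div_eq_iff] at this
    · exact this
    · simpa using q.denom_ne_zero
  have hden : ¬ p ∣ q.denom := by
    intro hd
    have h1 := (valuation_irredPlace_lt_one_iff p hp _).2 hd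
    have h2 : p ∣ q.num := by
      rw [← valuation_irredPlace_lt_one_iff p hp, hnd, map_mul, ← hV, hVq, one_mul]
      exact h1
    exact hp.not_isUnit (hcop.isUnit_of_dvd' h2 hd)
  have hdvd : p ∣ b * q.num ^ 2 + c * q.denom ^ 2 := by
    rw [← valuation_irredPlace_lt_one_iff p hp, map_add, map_mul, map_mul, map_pow, map_pow, hnd,
      ← hV]
    have : V (algebraMap κ[X] (RatFunc κ) q.denom) = 1 :=
      (valuation_irredPlace_eq_one_iff p hp _).2 hden
    rw [show algebraMap κ[X] (RatFunc κ) b * (q * algebraMap κ[X] (RatFunc κ) q.denom) ^ 2 +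
      algebraMap κ[X] (RatFunc κ) c * (algebraMap κ[X] (RatFunc κ) q.denom) ^ 2 =
      (B + D) / w ^ 2 * (algebraMap κ[X] (RatFunc κ) q.denom) ^ 2 by
        rw [hB, hD, hq]; field_simp, map_mul, map_pow, this, one_pow, mul_one, map_div₀, map_pow]
    rw [e3] at hBDlt
    rw [div_lt_one₀]
    · exact hBDlt
    · exact pow_pos (by simpa [zero_lt_iff] using hw0) 2
  obtain ⟨s, t, hst⟩ := (hp.coprime_iff_not_dvd).2 hden
  obtain ⟨k, hk⟩ := hdvd
  refine ⟨q.num * t, t ^ 2 * k + c * s * (1 + t * q.denom), ?_⟩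
  linear_combination t ^ 2 * hk - c * (1 + t * q.denom) * hst

theorem not_sameParity_of_exactly_dvd {p a b : κ[X]} (hp : Irreducible p) (hpa : p ∣ a)
    (hpa2 : ¬ p * p ∣ a) (hpb : ¬ p ∣ b) :
    ¬ SameParity ((irredPlace p hp).valuation (RatFunc κ)) (algebraMap κ[X] (RatFunc κ) a)
      (algebraMap κ[X] (RatFunc κ) b) := by
  rintro ⟨s, hs0, hs⟩
  obtain ⟨a', rfl⟩ := hpa
  rw [map_mul, map_mul, valuation_irredPlace_self, (valuation_irredPlace_eq_one_iff p hp a').2,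
      mul_one, map_mul, (valuation_irredPlace_eq_one_iff p hp b).2 hpb, one_mul, map_pow] at hs
  · exact exp_neg_one_ne_sq _ hs
  · intro h
    exact hpa2 (mul_dvd_mul_left p h)

end Legendre2

section Legendre3

open Polynomial IsDedekindDomain WithZero

section parity
variable {K Γ : Type*} [Field K] [LinearOrderedCommGroupWithZero Γ] {v : Valuation K Γ}

theorem SameParity.symm {a b : K} (h : SameParity v a b) : SameParity v b a := by
  obtain ⟨s, hs0, hs⟩ := h
  refine ⟨s⁻¹, inv_ne_zero hs0, ?_⟩
  rw [map_mul, map_pow, map_inv₀, hs, map_mul, map_pow]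
  have : v s ≠ 0 := by simpa using hs0
  field_simp

theorem SameParity.trans {a b c : K} (h : SameParity v a b) (h' : SameParity v b c) :
    SameParity v a c := by
  obtain ⟨s, hs0, hs⟩ := h
  obtain ⟨t, ht0, ht⟩ := h'
  refine ⟨s * t, mul_ne_zero hs0 ht0, ?_⟩
  rw [hs, map_mul, ht, ← map_mul]
  congr 1
  ring

theorem SameParity.of_mul_sq {l x y a b : K} (hl : l ≠ 0) (ha : a ≠ 0) (hb : b ≠ 0)
    (h : SameParity v (l * x * a ^ 2) (l * y * b ^ 2)) : SameParity v x y := by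
  obtain ⟨s, hs0, hs⟩ := h
  refine ⟨b * s / a, div_ne_zero (mul_ne_zero hb hs0) ha, ?_⟩
  have hl' : v l ≠ 0 := by simpa using hl
  have ha' : v a ≠ 0 := by simpa using ha
  simp only [map_mul, map_pow, map_div₀] at hs ⊢
  field_simp
  refine mul_left_cancel₀ hl' ?_
  rw [← mul_assoc, hs]
  simp only [mul_assoc]

theorem SameParity.of_eq {a b : K} (h : v a = v b) : SameParity v a b :=
  ⟨1, one_ne_zero, by simpa using h⟩

/-- Either residually isotropic, or all coefficients have values of the same parity. -/
def GoodAt (v : Valuation K Γ) (x y z : K) : Prop :=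
  LocIso v x y z ∨ (SameParity v x y ∧ SameParity v y z)

theorem GoodAt.rotate {x y z : K} (h : GoodAt v x y z) : GoodAt v y z x := by
  rcases h with h | ⟨h1, h2⟩
  · exact Or.inl h.rotate
  · exact Or.inr ⟨h2, (h1.trans h2).symm⟩

theorem GoodAt.of_mul_sq {l x y z a b c : K} (hl : l ≠ 0) (ha : a ≠ 0) (hb : b ≠ 0) (hc : c ≠ 0)
    (h : GoodAt v (l * x * a ^ 2) (l * y * b ^ 2) (l * z * c ^ 2)) : GoodAt v x y z := by
  rcases h with h | ⟨h1, h2⟩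
  · exact Or.inl (h.of_mul_sq hl)
  · exact Or.inr ⟨h1.of_mul_sq hl ha hb, h2.of_mul_sq hl hb hc⟩

end parity

variable {κ : Type*} [Field κ]

/-- The place at infinity of `κ(X)`. -/
noncomputable def inftyPlace (κ : Type*) [Field κ] : Valuation (RatFunc κ) ℤᵐ⁰ :=
  letI := Classical.decEq (RatFunc κ)
  RatFunc.inftyValuation κ

theorem inftyPlace_lt_iff (f g : κ[X]) :
    inftyPlace κ (algebraMap κ[X] (RatFunc κ) f) < inftyPlace κ (algebraMap κ[X] (RatFunc κ) g) ↔
      f.degree < g.degree := by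
  let := Classical.decEq (RatFunc κ)
  have e : ∀ f : κ[X], f ≠ 0 → inftyPlace κ (algebraMap κ[X] (RatFunc κ) f) =
      exp (f.natDegree : ℤ) := fun f hf => RatFunc.inftyValuation.polynomial κ hf
  by_cases hg : g = 0
  · simp [hg]
  rw [e g hg]
  by_cases hf : f = 0
  · simp [hf, bot_lt_iff_ne_bot, hg]
  rw [e f hf, exp_lt_exp, degree_eq_natDegree hf, degree_eq_natDegree hg]
  norm_cast

theorem inftyPlace_eq_iff (f g : κ[X]) :
    inftyPlace κ (algebraMap κ[X] (RatFunc κ) f) = inftyPlace κ (algebraMap κ[X] (RatFunc κ) g) ↔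
      f.degree = g.degree := by
  rw [le_antisymm_iff, ← not_lt, ← not_lt, inftyPlace_lt_iff, inftyPlace_lt_iff, not_lt, not_lt,
    ← le_antisymm_iff]

theorem LocIso.exists_polynomial {Γ : Type*} [LinearOrderedCommGroupWithZero Γ]
    {v : Valuation (RatFunc κ) Γ} {x y z : RatFunc κ} (h : LocIso v x y z) :
    ∃ a b c : κ[X], v (x * algebraMap _ _ a ^ 2 + y * algebraMap _ _ b ^ 2 +
      z * algebraMap _ _ c ^ 2) <
      max (v (x * algebraMap _ _ a ^ 2)) (max (v (y * algebraMap _ _ b ^ 2))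
        (v (z * algebraMap _ _ c ^ 2))) := by
  obtain ⟨a, b, c, h⟩ := h
  obtain ⟨a1, a2, ha2, rfl⟩ := IsFractionRing.div_surjective (A := κ[X]) a
  obtain ⟨b1, b2, hb2, rfl⟩ := IsFractionRing.div_surjective (A := κ[X]) b
  obtain ⟨c1, c2, hc2, rfl⟩ := IsFractionRing.div_surjective (A := κ[X]) c
  have ha := mem_nonZeroDivisors_iff_ne_zero.1 ha2
  have hb := mem_nonZeroDivisors_iff_ne_zero.1 hb2
  have hc := mem_nonZeroDivisors_iff_ne_zero.1 hc2
  refine ⟨a1 * b2 * c2, b1 * a2 * c2, c1 * a2 * b2, ?_⟩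
  set i := algebraMap κ[X] (RatFunc κ)
  have ha' : i a2 ≠ 0 := by simpa [i] using ha
  have hb' : i b2 ≠ 0 := by simpa [i] using hb
  have hc' : i c2 ≠ 0 := by simpa [i] using hc
  have hD : 0 < v ((i a2 * i b2 * i c2) ^ 2) := by
    rw [zero_lt_iff, Valuation.ne_zero_iff]
    exact pow_ne_zero 2 (mul_ne_zero (mul_ne_zero ha' hb') hc')
  have e1 : x * i (a1 * b2 * c2) ^ 2 = (i a2 * i b2 * i c2) ^ 2 * (x * (i a1 / i a2) ^ 2) := by
    simp only [map_mul]; field_simp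
  have e2 : y * i (b1 * a2 * c2) ^ 2 = (i a2 * i b2 * i c2) ^ 2 * (y * (i b1 / i b2) ^ 2) := by
    simp only [map_mul]; field_simp
  have e3 : z * i (c1 * a2 * b2) ^ 2 = (i a2 * i b2 * i c2) ^ 2 * (z * (i c1 / i c2) ^ 2) := by
    simp only [map_mul]; field_simp
  rw [e1, e2, e3, ← mul_add, ← mul_add]
  simp only [v.map_mul ((i a2 * i b2 * i c2) ^ 2), lt_max_iff, mul_lt_mul_iff_right₀ hD] at h ⊢
  exact h

theorem coeff_mul_sq_of_le {a u : κ[X]} {A N : ℕ} (hN : N = a.natDegree + 2 * A)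
    (hu : u.natDegree ≤ A) : (a * u ^ 2).coeff N = a.leadingCoeff * u.coeff A ^ 2 := by
  have h1 : (u ^ 2).natDegree ≤ 2 * A := by
    rw [sq]; exact (natDegree_mul_le_of_le hu hu).trans (by omega)
  rw [hN, coeff_mul_add_eq_of_natDegree_le le_rfl h1, two_mul, sq,
      coeff_mul_add_eq_of_natDegree_le hu hu, ← sq]; rfl

theorem ternIso_leadingCoeff_of_locIso {a b c : κ[X]} (ha : a ≠ 0) (hb : b ≠ 0) (hc : c ≠ 0)
    (hab : a.natDegree % 2 = b.natDegree % 2) (hbc : b.natDegree % 2 = c.natDegree % 2)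
    (h : LocIso (inftyPlace κ) (algebraMap κ[X] (RatFunc κ) a) (algebraMap κ[X] (RatFunc κ) b)
      (algebraMap κ[X] (RatFunc κ) c)) :
    TernIso a.leadingCoeff b.leadingCoeff c.leadingCoeff := by
  obtain ⟨u, v, w, h⟩ := h.exists_polynomial
  simp only [← map_pow, ← map_mul, ← map_add, lt_max_iff, inftyPlace_lt_iff] at h
  have hdeg : ∀ {a u : κ[X]}, a ≠ 0 → u ≠ 0 →
      (a * u ^ 2).degree = (a.natDegree + 2 * u.natDegree : ℕ) := by
    intro a u ha hu
    rw [degree_eq_natDegree (mul_ne_zero ha (pow_ne_zero 2 hu)), natDegree_mul ha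
      (pow_ne_zero 2 hu), natDegree_pow]
  -- the largest degree
  obtain ⟨N, hN1, hN2, hN3, hN⟩ : ∃ N : ℕ, (a * u ^ 2).degree ≤ N ∧ (b * v ^ 2).degree ≤ N ∧
      (c * w ^ 2).degree ≤ N ∧ ((a * u ^ 2).degree = N ∨ (b * v ^ 2).degree = N ∨
        (c * w ^ 2).degree = N) := by
    have hb : max (a * u ^ 2).degree (max (b * v ^ 2).degree (c * w ^ 2).degree) ≠ ⊥ := by
      intro hbot
      simp only [max_eq_bot] at hbot
      rw [hbot.1, hbot.2.1, hbot.2.2] at h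
      simp at h
    obtain ⟨N, hN⟩ := WithBot.ne_bot_iff_exists.1 hb
    refine ⟨N, ?_, ?_, ?_, ?_⟩
    · exact (le_max_left _ _).trans hN.ge
    · exact (le_max_left _ _).trans ((le_max_right _ _).trans hN.ge)
    · exact (le_max_right _ _).trans ((le_max_right _ _).trans hN.ge)
    · rcases max_choice (a * u ^ 2).degree (max (b * v ^ 2).degree (c * w ^ 2).degree) with h | h
      · exact Or.inl (h.symm.trans hN.symm)
      · rcases max_choice (b * v ^ 2).degree (c * w ^ 2).degree with h' | h'
        · exact Or.inr (Or.inl (h'.symm.trans (h.symm.trans hN.symm)))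
        · exact Or.inr (Or.inr (h'.symm.trans (h.symm.trans hN.symm)))
  have hS : (a * u ^ 2 + b * v ^ 2 + c * w ^ 2).coeff N = 0 := by
    apply coeff_eq_zero_of_degree_lt
    rcases h with h | h | h
    · exact h.trans_le hN1
    · exact h.trans_le hN2
    · exact h.trans_le hN3
  have hform : ∀ {a u : κ[X]}, a ≠ 0 → (a * u ^ 2).degree = N →
      N = a.natDegree + 2 * u.natDegree ∧ u ≠ 0 := by
    intro a u ha h
    by_cases hu : u = 0
    · simp [hu] at h
    · rw [hdeg ha hu] at h
      exact ⟨by exact_mod_cast h.symm, hu⟩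
  have hmod : N % 2 = a.natDegree % 2 := by
    rcases hN with h | h | h
    · have := (hform ha h).1; omega
    · have := (hform hb h).1; omega
    · have := (hform hc h).1; omega
  have key : ∀ {a u : κ[X]}, a ≠ 0 → (a * u ^ 2).degree ≤ N → N % 2 = a.natDegree % 2 →
      ∃ A, (a * u ^ 2).coeff N = a.leadingCoeff * u.coeff A ^ 2 ∧
        ((a * u ^ 2).degree = N → u.coeff A ≠ 0) := by
    intro a u ha h hm
    by_cases hu : u = 0
    · exact ⟨0, by simp [hu], by simp [hu]⟩
    · have h' := h
      rw [hdeg ha hu, Nat.cast_le] at h'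
      refine ⟨(N - a.natDegree) / 2, coeff_mul_sq_of_le (by omega) (by omega), ?_⟩
      intro h2
      have h3 := (hform ha h2).1
      rw [show (N - a.natDegree) / 2 = u.natDegree by omega]
      exact leadingCoeff_ne_zero.2 hu
  obtain ⟨A, hA, hA'⟩ := key ha hN1 hmod
  obtain ⟨B, hB, hB'⟩ := key hb hN2 (hmod.trans hab)
  obtain ⟨D, hD, hD'⟩ := key hc hN3 (hmod.trans (hab.trans hbc))
  refine ⟨u.coeff A, v.coeff B, w.coeff D, ?_, ?_⟩
  · rintro ⟨h1, h2, h3⟩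
    rcases hN with h | h | h
    · exact hA' h h1
    · exact hB' h h2
    · exact hD' h h3
  · rw [← hA, ← hB, ← hD, ← coeff_add, ← coeff_add, hS]

end Legendre3

section Legendre4

open Polynomial IsDedekindDomain WithZero

variable {κ : Type*} [Field κ]

/-- The finite local conditions for `⟨a, b, c⟩` over `κ[X]`. -/
def FinitelyGood (a b c : RatFunc κ) : Prop :=
  ∀ (p : κ[X]) (hp : Irreducible p), GoodAt ((irredPlace p hp).valuation (RatFunc κ)) a b c

/-- A ternary form over `κ[X]` satisfying all local conditions is isotropic. -/
theorem ternIso_of_local : ∀ (n : ℕ) (a b c : κ[X]), a ≠ 0 → b ≠ 0 → c ≠ 0 →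
    a.natDegree + b.natDegree + c.natDegree = n →
    FinitelyGood (algebraMap κ[X] (RatFunc κ) a) (algebraMap κ[X] (RatFunc κ) b)
      (algebraMap κ[X] (RatFunc κ) c) →
    LocIso (inftyPlace κ) (algebraMap κ[X] (RatFunc κ) a) (algebraMap κ[X] (RatFunc κ) b)
      (algebraMap κ[X] (RatFunc κ) c) → TernIso a b c := by
  intro n
  induction n using Nat.strong_induction_on with
  | _ n ih =>
  have inj : ∀ {f : κ[X]}, f ≠ 0 → algebraMap κ[X] (RatFunc κ) f ≠ 0 := fun {f} hf => by simpa using hf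
  have step1 : ∀ a b c : κ[X], a ≠ 0 → b ≠ 0 → c ≠ 0 →
      a.natDegree + b.natDegree + c.natDegree = n →
      FinitelyGood (algebraMap κ[X] (RatFunc κ) a) (algebraMap κ[X] (RatFunc κ) b)
        (algebraMap κ[X] (RatFunc κ) c) →
      LocIso (inftyPlace κ) (algebraMap κ[X] (RatFunc κ) a) (algebraMap κ[X] (RatFunc κ) b)
        (algebraMap κ[X] (RatFunc κ) c) → (∃ p, Irreducible p ∧ p * p ∣ a) → TernIso a b c := by
    rintro a b c ha hb hc hn hf hi ⟨p, hp, a', rfl⟩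
    have hp0 := hp.ne_zero
    have ha' : a' ≠ 0 := right_ne_zero_of_mul ha
    have hpd := hp.natDegree_pos
    have hdeg : (p * p * a').natDegree = p.natDegree + p.natDegree + a'.natDegree := by
      rw [natDegree_mul (mul_ne_zero hp0 hp0) ha', natDegree_mul hp0 hp0]
    set i := algebraMap κ[X] (RatFunc κ)
    have e1 : i (p * p * a') = 1 * i a' * i p ^ 2 := by simp only [map_mul]; ring
    have e2 : ∀ x, i x = 1 * i x * 1 ^ 2 := by intro x; ring
    rw [e1, e2 b, e2 c] at hf hi
    obtain ⟨u, v, w, h0, h⟩ := ih _ (by omega) a' b c ha' hb hc rfl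
      (fun q hq => (hf q hq).of_mul_sq one_ne_zero (inj hp0) one_ne_zero one_ne_zero)
      (hi.of_mul_sq one_ne_zero)
    refine ⟨u, p * v, p * w, ?_, by linear_combination p ^ 2 * h⟩
    simpa [hp0] using h0
  have step2 : ∀ a b c : κ[X], a ≠ 0 → b ≠ 0 → c ≠ 0 →
      a.natDegree + b.natDegree + c.natDegree = n →
      FinitelyGood (algebraMap κ[X] (RatFunc κ) a) (algebraMap κ[X] (RatFunc κ) b)
        (algebraMap κ[X] (RatFunc κ) c) →
      LocIso (inftyPlace κ) (algebraMap κ[X] (RatFunc κ) a) (algebraMap κ[X] (RatFunc κ) b)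
        (algebraMap κ[X] (RatFunc κ) c) → (∃ p, Irreducible p ∧ p ∣ a ∧ p ∣ b) → TernIso a b c := by
    rintro a b c ha hb hc hn hf hi ⟨p, hp, ⟨a', rfl⟩, ⟨b', rfl⟩⟩
    have hp0 := hp.ne_zero
    have ha' : a' ≠ 0 := right_ne_zero_of_mul ha
    have hb' : b' ≠ 0 := right_ne_zero_of_mul hb
    have hpd := hp.natDegree_pos
    rw [natDegree_mul hp0 ha', natDegree_mul hp0 hb'] at hn
    have hdeg := natDegree_mul hp0 hc
    set i := algebraMap κ[X] (RatFunc κ)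
    have hip := inj hp0
    have e1 : ∀ x, i (p * x) = i p * i x * 1 ^ 2 := by intro x; simp only [map_mul]; ring
    have e2 : i c = i p * i (p * c) * ((i p)⁻¹) ^ 2 := by
      simp only [map_mul]; field_simp
    rw [e1, e1, e2] at hf hi
    obtain ⟨u, v, w, h0, h⟩ := ih _ (by omega) a' b' (p * c) ha' hb' (mul_ne_zero hp0 hc) rfl
      (fun q hq => (hf q hq).of_mul_sq hip one_ne_zero one_ne_zero (inv_ne_zero hip))
      (hi.of_mul_sq hip)
    refine ⟨u, v, p * w, ?_, by linear_combination p * h⟩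
    simpa [hp0] using h0
  intro a b c ha hb hc hn hf hi
  have hf1 : FinitelyGood (algebraMap κ[X] (RatFunc κ) b) (algebraMap κ[X] (RatFunc κ) c)
    (algebraMap κ[X] (RatFunc κ) a) := fun q hq => (hf q hq).rotate
  have hf2 : FinitelyGood (algebraMap κ[X] (RatFunc κ) c) (algebraMap κ[X] (RatFunc κ) a)
    (algebraMap κ[X] (RatFunc κ) b) := fun q hq => (hf q hq).rotate.rotate
  by_cases ha1 : ∃ p, Irreducible p ∧ p * p ∣ a
  · exact step1 a b c ha hb hc hn hf hi ha1
  by_cases hb1 : ∃ p, Irreducible p ∧ p * p ∣ b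
  · exact (step1 b c a hb hc ha (by omega) hf1 hi.rotate hb1).rotate.rotate
  by_cases hc1 : ∃ p, Irreducible p ∧ p * p ∣ c
  · exact (step1 c a b hc ha hb (by omega) hf2 hi.rotate.rotate hc1).rotate
  by_cases hab : ∃ p, Irreducible p ∧ p ∣ a ∧ p ∣ b
  · exact step2 a b c ha hb hc hn hf hi hab
  by_cases hbc : ∃ p, Irreducible p ∧ p ∣ b ∧ p ∣ c
  · exact (step2 b c a hb hc ha (by omega) hf1 hi.rotate hbc).rotate.rotate
  by_cases hca : ∃ p, Irreducible p ∧ p ∣ c ∧ p ∣ a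
  · exact (step2 c a b hc ha hb (by omega) hf2 hi.rotate.rotate hca).rotate
  push Not at ha1 hb1 hc1 hab hbc hca
  have local_sol : ∀ a b c : κ[X], a ≠ 0 → (∀ p, Irreducible p → ¬ p * p ∣ a) →
      (∀ p, Irreducible p → p ∣ a → ¬ p ∣ b) → (∀ p, Irreducible p → p ∣ c → ¬ p ∣ a) →
      FinitelyGood (algebraMap κ[X] (RatFunc κ) a) (algebraMap κ[X] (RatFunc κ) b)
        (algebraMap κ[X] (RatFunc κ) c) → ∃ r, a ∣ b * r ^ 2 + c := by
    intro a b c ha ha1 hab hca hf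
    refine exists_dvd_mul_sq_add
      ((squarefree_iff_irreducible_sq_not_dvd_of_ne_zero ha).2 ha1) ?_
    intro p hp hpa
    refine exists_dvd_of_locIso hp hpa (ha1 p hp) (hab p hp hpa) (fun h => hca p hp h hpa) ?_
    refine (hf p hp).resolve_right fun h => ?_
    exact not_sameParity_of_exactly_dvd hp hpa (ha1 p hp) (hab p hp hpa) h.1
  obtain ⟨r, hr⟩ := local_sol a b c ha ha1 hab hca hf
  obtain ⟨s, hs⟩ := local_sol b c a hb hb1 hbc hab hf1
  obtain ⟨t, ht⟩ := local_sol c a b hc hc1 hca hbc hf2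
  have cop_ab : IsCoprime a b := isCoprime_of_irreducible_dvd (fun h => ha h.1) hab
  have cop_bc : IsCoprime b c := isCoprime_of_irreducible_dvd (fun h => hb h.1) hbc
  have cop_ca : IsCoprime c a := isCoprime_of_irreducible_dvd (fun h => hc h.1) hca
  by_cases hpar : a.natDegree % 2 = b.natDegree % 2 ∧ b.natDegree % 2 = c.natDegree % 2
  · exact ternIso_of_top ha hb hc cop_ab cop_ca.symm cop_bc hr hs ht
      ((b.natDegree + c.natDegree) / 2) ((a.natDegree + c.natDegree) / 2)
      ((a.natDegree + b.natDegree) / 2) (by omega) (by omega) (by omega)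
      (ternIso_leadingCoeff_of_locIso ha hb hc hpar.1 hpar.2 hi)
  · exact ternIso_of_bounds ha hb hc cop_ab cop_ca.symm cop_bc hr hs ht
      ((b.natDegree + c.natDegree + 1) / 2) ((a.natDegree + c.natDegree + 1) / 2)
      ((a.natDegree + b.natDegree + 1) / 2) (by omega) (by omega) (by omega) (by omega)

/-- Anisotropy of the lowest coefficients implies anisotropy over `κ[X]`. -/
theorem not_ternIso_of_low {x y z : κ[X]} {k : ℕ} (hx : X ^ k ∣ x) (hy : X ^ k ∣ y)
    (hz : X ^ k ∣ z) (h : ¬ TernIso (x.coeff k) (y.coeff k) (z.coeff k)) : ¬ TernIso x y z := by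
  classical
  rintro ⟨u, v, w, h0, e⟩
  obtain ⟨x, rfl⟩ := hx
  obtain ⟨y, rfl⟩ := hy
  obtain ⟨z, rfl⟩ := hz
  have e' : x * u ^ 2 + y * v ^ 2 + z * w ^ 2 = 0 := by
    have : (X ^ k : κ[X]) * (x * u ^ 2 + y * v ^ 2 + z * w ^ 2) = 0 := by
      linear_combination e
    exact (mul_eq_zero.1 this).resolve_left (pow_ne_zero k X_ne_zero)
  simp only [coeff_X_pow_mul', le_refl, if_true, tsub_self] at h
  -- divide by the largest power of `X`
  have hex : ∃ m, ¬ (u.coeff m = 0 ∧ v.coeff m = 0 ∧ w.coeff m = 0) := by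
    by_contra hcon
    push Not at hcon
    exact h0 ⟨ext fun m => by simpa using (hcon m).1, ext fun m => by simpa using (hcon m).2.1,
      ext fun m => by simpa using (hcon m).2.2⟩
  obtain ⟨m, hm, hlt⟩ : ∃ m, ¬ (u.coeff m = 0 ∧ v.coeff m = 0 ∧ w.coeff m = 0) ∧
      ∀ j < m, u.coeff j = 0 ∧ v.coeff j = 0 ∧ w.coeff j = 0 :=
    ⟨Nat.find hex, Nat.find_spec hex, fun j hj => not_not.1 (Nat.find_min hex hj)⟩
  obtain ⟨u, rfl⟩ := X_pow_dvd_iff.2 fun j hj => (hlt j hj).1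
  obtain ⟨v, rfl⟩ := X_pow_dvd_iff.2 fun j hj => (hlt j hj).2.1
  obtain ⟨w, rfl⟩ := X_pow_dvd_iff.2 fun j hj => (hlt j hj).2.2
  have e2 : x * u ^ 2 + y * v ^ 2 + z * w ^ 2 = 0 := by
    have : ((X ^ m) ^ 2 : κ[X]) * (x * u ^ 2 + y * v ^ 2 + z * w ^ 2) = 0 := by
      linear_combination e'
    exact (mul_eq_zero.1 this).resolve_left (pow_ne_zero 2 (pow_ne_zero m X_ne_zero))
  refine h ⟨u.coeff 0, v.coeff 0, w.coeff 0, ?_, ?_⟩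
  · have hm' : ¬((X ^ m * u).coeff m = 0 ∧ (X ^ m * v).coeff m = 0 ∧ (X ^ m * w).coeff m = 0) := hm
    simpa only [coeff_X_pow_mul', le_refl, if_true, tsub_self] using hm'
  · simp only [coeff_zero_eq_eval_zero]
    simpa using congrArg (eval 0) e2

/-- Suppose the quaternary form `⟨x, y, z, xyzF⟩` over `κ[X]` is isotropic. If the vector of lowest
coefficients of `(x, y, z)` is anisotropic, so is the vector of highest coefficients. -/
theorem not_ternIso_top_of_low {i : κ} (hi : i ^ 2 = -1) {x y z : κ[X]} {k l : ℕ}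
    (hx : X ^ k ∣ x) (hy : X ^ k ∣ y) (hz : X ^ k ∣ z) (hx' : x.natDegree ≤ l)
    (hy' : y.natDegree ≤ l) (hz' : z.natDegree ≤ l)
    {a b c d : κ[X]} (h0 : ¬ (a = 0 ∧ b = 0 ∧ c = 0 ∧ d = 0))
    (h : x * a ^ 2 + y * b ^ 2 + z * c ^ 2 + x * y * z * conicForm x y z * d ^ 2 = 0)
    (hlow : ¬ TernIso (x.coeff k) (y.coeff k) (z.coeff k))
    (htop : ¬ (x.coeff l = 0 ∧ y.coeff l = 0 ∧ z.coeff l = 0)) :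
    ¬ TernIso (x.coeff l) (y.coeff l) (z.coeff l) := by
  intro hiso
  have hx0 : x ≠ 0 := by rintro rfl; exact hlow ⟨1, 0, 0, by simp, by simp⟩
  have hy0 : y ≠ 0 := by rintro rfl; exact hlow ⟨0, 1, 0, by simp, by simp⟩
  have hz0 : z ≠ 0 := by rintro rfl; exact hlow ⟨0, 0, 1, by simp, by simp⟩
  refine not_ternIso_of_low hx hy hz hlow (ternIso_of_local _ x y z hx0 hy0 hz0 rfl ?_ ?_)
  all_goals
    set ι := algebraMap κ[X] (RatFunc κ) with hι
    have inj : ∀ {f : κ[X]}, ι f = 0 ↔ f = 0 := fun {f} => by simp [hι]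
    have hψ : ι x * ι a ^ 2 + ι y * ι b ^ 2 + ι z * ι c ^ 2 +
        ι x * ι y * ι z * conicForm (ι x) (ι y) (ι z) * ι d ^ 2 = 0 := by
      have := congrArg ι h
      simp only [conicForm, map_add, map_mul, map_pow, map_sub, map_ofNat, map_zero] at this ⊢
      exact this
    have h0' : ¬ (ι a = 0 ∧ ι b = 0 ∧ ι c = 0 ∧ ι d = 0) := by simpa only [inj] using h0
    have hi' : (ι (C i)) ^ 2 = -1 := by rw [← map_pow, ← C_pow, hi]; simp
  · intro p hp
    by_cases hv : (irredPlace p hp).valuation (RatFunc κ) (ι x) =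
        (irredPlace p hp).valuation (RatFunc κ) (ι y) ∧
        (irredPlace p hp).valuation (RatFunc κ) (ι y) =
        (irredPlace p hp).valuation (RatFunc κ) (ι z)
    · exact Or.inr ⟨SameParity.of_eq hv.1, SameParity.of_eq hv.2⟩
    · exact Or.inl (Valuation.locIso_of_conicForm hi' (inj.not.2 hx0) (inj.not.2 hy0)
        (inj.not.2 hz0) hv h0' hψ)
  · by_cases hv : inftyPlace κ (ι x) = inftyPlace κ (ι y) ∧ inftyPlace κ (ι y) = inftyPlace κ (ι z)
    · rw [inftyPlace_eq_iff, inftyPlace_eq_iff] at hv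
      have n1 := natDegree_eq_natDegree hv.1
      have n2 := natDegree_eq_natDegree hv.2
      have hxl : x.natDegree = l := by
        by_contra hne
        refine htop ⟨?_, ?_, ?_⟩ <;> exact coeff_eq_zero_of_natDegree_lt (by omega)
      obtain ⟨u, v, w, huvw, e⟩ := hiso
      refine ⟨ι (C u), ι (C v), ι (C w), ?_⟩
      simp only [← map_pow, ← map_mul, ← map_add, lt_max_iff, hι, inftyPlace_lt_iff]
      have hlt : (x * C (u ^ 2) + y * C (v ^ 2) + z * C (w ^ 2)).degree < l := by
        rw [degree_lt_iff_coeff_zero]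
        intro m hm
        simp only [coeff_add, coeff_mul_C]
        rcases hm.eq_or_lt with rfl | hm
        · exact e
        · rw [coeff_eq_zero_of_natDegree_lt (hx'.trans_lt hm),
            coeff_eq_zero_of_natDegree_lt (hy'.trans_lt hm),
            coeff_eq_zero_of_natDegree_lt (hz'.trans_lt hm)]
          simp
      have hd : ∀ {x : κ[X]} {u : κ}, x ≠ 0 → x.natDegree = l → u ≠ 0 →
          (x * C (u ^ 2)).degree = l := by
        intro x u hx0 hx hu
        rw [degree_mul_C (pow_ne_zero 2 hu), degree_eq_natDegree hx0, hx]
      by_cases hu : u = 0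
      · by_cases hv' : v = 0
        · have hw : w ≠ 0 := fun hw => huvw ⟨hu, hv', hw⟩
          exact Or.inr (Or.inr (hlt.trans_eq (hd hz0 (by omega) hw).symm))
        · exact Or.inr (Or.inl (hlt.trans_eq (hd hy0 (by omega) hv').symm))
      · exact Or.inl (hlt.trans_eq (hd hx0 (by omega) hu).symm)
    · exact Valuation.locIso_of_conicForm hi' (inj.not.2 hx0) (inj.not.2 hy0)
        (inj.not.2 hz0) hv h0' hψ

end Legendre4

/-! ### Newton polygons and reduction of isotropic vectors -/

section Chain

open Polynomial IsLocalRing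

/-- Integral diagonal coefficients `f₀, …, f₃` in three variables such that isotropy of
`⟨f₀, …, f₃⟩` at a point implies isotropy of `⟨x, y, z, xyzF⟩`. -/
def SpecialIso (f : Fin 4 → MvPolynomial (Fin 3) ℤ) : Prop :=
  ∀ (R : Type) [CommRing R] [IsDomain R] (b : Fin 3 → R) (Z : Fin 4 → R),
    b 0 ≠ 0 → b 1 ≠ 0 → b 2 ≠ 0 → Z ≠ 0 → ∑ k, MvPolynomial.aeval b (f k) * Z k ^ 2 = 0 →
    ∃ s t u w : R, ¬ (s = 0 ∧ t = 0 ∧ u = 0 ∧ w = 0) ∧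
      b 0 * s ^ 2 + b 1 * t ^ 2 + b 2 * u ^ 2 +
        b 0 * b 1 * b 2 * conicForm (b 0) (b 1) (b 2) * w ^ 2 = 0

theorem SpecialIso.not_ternIso_top {f : Fin 4 → MvPolynomial (Fin 3) ℤ} (hf : SpecialIso f)
    {κ : Type} [Field κ] {i : κ} (hi : i ^ 2 = -1) {k l : ℕ} (b : Fin 3 → κ[X])
    (hb : ∀ m, X ^ k ∣ b m) (hb' : ∀ m, (b m).natDegree ≤ l) (Z : Fin 4 → κ[X]) (hZ : Z ≠ 0)
    (h : ∑ k, MvPolynomial.aeval b (f k) * Z k ^ 2 = 0)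
    (hlow : ¬ TernIso ((b 0).coeff k) ((b 1).coeff k) ((b 2).coeff k))
    (htop : ∃ m, (b m).coeff l ≠ 0) :
    ¬ TernIso ((b 0).coeff l) ((b 1).coeff l) ((b 2).coeff l) := by
  have hx0 : b 0 ≠ 0 := by intro h; exact hlow ⟨1, 0, 0, by simp, by simp [h]⟩
  have hy0 : b 1 ≠ 0 := by intro h; exact hlow ⟨0, 1, 0, by simp, by simp [h]⟩
  have hz0 : b 2 ≠ 0 := by intro h; exact hlow ⟨0, 0, 1, by simp, by simp [h]⟩
  obtain ⟨s, t, u, w, h0, e⟩ := hf κ[X] b Z hx0 hy0 hz0 hZ h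
  refine not_ternIso_top_of_low hi (hb 0) (hb 1) (hb 2) (hb' 0) (hb' 1) (hb' 2) h0 e hlow ?_
  rintro ⟨h1, h2, h3⟩
  obtain ⟨m, hm⟩ := htop
  fin_cases m
  · exact hm h1
  · exact hm h2
  · exact hm h3

theorem exists_common_scale {L ι : Type*} [Field L] [Fintype ι] (A : ValuationSubring L)
    (w : ι → L) (hw : ∃ m, w m ≠ 0) :
    ∃ (m : ι) (u : ι → A), w m ≠ 0 ∧ (∀ n, w n = w m * u n) ∧ u m = 1 := by
  obtain ⟨m0, hm0⟩ := hw
  obtain ⟨m, -, hm⟩ := Finset.exists_max_image Finset.univ (fun n => A.valuation (w n))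
    ⟨m0, Finset.mem_univ _⟩
  have hwm : w m ≠ 0 := by
    intro h
    have := hm m0 (Finset.mem_univ _)
    rw [h, map_zero, le_zero_iff, Valuation.zero_iff] at this
    exact hm0 this
  refine ⟨m, fun n => ⟨w n / w m, ?_⟩, hwm, fun n => ?_, ?_⟩
  · rw [← A.valuation_le_one_iff, map_div₀]
    exact div_le_one_of_le₀ (hm n (Finset.mem_univ _)) zero_le
  · simp only
    field_simp
  · exact Subtype.ext (div_self hwm)

theorem exists_lift_polynomial {L : Type*} [Field L] (A : ValuationSubring L) (p : L[X])
    (hp : ∀ n, p.coeff n ∈ A) : ∃ q : A[X], q.map A.subtype = p := by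
  have : p ∈ lifts A.subtype := by
    rw [lifts_iff_coeff_lifts]
    intro n
    exact ⟨⟨_, hp n⟩, rfl⟩
  exact this

/-- A vector over a valued field whose normalised reduction is anisotropic. -/
def RedAniso {L : Type*} [Field L] (A : ValuationSubring L) (w : Fin 3 → L) : Prop :=
  ∃ (e : L) (u : Fin 3 → A), e ≠ 0 ∧ (∀ m, w m = e * u m) ∧
    ¬ TernIso (residue A (u 0)) (residue A (u 1)) (residue A (u 2))

theorem not_ternIso_ne_zero {R : Type*} [CommRing R] [Nontrivial R] {a : Fin 3 → R}
    (h : ¬ TernIso (a 0) (a 1) (a 2)) (m : Fin 3) : a m ≠ 0 := by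
  intro hm
  refine h ?_
  fin_cases m
  · exact ⟨1, 0, 0, by simp, by simp_all⟩
  · exact ⟨0, 1, 0, by simp, by simp_all⟩
  · exact ⟨0, 0, 1, by simp, by simp_all⟩

theorem RedAniso.valuation {L : Type*} [Field L] {A : ValuationSubring L} {w : Fin 3 → L}
    (h : RedAniso A w) : (∀ m, w m ≠ 0) ∧ ∀ m n, A.valuation (w m) = A.valuation (w n) := by
  obtain ⟨e, u, he, hw, hu⟩ := h
  have hunit : ∀ m, A.valuation (u m : L) = 1 := by
    intro m
    have := not_ternIso_ne_zero (a := fun m => residue A (u m)) hu m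
    rw [← A.valuation_eq_one_iff]
    exact (residue_ne_zero_iff_isUnit _).1 this
  have hv : ∀ m, A.valuation (w m) = A.valuation e := by
    intro m
    rw [hw m, map_mul, hunit m, mul_one]
  refine ⟨fun m hm => he ?_, fun m n => (hv m).trans (hv n).symm⟩
  have := hv m
  rw [hm, map_zero, eq_comm, Valuation.zero_iff] at this
  exact this

theorem RedAniso.not_ternIso {L : Type*} [Field L] {A : ValuationSubring L} {w : Fin 3 → L}
    (h : RedAniso A w) : ¬ TernIso (w 0) (w 1) (w 2) := by
  rintro ⟨a, b, c, h0, e⟩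
  obtain ⟨ε, u, he, hw, hu⟩ := h
  have hex : ∃ m, ![a, b, c] m ≠ 0 := by
    by_contra hcon
    push Not at hcon
    exact h0 ⟨hcon 0, hcon 1, hcon 2⟩
  obtain ⟨m, t, hm, ht, htm⟩ := exists_common_scale A ![a, b, c] hex
  have e1 := ht 0
  have e2 := ht 1
  have e3 := ht 2
  simp only [Matrix.cons_val_zero, Matrix.cons_val_one, Matrix.cons_val] at e1 e2 e3
  have key : u 0 * t 0 ^ 2 + u 1 * t 1 ^ 2 + u 2 * t 2 ^ 2 = 0 := by
    apply Subtype.ext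
    push_cast
    have h1 : (ε * (![a, b, c] m) ^ 2) * ((u 0 : L) * t 0 ^ 2 + u 1 * t 1 ^ 2 + u 2 * t 2 ^ 2) = 0 := by
      rw [hw 0, hw 1, hw 2] at e
      generalize ![a, b, c] m = q at e1 e2 e3 ⊢
      rw [← e, e1, e2, e3]
      ring
    exact (mul_eq_zero.1 h1).resolve_left (mul_ne_zero he (pow_ne_zero 2 hm))
  refine hu ⟨residue A (t 0), residue A (t 1), residue A (t 2), ?_, ?_⟩
  · rintro ⟨z0, z1, z2⟩
    have : residue A (t m) = 0 := by
      fin_cases m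
      · exact z0
      · exact z1
      · exact z2
    rw [htm, map_one] at this
    exact one_ne_zero this
  · rw [← map_pow, ← map_pow, ← map_pow, ← map_mul, ← map_mul, ← map_mul, ← map_add, ← map_add,
      key, map_zero]

/-- Reduction of an isotropic vector of polynomials. -/
theorem exists_reduced_isotropic {L : Type} [Field L] (A : ValuationSubring L)
    {f : Fin 4 → MvPolynomial (Fin 3) ℤ} {a : Fin 4 → Fin 4 → MvPolynomial (Fin 3) A}
    (ha : ∀ i j, MvPolynomial.map (residue A) (a i j) =
      if i = j then MvPolynomial.map (Int.castRingHom _) (f i) else 0)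
    (b : Fin 3 → A[X]) (Z : Fin 4 → L[X]) (hZ : Z ≠ 0)
    (h : ∑ i, ∑ j, (MvPolynomial.eval₂ C b (a i j)).map A.subtype * Z i * Z j = 0) :
    ∃ Z' : Fin 4 → (ResidueField A)[X], Z' ≠ 0 ∧
      ∑ k, MvPolynomial.aeval (fun m => (b m).map (residue A)) (f k) * Z' k ^ 2 = 0 := by
  classical
  -- normalise
  set N := Finset.univ.sup (fun i => (Z i).natDegree) with hN
  obtain ⟨⟨i0, n0⟩, u, hm, hu, hum⟩ := exists_common_scale A
    (fun x : Fin 4 × Fin (N + 1) => (Z x.1).coeff x.2) (by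
      obtain ⟨i, hi⟩ := Function.ne_iff.1 hZ
      refine ⟨⟨i, ⟨(Z i).natDegree, Nat.lt_succ_of_le ?_⟩⟩, ?_⟩
      · exact Finset.le_sup (f := fun i => (Z i).natDegree) (Finset.mem_univ i)
      · exact leadingCoeff_ne_zero.2 hi)
  simp only at hm hu hum
  set e := (Z i0).coeff n0
  have hcoef : ∀ i n, ((C e⁻¹ * Z i).coeff n) ∈ A := by
    intro i n
    rw [coeff_C_mul]
    by_cases hn : n < N + 1
    · have := hu (i, ⟨n, hn⟩)
      simp only at this
      rw [this, inv_mul_cancel_left₀ hm]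
      exact (u _).2
    · rw [coeff_eq_zero_of_natDegree_lt, mul_zero]
      · exact A.zero_mem
      · refine lt_of_le_of_lt ?_ (Nat.lt_of_succ_le (not_lt.1 hn))
        exact Finset.le_sup (f := fun i => (Z i).natDegree) (Finset.mem_univ i)
  choose Y hY using fun i => exists_lift_polynomial A (C e⁻¹ * Z i) (hcoef i)
  refine ⟨fun i => (Y i).map (residue A), ?_, ?_⟩
  · intro h0
    have h1 := congrArg (fun p => coeff p n0) (congrFun h0 i0)
    simp only [coeff_map, Pi.zero_apply, coeff_zero] at h1
    have h2 : (Y i0).coeff n0 = 1 := by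
      apply Subtype.ext
      have := congrArg (fun p => coeff p n0) (hY i0)
      simp only [coeff_map, coeff_C_mul] at this
      exact this.trans (inv_mul_cancel₀ hm)
    rw [h2, map_one] at h1
    exact one_ne_zero h1
  · have h1 : ∑ i, ∑ j, MvPolynomial.eval₂ C b (a i j) * Y i * Y j = 0 := by
      apply map_injective A.subtype A.subtype_injective
      simp only [Polynomial.map_sum, Polynomial.map_mul, hY, Polynomial.map_zero]
      have := congrArg (fun p => C e⁻¹ * C e⁻¹ * p) h
      simp only [mul_zero, Finset.mul_sum] at this
      rw [← this]
      refine Finset.sum_congr rfl fun i _ => Finset.sum_congr rfl fun j _ => ?_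
      ring
    have h2 := congrArg (Polynomial.map (residue A)) h1
    simp only [Polynomial.map_sum, Polynomial.map_mul, Polynomial.map_zero] at h2
    rw [← h2]
    refine Finset.sum_congr rfl fun i _ => ?_
    have key : ∀ j, (MvPolynomial.eval₂ C b (a i j)).map (residue A) =
        MvPolynomial.eval₂ C (fun m => (b m).map (residue A))
          (MvPolynomial.map (residue A) (a i j)) := by
      intro j
      rw [MvPolynomial.eval₂_map]
      have := MvPolynomial.hom_eval₂ (a i j) C (mapRingHom (residue A)) b
      simp only [coe_mapRingHom] at this
      rw [this]
      congr 1
      ext x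
      simp
    simp only [key, ha]
    rw [Finset.sum_eq_single i]
    · rw [if_pos rfl, MvPolynomial.eval₂_map, MvPolynomial.aeval_def, sq, mul_assoc]
      congr 2
    · intro j _ hj
      rw [if_neg (Ne.symm hj)]
      simp
    · simp

theorem eval₂_mul_left_of_isHomogeneous {σ R S : Type*} [CommRing R] [CommRing S] (g : R →+* S)
    (c : S) (b : σ → S) {p : MvPolynomial σ R} {m : ℕ} (hp : p.IsHomogeneous m) :
    MvPolynomial.eval₂ g (fun i => c * b i) p = c ^ m * MvPolynomial.eval₂ g b p := by
  rw [MvPolynomial.eval₂_eq, MvPolynomial.eval₂_eq, Finset.mul_sum]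
  refine Finset.sum_congr rfl fun d hd => ?_
  have hdm : ∑ i ∈ d.support, d i = m := by
    have := hp (MvPolynomial.mem_support_iff.1 hd)
    simpa [Finsupp.weight_apply, Finsupp.sum] using this
  simp only [mul_pow, Finset.prod_mul_distrib, Finset.prod_pow_eq_pow_sum, hdm]
  ring

end Chain

section Chain

open Polynomial IsLocalRing

theorem RedAniso.not_ternIso_residue {L : Type*} [Field L] {A : ValuationSubring L}
    {w : Fin 3 → L} (h : RedAniso A w) {q : L} {t : Fin 3 → A} (hq : ∀ m, q * w m = t m)
    (ht : ∃ m, residue A (t m) ≠ 0) :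
    ¬ TernIso (residue A (t 0)) (residue A (t 1)) (residue A (t 2)) := by
  obtain ⟨e, u, he, hw, hu⟩ := h
  obtain ⟨m0, hm0⟩ := ht
  have hunit : ∀ m, A.valuation (u m : L) = 1 := by
    intro m
    have := not_ternIso_ne_zero (a := fun m => residue A (u m)) hu m
    rw [← A.valuation_eq_one_iff]
    exact (residue_ne_zero_iff_isUnit _).1 this
  have hs : A.valuation (q * e) = 1 := by
    have h1 : A.valuation (t m0 : L) = 1 := by
      rw [← A.valuation_eq_one_iff]
      exact (residue_ne_zero_iff_isUnit _).1 hm0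
    rw [← hq, hw, ← mul_assoc, map_mul, hunit, mul_one] at h1
    exact h1
  let s : A := ⟨q * e, (A.valuation_le_one_iff _).1 hs.le⟩
  have hs' : residue A s ≠ 0 := by
    rw [residue_ne_zero_iff_isUnit, A.valuation_eq_one_iff]
    exact hs
  have hts : ∀ m, t m = s * u m := by
    intro m
    apply Subtype.ext
    rw [← hq, hw, ← mul_assoc]
    rfl
  rintro ⟨a, b, c, h0, e'⟩
  refine hu ⟨a, b, c, h0, ?_⟩
  rw [hts, hts, hts, map_mul, map_mul, map_mul] at e'
  refine (mul_eq_zero.1 (?_ : residue A s * _ = 0)).resolve_left hs'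
  rw [← e']
  ring

theorem exists_rescaled_chart {L : Type} [Field L] (A : ValuationSubring L)
    {d : Fin 4 → ℕ} (hpar : ∀ i j, Even (d i + d j))
    {a : Fin 4 → Fin 4 → MvPolynomial (Fin 3) A}
    (hom : ∀ i j, (a i j).IsHomogeneous ((d i + d j) / 2))
    (B : Fin 3 → L[X]) (Z : Fin 4 → L[X]) (hZ : Z ≠ 0)
    (h : ∑ i, ∑ j, MvPolynomial.eval₂ (C.comp A.subtype) B (a i j) * Z i * Z j = 0)
    {c g : L} (hc : c ≠ 0) (hg : g ≠ 0) (b : Fin 3 → A[X])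
    (hb : ∀ m, (b m).map A.subtype = C (g ^ 2)⁻¹ * (B m).comp (C c * X)) :
    ∃ Z' : Fin 4 → L[X], Z' ≠ 0 ∧
      ∑ i, ∑ j, (MvPolynomial.eval₂ C b (a i j)).map A.subtype * Z' i * Z' j = 0 := by
  refine ⟨fun k => C (g ^ d k) * (Z k).comp (C c * X), ?_, ?_⟩
  · obtain ⟨k, hk⟩ := Function.ne_iff.1 hZ
    refine Function.ne_iff.2 ⟨k, mul_ne_zero (C_ne_zero.2 (pow_ne_zero _ hg)) ?_⟩
    intro h0
    apply hk
    have := congrArg (fun p => p.comp (C c⁻¹ * X)) h0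
    simp only [comp_assoc, mul_comp, C_comp, X_comp, zero_comp] at this
    rwa [← mul_assoc, ← C_mul, mul_inv_cancel₀ hc, C_1, one_mul, comp_X] at this
  · have hB : ∀ m, (B m).comp (C c * X) = C (g ^ 2) * (b m).map A.subtype := by
      intro m
      rw [hb, ← mul_assoc, ← C_mul, mul_inv_cancel₀ (pow_ne_zero 2 hg), C_1, one_mul]
    have key : ∀ i j, (MvPolynomial.eval₂ (C.comp A.subtype) B (a i j)).comp (C c * X) =
        C (g ^ d i) * C (g ^ d j) * (MvPolynomial.eval₂ C b (a i j)).map A.subtype := by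
      intro i j
      have h1 := MvPolynomial.hom_eval₂ (a i j) (C.comp A.subtype)
        (compRingHom (C c * X)) B
      have h2 := MvPolynomial.hom_eval₂ (a i j) C (mapRingHom A.subtype) b
      simp only [coe_compRingHom_apply] at h1
      simp only [coe_mapRingHom] at h2
      rw [h1, h2]
      simp only [hB]
      rw [eval₂_mul_left_of_isHomogeneous _ _ _ (hom i j)]
      have h3 : (C (g ^ 2)) ^ ((d i + d j) / 2) = C (g ^ d i) * C (g ^ d j) := by
        rw [← C_pow, ← pow_mul, Nat.mul_div_cancel' (hpar i j).two_dvd, pow_add, C_mul]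
      rw [h3]
      congr 2
      ext x : 1
      simp
    have := congrArg (compRingHom (C c * X)) h
    simp only [map_sum, map_mul, map_zero, coe_compRingHom_apply, key] at this
    rw [← this]
    refine Finset.sum_congr rfl fun i _ => Finset.sum_congr rfl fun j _ => ?_
    ring

/-- Along the slopes of the Newton polygon of a vector of polynomials, anisotropy of the
reduced coefficient vector passes from one end of an edge to the other. -/
theorem RedAniso.of_edge {L : Type} [Field L] (A : ValuationSubring L)
    {ι : ResidueField A} (hι : ι ^ 2 = -1)
    {d : Fin 4 → ℕ} (hpar : ∀ i j, Even (d i + d j))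
    {f : Fin 4 → MvPolynomial (Fin 3) ℤ} (hf : SpecialIso f)
    {a : Fin 4 → Fin 4 → MvPolynomial (Fin 3) A}
    (hom : ∀ i j, (a i j).IsHomogeneous ((d i + d j) / 2))
    (ha : ∀ i j, MvPolynomial.map (residue A) (a i j) =
      if i = j then MvPolynomial.map (Int.castRingHom _) (f i) else 0)
    (B : Fin 3 → L[X]) (Z : Fin 4 → L[X]) (hZ : Z ≠ 0)
    (h : ∑ i, ∑ j, MvPolynomial.eval₂ (C.comp A.subtype) B (a i j) * Z i * Z j = 0)
    {c g : L} (hc : c ≠ 0) (hg : g ≠ 0) {k l : ℕ}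
    (hle : ∀ m n, A.valuation ((B m).coeff n * c ^ n) ≤ A.valuation (g ^ 2))
    (hlow : ∀ m, ∀ n < k, A.valuation ((B m).coeff n * c ^ n) < A.valuation (g ^ 2))
    (htop : ∀ m n, l < n → A.valuation ((B m).coeff n * c ^ n) < A.valuation (g ^ 2))
    (hk : ∃ m, A.valuation ((B m).coeff k * c ^ k) = A.valuation (g ^ 2))
    (hl : ∃ m, A.valuation ((B m).coeff l * c ^ l) = A.valuation (g ^ 2))
    (hred : RedAniso A (fun m => (B m).coeff k)) : RedAniso A (fun m => (B m).coeff l) := by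
  have hg2 : g ^ 2 ≠ 0 := pow_ne_zero 2 hg
  have hvg : 0 < A.valuation (g ^ 2) := by
    rw [zero_lt_iff]; simpa [Valuation.zero_iff] using hg
  have hcoef : ∀ m n, (C (g ^ 2)⁻¹ * (B m).comp (C c * X)).coeff n =
      (B m).coeff n * c ^ n / g ^ 2 := by
    intro m n
    rw [coeff_C_mul, comp_C_mul_X_coeff]
    field_simp
  have hmem : ∀ m n, (C (g ^ 2)⁻¹ * (B m).comp (C c * X)).coeff n ∈ A := by
    intro m n
    rw [hcoef, ← A.valuation_le_one_iff, map_div₀]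
    exact div_le_one_of_le₀ (hle m n) zero_le
  choose b hb using fun m => exists_lift_polynomial A _ (hmem m)
  have hbc : ∀ m n, ((b m).coeff n : L) = (B m).coeff n * c ^ n / g ^ 2 := by
    intro m n
    rw [← hcoef, ← hb, coeff_map]; rfl
  have hres0 : ∀ m n, A.valuation ((B m).coeff n * c ^ n) < A.valuation (g ^ 2) →
      residue A ((b m).coeff n) = 0 := by
    intro m n hmn
    rw [residue_eq_zero_iff, A.valuation_lt_one_iff, hbc, map_div₀]
    exact (div_lt_one₀ hvg).2 hmn
  have hres1 : ∀ m n, A.valuation ((B m).coeff n * c ^ n) = A.valuation (g ^ 2) →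
      residue A ((b m).coeff n) ≠ 0 := by
    intro m n hmn
    rw [residue_ne_zero_iff_isUnit, A.valuation_eq_one_iff, hbc, map_div₀, hmn]
    exact div_self hvg.ne'
  obtain ⟨Z1, hZ1, h1⟩ := exists_rescaled_chart A hpar hom B Z hZ h hc hg b hb
  obtain ⟨Z2, hZ2, h2⟩ := exists_reduced_isotropic A ha b Z1 hZ1 h1
  have h3 : ¬ TernIso (residue A ((b 0).coeff k)) (residue A ((b 1).coeff k))
      (residue A ((b 2).coeff k)) := by
    refine hred.not_ternIso_residue (q := c ^ k / g ^ 2) (t := fun m => (b m).coeff k) ?_ ?_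
    · intro m
      rw [hbc]; ring
    · obtain ⟨m, hm⟩ := hk
      exact ⟨m, hres1 m k hm⟩
  have h4 := hf.not_ternIso_top hι (k := k) (l := l) (fun m => (b m).map (residue A)) ?_ ?_ Z2 hZ2
    h2 (by simpa only [coeff_map] using h3) ?_
  · simp only [coeff_map] at h4
    refine ⟨g ^ 2 / c ^ l, fun m => (b m).coeff l, div_ne_zero hg2 (pow_ne_zero l hc), fun m => ?_, h4⟩
    rw [hbc]
    field_simp
  · intro m
    rw [X_pow_dvd_iff]
    intro n hn
    rw [coeff_map]
    exact hres0 m n (hlow m n hn)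
  · intro m
    rw [natDegree_le_iff_coeff_eq_zero]
    intro n hn
    rw [coeff_map]
    exact hres0 m n (htop m n hn)
  · obtain ⟨m, hm⟩ := hl
    exact ⟨m, by simpa only [coeff_map] using hres1 m l hm⟩

end Chain

section Chain

open Polynomial IsLocalRing

/-- If the reduced constant coefficient vector is anisotropic, then so is the top one. -/
theorem RedAniso.of_coeff_zero {L : Type} [Field L] (A : ValuationSubring L)
    (hdiv : ∀ x : L, x ≠ 0 → ∀ n, 0 < n → ∃ y : L, A.valuation y ^ n = A.valuation x)
    {ι : ResidueField A} (hι : ι ^ 2 = -1)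
    {d : Fin 4 → ℕ} (hpar : ∀ i j, Even (d i + d j))
    {f : Fin 4 → MvPolynomial (Fin 3) ℤ} (hf : SpecialIso f)
    {a : Fin 4 → Fin 4 → MvPolynomial (Fin 3) A}
    (hom : ∀ i j, (a i j).IsHomogeneous ((d i + d j) / 2))
    (ha : ∀ i j, MvPolynomial.map (residue A) (a i j) =
      if i = j then MvPolynomial.map (Int.castRingHom _) (f i) else 0)
    (B : Fin 3 → L[X]) (Z : Fin 4 → L[X]) (hZ : Z ≠ 0)
    (h : ∑ i, ∑ j, MvPolynomial.eval₂ (C.comp A.subtype) B (a i j) * Z i * Z j = 0)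
    (N : ℕ) (hN : ∀ m, (B m).natDegree ≤ N) (hNne : ∃ m, (B m).coeff N ≠ 0)
    (h0 : RedAniso A (fun m => (B m).coeff 0)) : RedAniso A (fun m => (B m).coeff N) := by
  classical
  let v := A.valuation
  have hv0 : ∀ x : L, v x = 0 ↔ x = 0 := fun x => Valuation.zero_iff _
  -- coefficients of maximal valuation
  have hex : ∀ j, ∃ m, ∀ n, v ((B n).coeff j) ≤ v ((B m).coeff j) := fun j => by
    obtain ⟨m, -, hm⟩ := Finset.exists_max_image Finset.univ (fun n => v ((B n).coeff j))
      ⟨0, Finset.mem_univ _⟩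
    exact ⟨m, fun n => hm n (Finset.mem_univ _)⟩
  choose μ hμ using hex
  set r : ℕ → L := fun j => (B (μ j)).coeff j with hr
  have hrle : ∀ n j, v ((B n).coeff j) ≤ v (r j) := fun n j => hμ j n
  have hrN : ∀ j, N < j → r j = 0 := fun j hj =>
    coeff_eq_zero_of_natDegree_lt ((hN _).trans_lt hj)
  have hrNne : r N ≠ 0 := by
    obtain ⟨m, hm⟩ := hNne
    intro h
    have := hrle m N
    rw [h, map_zero, le_zero_iff, hv0] at this
    exact hm this
  have key : ∀ n i, N = i + n → RedAniso A (fun m => (B m).coeff i) →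
      (∀ c : L, c ≠ 0 → (∃ j > i, v (r i * c ^ i) ≤ v (r j * c ^ j)) →
        ∀ j < i, v (r j * c ^ j) < v (r i * c ^ i)) →
      RedAniso A (fun m => (B m).coeff N) := by
    intro n
    induction n using Nat.strong_induction_on with
    | _ n ih =>
    intro i hi hred hslope
    rcases Nat.eq_zero_or_pos n with rfl | hn
    · rw [hi]; exact hred
    have hri : r i ≠ 0 := hred.valuation.1 (μ i)
    set S := (Finset.Ioc i N).filter (fun j => r j ≠ 0) with hS
    have hNS : N ∈ S := by simp [hS, hrNne]; omega
    have hSi : ∀ j ∈ S, i < j ∧ r j ≠ 0 := by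
      intro j hj
      simp only [hS, Finset.mem_filter, Finset.mem_Ioc] at hj
      exact ⟨hj.1.1, hj.2⟩
    have hcs : ∀ j, ∃ c : L, j ∈ S → c ≠ 0 ∧ v c ^ (j - i) = v (r i / r j) := by
      intro j
      by_cases hj : j ∈ S
      · have hne : r i / r j ≠ 0 := div_ne_zero hri (hSi j hj).2
        have hpos : 0 < j - i := Nat.sub_pos_of_lt (hSi j hj).1
        obtain ⟨c, hc⟩ := hdiv _ hne _ hpos
        refine ⟨c, fun _ => ⟨?_, hc⟩⟩
        rintro rfl
        rw [map_zero, zero_pow hpos.ne', eq_comm, Valuation.zero_iff] at hc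
        exact hne hc
      · exact ⟨0, fun h => (hj h).elim⟩
    choose cs hcs using hcs
    obtain ⟨j0, hj0, hmin⟩ := Finset.exists_min_image S (fun j => v (cs j)) ⟨N, hNS⟩
    set c := cs j0 with hc
    have hc0 : c ≠ 0 := (hcs j0 hj0).1
    have hvc : 0 < v c := zero_lt_iff.2 (by rwa [Ne, hv0])
    have hrj : ∀ j ∈ S, ∀ t : L, v t ^ (j - i) ≤ v (r i / r j) →
        v (r j * t ^ j) ≤ v (r i * t ^ i) := by
      intro j hj t ht
      have hpos : 0 < v (r j) := zero_lt_iff.2 (by rw [Ne, hv0]; exact (hSi j hj).2)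
      rw [map_div₀, le_div_iff₀ hpos] at ht
      have : j = i + (j - i) := by have := (hSi j hj).1; omega
      rw [this, pow_add, map_mul, map_mul, map_mul, ← this, map_pow, map_pow]
      calc v (r j) * (v t ^ i * v t ^ (j - i)) = (v t ^ (j - i) * v (r j)) * v t ^ i := by
            rw [mul_comm (v t ^ i), ← mul_assoc, mul_comm (v (r j))]
        _ ≤ v (r i) * v t ^ i := by gcongr
    have hSle : ∀ j ∈ S, v (r j * c ^ j) ≤ v (r i * c ^ i) := by
      intro j hj
      refine hrj j hj c ?_
      rw [← (hcs j hj).2]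
      exact pow_le_pow_left₀ zero_le (hmin j hj) _
    have hj0eq : v (r j0 * c ^ j0) = v (r i * c ^ i) := by
      have hpos : v (r j0) ≠ 0 := by rw [Ne, hv0]; exact (hSi j0 hj0).2
      have e := (hcs j0 hj0).2
      rw [map_div₀, eq_div_iff hpos] at e
      have : j0 = i + (j0 - i) := by have := (hSi j0 hj0).1; omega
      rw [map_mul, map_mul, map_pow, map_pow, ← e]
      conv_lhs => rw [this, pow_add]
      rw [← this]
      rw [mul_comm, mul_comm (v c ^ i), mul_assoc, mul_assoc, mul_comm (v (r j0))]
    have hgtle : ∀ j, i < j → v (r j * c ^ j) ≤ v (r i * c ^ i) := by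
      intro j hj
      by_cases hjS : j ∈ S
      · exact hSle j hjS
      · have : r j = 0 := by
          by_contra hne
          refine hjS ?_
          simp only [hS, Finset.mem_filter, Finset.mem_Ioc]
          exact ⟨⟨hj, not_lt.1 fun hlt => hne (hrN j hlt)⟩, hne⟩
        rw [this, zero_mul, map_zero]
        exact zero_le
    have hltlt := hslope c hc0 ⟨j0, (hSi j0 hj0).1, hj0eq.ge⟩
    set T := S.filter (fun j => v (r j * c ^ j) = v (r i * c ^ i)) with hT
    have hTne : T.Nonempty := ⟨j0, Finset.mem_filter.2 ⟨hj0, hj0eq⟩⟩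
    set l := T.max' hTne with hl
    have hlT : l ∈ T := T.max'_mem hTne
    have hlS : l ∈ S := (Finset.mem_filter.1 hlT).1
    have hleq : v (r l * c ^ l) = v (r i * c ^ i) := (Finset.mem_filter.1 hlT).2
    have hil : i < l := (hSi l hlS).1
    have hlN : l ≤ N := by
      have := (Finset.mem_filter.1 hlS).1
      exact (Finset.mem_Ioc.1 this).2
    have hMpos : 0 < v (r i * c ^ i) := by
      rw [zero_lt_iff, Ne, hv0]
      exact mul_ne_zero hri (pow_ne_zero _ hc0)
    have hgtl : ∀ j, l < j → v (r j * c ^ j) < v (r i * c ^ i) := by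
      intro j hj
      refine lt_of_le_of_ne (hgtle j (hil.trans hj)) fun heq => ?_
      have hjS : j ∈ S := by
        simp only [hS, Finset.mem_filter, Finset.mem_Ioc]
        have hne : r j ≠ 0 := by
          intro h0
          rw [h0, zero_mul, map_zero] at heq
          exact hMpos.ne heq
        exact ⟨⟨hil.trans hj, not_lt.1 fun hlt => hne (hrN j hlt)⟩, hne⟩
      have := T.le_max' j (Finset.mem_filter.2 ⟨hjS, heq⟩)
      omega
    have hall : ∀ j, v (r j * c ^ j) ≤ v (r i * c ^ i) := by
      intro j
      rcases lt_trichotomy j i with hj | rfl | hj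
      · exact (hltlt j hj).le
      · exact le_rfl
      · exact hgtle j hj
    obtain ⟨g, hg⟩ := hdiv (r i * c ^ i) (mul_ne_zero hri (pow_ne_zero _ hc0)) 2 two_pos
    rw [← map_pow] at hg
    have hg0 : g ≠ 0 := by
      rintro rfl
      rw [zero_pow two_ne_zero, map_zero] at hg
      exact hMpos.ne hg
    have hBr : ∀ m j, v ((B m).coeff j * c ^ j) ≤ v (r j * c ^ j) := by
      intro m j
      rw [map_mul, map_mul]
      gcongr
      exact hrle m j
    refine ih (N - l) (by omega) l (by omega) ?_ ?_
    · refine RedAniso.of_edge A hι hpar hf hom ha B Z hZ h hc0 hg0 (k := i) (l := l) ?_ ?_ ?_ ?_ ?_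
        hred
      · intro m j
        rw [hg]
        exact (hBr m j).trans (hall j)
      · intro m j hj
        rw [hg]
        exact (hBr m j).trans_lt (hltlt j hj)
      · intro m j hj
        rw [hg]
        exact (hBr m j).trans_lt (hgtl j hj)
      · exact ⟨μ i, hg.symm⟩
      · exact ⟨μ l, hleq.trans hg.symm⟩
    · rintro c1 hc1 ⟨j', hj', hle'⟩
      have hvc1 : v c < v c1 := by
        by_contra hcon
        have hcon := not_lt.1 hcon
        have hlt : v (r j' * c ^ j') < v (r l * c ^ l) := by rw [hleq]; exact hgtl j' hj'
        have hj'' : j' = l + (j' - l) := by omega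
        have hvc1' : 0 < v c1 := zero_lt_iff.2 (by rwa [Ne, hv0])
        simp only [map_mul, map_pow] at hlt hle'
        have e1 : v (r l) ≤ v (r j') * v c1 ^ (j' - l) := by
          rw [hj'', pow_add, ← hj'', mul_comm (v c1 ^ l), ← mul_assoc] at hle'
          exact le_of_mul_le_mul_right hle' (pow_pos hvc1' l)
        have e2 : v (r l) ≤ v (r j') * v c ^ (j' - l) := e1.trans (by gcongr)
        have e3 : v (r l) * v c ^ l ≤ v (r j') * v c ^ j' := by
          rw [hj'', pow_add, ← hj'', mul_comm (v c ^ l), ← mul_assoc]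
          gcongr
        exact absurd hlt (not_lt.2 e3)
      intro j hj
      have hjle : v (r j) * v c ^ j ≤ v (r l) * v c ^ l := by
        have := (hall j).trans hleq.ge
        simpa only [map_mul, map_pow] using this
      have hrl : 0 < v (r l) := zero_lt_iff.2 (by rw [Ne, hv0]; exact (hSi l hlS).2)
      have hlj : l = j + (l - j) := by omega
      rw [map_mul, map_mul, map_pow, map_pow]
      have e1 : v (r j) ≤ v (r l) * v c ^ (l - j) := by
        rw [hlj, pow_add, ← hlj, mul_comm (v c ^ j), ← mul_assoc] at hjle
        exact le_of_mul_le_mul_right hjle (pow_pos hvc j)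
      have e2 : v (r j) < v (r l) * v c1 ^ (l - j) := by
        refine e1.trans_lt ?_
        exact mul_lt_mul_of_pos_left
          (pow_lt_pow_left₀ hvc1 zero_le (by omega)) hrl
      have hvc1' : 0 < v c1 := hvc.trans hvc1
      rw [hlj, pow_add, ← hlj, mul_comm (v c1 ^ j), ← mul_assoc]
      exact mul_lt_mul_of_pos_right e2 (pow_pos hvc1' j)
  refine key N 0 (by omega) h0 ?_
  intro c _ _ j hj
  omega

end Chain

/-! ### Cassels–Pfister for diagonal forms -/

section CasselsPfister

open Polynomial

variable {ι : Type} [Fintype ι]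

theorem coeff_two_mul_sum_sq {K : Type*} [CommRing K] (θ : ι → K) (r : ι → K[X]) (n : ℕ)
    (hr : ∀ i, (r i).natDegree ≤ n) :
    (∑ i, C (θ i) * r i ^ 2).coeff (2 * n) = ∑ i, θ i * (r i).coeff n ^ 2 := by
  rw [finsetSum_coeff]
  refine Finset.sum_congr rfl fun i _ => ?_
  rw [coeff_C_mul, coeff_pow_of_natDegree_le (hr i)]

/-- A diagonal form without nontrivial zeros. -/
def DiagAniso {K : Type*} [CommRing K] (θ : ι → K) : Prop :=
  ∀ w : ι → K, ∑ i, θ i * w i ^ 2 = 0 → w = 0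

theorem exists_natDegree_bound {K : Type*} [CommRing K] (r : ι → K[X]) (hr : r ≠ 0) :
    ∃ n, (∀ i, (r i).natDegree ≤ n) ∧ ∃ i, (r i).coeff n ≠ 0 := by
  classical
  obtain ⟨i0, hi0⟩ := Function.ne_iff.1 hr
  obtain ⟨i, -, hi⟩ := Finset.exists_max_image Finset.univ (fun i => (r i).degree)
    ⟨i0, Finset.mem_univ _⟩
  have hne : r i ≠ 0 := by
    intro h
    have := hi i0 (Finset.mem_univ _)
    rw [h, degree_zero, le_bot_iff, degree_eq_bot] at this
    exact hi0 this
  refine ⟨(r i).natDegree, fun j => natDegree_le_natDegree (hi j (Finset.mem_univ _)), i, ?_⟩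
  exact leadingCoeff_ne_zero.2 hne

theorem DiagAniso.polynomial {K : Type*} [CommRing K] {θ : ι → K} (h : DiagAniso θ) :
    DiagAniso (fun i => C (θ i)) := by
  intro r hr
  by_contra hne
  obtain ⟨n, hn, i, hi⟩ := exists_natDegree_bound r hne
  have := coeff_two_mul_sum_sq θ r n hn
  rw [hr, coeff_zero] at this
  exact hi (congrFun (h _ this.symm) i)

theorem DiagAniso.fractionRing {R K : Type*} [CommRing R] [IsDomain R] [Field K] [Algebra R K]
    [IsFractionRing R K] {θ : ι → R} (h : DiagAniso θ) :
    DiagAniso (fun i => algebraMap R K (θ i)) := by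
  classical
  intro w hw
  obtain ⟨d, hd⟩ := IsLocalization.exist_integer_multiples_of_finite (nonZeroDivisors R) w
  choose s hs using hd
  have hd0 : algebraMap R K d ≠ 0 := IsFractionRing.to_map_ne_zero_of_mem_nonZeroDivisors d.2
  have hs' : ∀ i, algebraMap R K (s i) = algebraMap R K d * w i := fun i => by
    rw [hs, Algebra.smul_def]
  have : s = 0 := by
    apply h
    apply IsFractionRing.injective R K
    rw [map_sum, map_zero, ← mul_zero (algebraMap R K d ^ 2), ← hw, Finset.mul_sum]
    refine Finset.sum_congr rfl fun i _ => ?_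
    rw [map_mul, map_pow, hs']
    ring
  ext i
  have := hs' i
  rw [‹s = 0›, Pi.zero_apply, map_zero, eq_comm, mul_eq_zero] at this
  exact this.resolve_left hd0

theorem cassels_pfister {K : Type*} [Field K] {θ : ι → K} (hθ : DiagAniso θ) (ℓ : ι → K)
    (P : K[X]) : ∀ (n : ℕ) (w : ι → K[X]) (g : K[X]), g.natDegree = n → g ≠ 0 →
    ∑ i, C (θ i) * w i ^ 2 = P * g ^ 2 → ∑ i, C (ℓ i) * w i = 0 →
    ∃ w' : ι → K[X], ∑ i, C (θ i) * w' i ^ 2 = P ∧ ∑ i, C (ℓ i) * w' i = 0 := by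
  intro n
  induction n using Nat.strong_induction_on with
  | _ n ih =>
  intro w g hgn hg hw hℓ
  set s : ι → K[X] := fun i => w i / g with hs
  set r : ι → K[X] := fun i => w i % g with hr
  have hwsr : ∀ i, w i = g * s i + r i := fun i => (EuclideanDomain.div_add_mod (w i) g).symm
  have hrdeg : ∀ i, (r i).degree < g.degree := fun i => degree_mod_lt _ hg
  -- the linear constraint
  have hℓ1 : g * (∑ i, C (ℓ i) * s i) + ∑ i, C (ℓ i) * r i = 0 := by
    rw [← hℓ, Finset.mul_sum, ← Finset.sum_add_distrib]
    refine Finset.sum_congr rfl fun i _ => ?_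
    rw [hwsr i]; ring
  have hℓrdeg : (∑ i, C (ℓ i) * r i).degree < g.degree := by
    refine (degree_sum_le _ _).trans_lt ?_
    rw [Finset.sup_lt_iff (bot_lt_iff_ne_bot.2 (by simpa [degree_eq_bot] using hg))]
    intro i _
    refine lt_of_le_of_lt ?_ (hrdeg i)
    rw [← smul_eq_C_mul]
    exact degree_smul_le _ _
  have hℓs : ∑ i, C (ℓ i) * s i = 0 := by
    by_contra hne
    have h1 : ∑ i, C (ℓ i) * r i = - (g * (∑ i, C (ℓ i) * s i)) := by linear_combination hℓ1
    rw [h1, degree_neg, degree_mul] at hℓrdeg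
    have h2 : (0 : WithBot ℕ) ≤ (∑ i, C (ℓ i) * s i).degree := zero_le_degree_iff.2 hne
    exact absurd hℓrdeg (not_lt.2 (le_add_of_nonneg_right h2))
  have hℓr : ∑ i, C (ℓ i) * r i = 0 := by
    rw [hℓs, mul_zero, zero_add] at hℓ1
    exact hℓ1
  set qs := ∑ i, C (θ i) * s i ^ 2 with hqs
  set qr := ∑ i, C (θ i) * r i ^ 2 with hqr
  set bb := ∑ i, C (θ i) * (r i * s i) with hbb
  have hqw : g ^ 2 * qs + 2 * g * bb + qr = P * g ^ 2 := by
    rw [← hw, hqs, hqr, hbb, Finset.mul_sum, Finset.mul_sum, ← Finset.sum_add_distrib,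
      ← Finset.sum_add_distrib]
    refine Finset.sum_congr rfl fun i _ => ?_
    rw [hwsr i]; ring
  by_cases hr0 : r = 0
  · refine ⟨s, ?_, hℓs⟩
    have : qr = 0 := by simp [hqr, hr0]
    have hb0 : bb = 0 := by simp [hbb, hr0]
    rw [this, hb0] at hqw
    have hg2 : g ^ 2 ≠ 0 := pow_ne_zero 2 hg
    apply mul_left_cancel₀ hg2
    linear_combination hqw
  have hqr0 : qr ≠ 0 := fun h => hr0 (hθ.polynomial r h)
  set g' := P * g - g * qs - 2 * bb with hg'
  have hgg' : qr = g * g' := by rw [hg']; linear_combination hqw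
  have hg'0 : g' ≠ 0 := by
    intro h
    rw [h, mul_zero] at hgg'
    exact hqr0 hgg'
  have hqrdeg : qr.natDegree < 2 * g.natDegree := by
    obtain ⟨m, hm, i, hi⟩ := exists_natDegree_bound r hr0
    have h1 : (r i).natDegree < g.natDegree :=
      natDegree_lt_natDegree (fun h => by simp [h] at hi) (hrdeg i)
    have h2 : m ≤ (r i).natDegree := le_natDegree_of_ne_zero hi
    have h3 : qr.natDegree ≤ 2 * m := by
      refine natDegree_sum_le_of_forall_le _ _ fun j _ => ?_
      refine (natDegree_C_mul_le _ _).trans (natDegree_pow_le.trans ?_)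
      exact Nat.mul_le_mul_left 2 (hm j)
    omega
  have hg'deg : g'.natDegree < n := by
    rw [hgg', natDegree_mul hg hg'0] at hqrdeg
    omega
  refine ih _ hg'deg (fun i => g' * s i + (qs - P) * r i) g' rfl hg'0 ?_ ?_
  · have : ∑ i, C (θ i) * (g' * s i + (qs - P) * r i) ^ 2 =
        g' ^ 2 * qs + 2 * (g' * (qs - P)) * bb + (qs - P) ^ 2 * qr := by
      rw [hqs, hqr, hbb, Finset.mul_sum, Finset.mul_sum, Finset.mul_sum, ← Finset.sum_add_distrib,
        ← Finset.sum_add_distrib]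
      refine Finset.sum_congr rfl fun i _ => ?_
      ring
    rw [this, hgg', hg']
    ring
  · have : ∑ i, C (ℓ i) * (g' * s i + (qs - P) * r i) =
        g' * (∑ i, C (ℓ i) * s i) + (qs - P) * ∑ i, C (ℓ i) * r i := by
      rw [Finset.mul_sum, Finset.mul_sum, ← Finset.sum_add_distrib]
      refine Finset.sum_congr rfl fun i _ => ?_
      ring
    rw [this, hℓs, hℓr, mul_zero, mul_zero, add_zero]

/-- Representation of `c₀ + c₁X²` by an anisotropic diagonal form. -/
theorem DiagAniso.exists_of_quadratic {K : Type*} [Field K] (h2 : (2 : K) ≠ 0) {θ : ι → K}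
    (hθ : DiagAniso θ) (ℓ : ι → K) (c₀ c₁ : K) (w : ι → K[X]) (g : K[X]) (hg : g ≠ 0)
    (hw : ∑ i, C (θ i) * w i ^ 2 = (C c₀ + C c₁ * X ^ 2) * g ^ 2)
    (hℓ : ∑ i, C (ℓ i) * w i = 0) :
    ∃ w₀ w₁ : ι → K, ∑ i, θ i * w₀ i ^ 2 = c₀ ∧ ∑ i, θ i * w₁ i ^ 2 = c₁ ∧
      ∑ i, θ i * (w₀ i * w₁ i) = 0 ∧ ∑ i, ℓ i * w₀ i = 0 ∧ ∑ i, ℓ i * w₁ i = 0 := by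
  obtain ⟨w', hw', hℓ'⟩ := cassels_pfister hθ ℓ _ _ w g rfl hg hw hℓ
  have hdeg : ∀ i, (w' i).natDegree ≤ 1 := by
    by_cases h0 : w' = 0
    · simp [h0]
    obtain ⟨n, hn, i, hi⟩ := exists_natDegree_bound w' h0
    by_contra hcon
    push Not at hcon
    obtain ⟨j, hj⟩ := hcon
    have hn2 : 2 ≤ n := (Nat.succ_le_of_lt hj).trans (hn j)
    have := coeff_two_mul_sum_sq θ w' n hn
    rw [hw', coeff_eq_zero_of_natDegree_lt] at this
    · exact hi (congrFun (hθ _ this.symm) i)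
    · have : (C c₀ + C c₁ * X ^ 2).natDegree ≤ 2 := by compute_degree
      omega
  have hlin : ∀ i, w' i = C ((w' i).coeff 1) * X + C ((w' i).coeff 0) := fun i =>
    eq_X_add_C_of_natDegree_le_one (hdeg i)
  set w₀ : ι → K := fun i => (w' i).coeff 0
  set w₁ : ι → K := fun i => (w' i).coeff 1
  have hlin : ∀ i, w' i = C (w₁ i) * X + C (w₀ i) := hlin
  have hexp : C (∑ i, θ i * w₀ i ^ 2) + C (2 * ∑ i, θ i * (w₀ i * w₁ i)) * X +
      C (∑ i, θ i * w₁ i ^ 2) * X ^ 2 = C c₀ + C c₁ * X ^ 2 := by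
    rw [← hw']
    simp only [map_sum, C_mul, Finset.sum_mul, Finset.mul_sum, ← Finset.sum_add_distrib]
    refine Finset.sum_congr rfl fun i _ => ?_
    rw [hlin i]
    simp only [C_pow]
    rw [show (C (2 : K) : K[X]) = 2 from rfl]
    ring
  have hexp' : C (∑ i, ℓ i * w₀ i) + C (∑ i, ℓ i * w₁ i) * X = 0 := by
    rw [← hℓ']
    simp only [map_sum, C_mul, Finset.sum_mul, ← Finset.sum_add_distrib]
    refine Finset.sum_congr rfl fun i _ => ?_
    rw [hlin i]
    ring
  refine ⟨w₀, w₁, ?_, ?_, ?_, ?_, ?_⟩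
  · have := congrArg (fun p => p.coeff 0) hexp
    simp only [coeff_add, coeff_C_mul, coeff_X_pow, coeff_C, coeff_X] at this
    norm_num at this
    exact this
  · have := congrArg (fun p => p.coeff 2) hexp
    simp only [coeff_add, coeff_C_mul, coeff_X_pow, coeff_C, coeff_X] at this
    norm_num at this
    exact this
  · have := congrArg (fun p => p.coeff 1) hexp
    simp only [coeff_add, coeff_C_mul, coeff_X_pow, coeff_C, coeff_X] at this
    norm_num at this
    exact this.resolve_left h2
  · simpa using congrArg (fun p => p.coeff 0) hexp'
  · simpa [coeff_X, coeff_C] using congrArg (fun p => p.coeff 1) hexp'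

end CasselsPfister

section CasselsPfister

open Polynomial

variable {ι : Type} [Fintype ι]

theorem DiagAniso.exists_reflection {K : Type*} [Field K] {θ : ι → K}
    (hθ : DiagAniso θ) (x y z : ι → K) (hxy : ∑ i, θ i * (x i * y i) = 0)
    (hyz : ∑ i, θ i * y i ^ 2 = ∑ i, θ i * z i ^ 2) :
    ∃ x' : ι → K, ∑ i, θ i * x' i ^ 2 = ∑ i, θ i * x i ^ 2 ∧ ∑ i, θ i * (x' i * z i) = 0 := by
  by_cases hne : y = z
  · exact ⟨x, rfl, hne ▸ hxy⟩
  set D : ι → K := fun i => y i - z i with hD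
  set q := ∑ i, θ i * D i ^ 2 with hq
  have hq0 : q ≠ 0 := by
    intro h
    have := hθ D h
    exact hne (funext fun i => sub_eq_zero.1 (congrFun this i))
  set xz := ∑ i, θ i * (x i * z i) with hxz
  set Dz := ∑ i, θ i * (D i * z i) with hDz
  have hxD : ∑ i, θ i * (x i * D i) = - xz := by
    have : ∑ i, θ i * (x i * D i) = ∑ i, θ i * (x i * y i) - xz := by
      rw [hxz, ← Finset.sum_sub_distrib]
      exact Finset.sum_congr rfl fun i _ => by simp only [hD]; ring
    rw [this, hxy, zero_sub]
  have hqDz : q = -2 * Dz := by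
    have : q = ∑ i, θ i * y i ^ 2 - ∑ i, θ i * z i ^ 2 - 2 * Dz := by
      rw [hq, hDz, Finset.mul_sum, ← Finset.sum_sub_distrib, ← Finset.sum_sub_distrib]
      exact Finset.sum_congr rfl fun i _ => by simp only [hD]; ring
    rw [this, hyz]; ring
  set t := 2 * xz / q with ht
  refine ⟨fun i => x i + t * D i, ?_, ?_⟩
  · have : ∑ i, θ i * (x i + t * D i) ^ 2 =
        ∑ i, θ i * x i ^ 2 + 2 * t * ∑ i, θ i * (x i * D i) + t ^ 2 * q := by
      rw [hq, Finset.mul_sum, Finset.mul_sum, ← Finset.sum_add_distrib, ← Finset.sum_add_distrib]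
      exact Finset.sum_congr rfl fun i _ => by ring
    rw [this, hxD, ht]
    field_simp
    ring
  · have : ∑ i, θ i * ((x i + t * D i) * z i) = xz + t * Dz := by
      rw [hxz, hDz, Finset.mul_sum, ← Finset.sum_add_distrib]
      exact Finset.sum_congr rfl fun i _ => by ring
    rw [this, ht]
    field_simp
    rw [hqDz]
    ring

theorem exists_clear_denominators {R K : Type*} [CommRing R] [IsDomain R] [Field K] [Algebra R K]
    [IsFractionRing R K] (W : ι → K) :
    ∃ (g : R) (w : ι → R), g ≠ 0 ∧ ∀ i, algebraMap R K (w i) = algebraMap R K g * W i := by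
  classical
  obtain ⟨d, hd⟩ := IsLocalization.exist_integer_multiples_of_finite (nonZeroDivisors R) W
  choose s hs using hd
  exact ⟨d, s, nonZeroDivisors.ne_zero d.2, fun i => by rw [hs, Algebra.smul_def]⟩

/-- Representation of `c₀ + c₁X²` over the rational function field. -/
theorem DiagAniso.exists_of_quadratic_fraction {K K₁ : Type*} [Field K] [Field K₁]
    [Algebra K[X] K₁] [IsFractionRing K[X] K₁] (h2 : (2 : K) ≠ 0) {θ : ι → K}
    (hθ : DiagAniso θ) (ℓ : ι → K) (c₀ c₁ : K) (W : ι → K₁)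
    (hW : ∑ i, algebraMap K[X] K₁ (C (θ i)) * W i ^ 2 =
      algebraMap K[X] K₁ (C c₀ + C c₁ * X ^ 2))
    (hℓ : ∑ i, algebraMap K[X] K₁ (C (ℓ i)) * W i = 0) :
    ∃ w₀ w₁ : ι → K, ∑ i, θ i * w₀ i ^ 2 = c₀ ∧ ∑ i, θ i * w₁ i ^ 2 = c₁ ∧
      ∑ i, θ i * (w₀ i * w₁ i) = 0 ∧ ∑ i, ℓ i * w₀ i = 0 ∧ ∑ i, ℓ i * w₁ i = 0 := by
  obtain ⟨g, w, hg, hw⟩ := exists_clear_denominators (R := K[X]) W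
  refine hθ.exists_of_quadratic h2 ℓ c₀ c₁ w g hg ?_ ?_
  · apply IsFractionRing.injective K[X] K₁
    rw [map_mul, ← hW, map_sum, Finset.sum_mul]
    refine Finset.sum_congr rfl fun i _ => ?_
    rw [map_mul, map_pow, hw, map_pow]; ring
  · apply IsFractionRing.injective K[X] K₁
    rw [map_zero, ← mul_zero (algebraMap K[X] K₁ g), ← hℓ, map_sum, Finset.mul_sum]
    refine Finset.sum_congr rfl fun i _ => ?_
    rw [map_mul, hw]; ring

/-- If a multiple of `c₀ + c₁X² + c₂Y²` by a nonzero square is a value of an anisotropic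
diagonal form, then the form has orthogonal vectors with values `c₀`, `c₁`, `c₂`. -/
theorem DiagAniso.exists_orthogonal {K : Type*} [Field K] (h2 : (2 : K) ≠ 0) {θ : ι → K}
    (hθ : DiagAniso θ) (c₀ c₁ c₂ : K) (w : ι → K[X][X]) (g : K[X][X]) (hg : g ≠ 0)
    (hw : ∑ i, C (C (θ i)) * w i ^ 2 =
      (C (C c₀ + C c₁ * X ^ 2) + C (C c₂) * X ^ 2) * g ^ 2) :
    ∃ w₀ w₁ w₂ : ι → K, ∑ i, θ i * w₀ i ^ 2 = c₀ ∧ ∑ i, θ i * w₁ i ^ 2 = c₁ ∧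
      ∑ i, θ i * w₂ i ^ 2 = c₂ ∧ ∑ i, θ i * (w₀ i * w₁ i) = 0 ∧
      ∑ i, θ i * (w₀ i * w₂ i) = 0 ∧ ∑ i, θ i * (w₁ i * w₂ i) = 0 := by
  let K₁ := FractionRing K[X]
  let φ : K[X] →+* K₁ := algebraMap K[X] K₁
  have hφ : Function.Injective φ := IsFractionRing.injective K[X] K₁
  have h2' : (2 : K₁) ≠ 0 := by
    have h : (C 2 : K[X]) ≠ 0 := C_ne_zero.2 h2
    have := (map_ne_zero_iff φ hφ).2 h
    rwa [show (C 2 : K[X]) = 2 from rfl, map_ofNat] at this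
  have hθ₁ : DiagAniso (fun i => φ (C (θ i))) := hθ.polynomial.fractionRing
  obtain ⟨W₀, W₁, e0, e1, e01, -, -⟩ := hθ₁.exists_of_quadratic h2' 0
    (φ (C c₀ + C c₁ * X ^ 2)) (φ (C c₂)) (fun i => (w i).map φ) (g.map φ)
    ((Polynomial.map_ne_zero_iff hφ).2 hg) (by
      have := congrArg (Polynomial.map φ) hw
      simpa [Polynomial.map_sum] using this) (by simp)
  obtain ⟨w₂, -, f2, -⟩ := hθ.exists_of_quadratic_fraction h2 0 c₂ 0 W₁ (by simpa using e1)
    (by simp)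
  have f2 : ∑ i, θ i * w₂ i ^ 2 = c₂ := f2
  obtain ⟨W₀', e0', e02⟩ := hθ₁.exists_reflection W₀ W₁ (fun i => φ (C (w₂ i))) e01 (by
    rw [e1, ← f2]
    simp only [map_sum, map_mul, map_pow])
  obtain ⟨w₀, w₁, g0, g1, g01, g02, g12⟩ := hθ.exists_of_quadratic_fraction h2
    (fun i => θ i * w₂ i) c₀ c₁ W₀' (e0'.trans e0) (by
      rw [← e02]
      refine Finset.sum_congr rfl fun i _ => ?_
      simp only [map_mul, φ]
      ring)
  refine ⟨w₀, w₁, w₂, g0, g1, f2, g01, ?_, ?_⟩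
  · rw [← g02]
    exact Finset.sum_congr rfl fun i _ => by ring
  · rw [← g12]
    exact Finset.sum_congr rfl fun i _ => by ring

theorem DiagAniso.adjoint {K : Type*} [CommRing K] [IsDomain K] {a b c : K}
    (h : DiagAniso ![a, b, c]) : a ≠ 0 ∧ b ≠ 0 ∧ c ≠ 0 ∧ DiagAniso ![b * c, a * c, a * b] := by
  have ha : a ≠ 0 := by
    rintro rfl
    have := congrFun (h ![1, 0, 0] (by simp [Fin.sum_univ_three])) 0
    simp at this
  have hb : b ≠ 0 := by
    rintro rfl
    have := congrFun (h ![0, 1, 0] (by simp [Fin.sum_univ_three])) 1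
    simp at this
  have hc : c ≠ 0 := by
    rintro rfl
    have := congrFun (h ![0, 0, 1] (by simp [Fin.sum_univ_three])) 2
    simp at this
  refine ⟨ha, hb, hc, fun w hw => ?_⟩
  simp only [Fin.sum_univ_three, Matrix.cons_val_zero, Matrix.cons_val_one, Matrix.cons_val] at hw
  have := h ![b * c * w 0, a * c * w 1, a * b * w 2] (by
    simp only [Fin.sum_univ_three, Matrix.cons_val_zero, Matrix.cons_val_one, Matrix.cons_val]
    linear_combination (a * b * c) * hw)
  ext i
  have h0 := congrFun this 0
  have h1 := congrFun this 1
  have h2 := congrFun this 2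
  simp [ha, hb, hc] at h0 h1 h2
  fin_cases i <;> simp [h0, h1, h2]

/-- A ternary anisotropic form `φ` which acquires a zero over `K(s,t)(√Δ)`, where
`Δ = -f₃(f₀ + f₁s² + f₂t²)`, forces `f₀f₁f₂f₃` to be a square. -/
theorem DiagAniso.isSquare_of_isotropic {K : Type*} [Field K] (h2 : (2 : K) ≠ 0) {a b c : K}
    (hφ : DiagAniso ![a, b, c]) {f₀ f₁ f₂ f₃ : K} (hf₃ : f₃ ≠ 0) (u v : Fin 3 → K[X][X])
    (hne : ¬ (u = 0 ∧ v = 0))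
    (h : ∑ i, C (C (![a, b, c] i)) * u i ^ 2 - C (C f₃) *
      (C (C f₀ + C f₁ * X ^ 2) + C (C f₂) * X ^ 2) * ∑ i, C (C (![a, b, c] i)) * v i ^ 2 = 0)
    (hb : ∑ i, C (C (![a, b, c] i)) * (u i * v i) = 0) : IsSquare (f₀ * f₁ * f₂ * f₃) := by
  obtain ⟨ha0, hb0, hc0, hθ⟩ := hφ.adjoint
  have hφ2 : DiagAniso (fun i => (C (C (![a, b, c] i)) : K[X][X])) := hφ.polynomial.polynomial
  have hv : v ≠ 0 := by
    rintro rfl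
    refine hne ⟨hφ2 u ?_, rfl⟩
    simpa using h
  have hg : ∑ i, C (C (![a, b, c] i)) * v i ^ 2 ≠ 0 := fun h0 => hv (hφ2 v h0)
  set g := ∑ i, C (C (![a, b, c] i)) * v i ^ 2 with hgdef
  have hw : ∑ i, C (C (![b * c, a * c, a * b] i)) *
      (![u 1 * v 2 - u 2 * v 1, u 2 * v 0 - u 0 * v 2, u 0 * v 1 - u 1 * v 0] i) ^ 2 =
      (C (C (f₃ * f₀) + C (f₃ * f₁) * X ^ 2) + C (C (f₃ * f₂)) * X ^ 2) * g ^ 2 := by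
    have e1 : ∑ i, C (C (![b * c, a * c, a * b] i)) *
      (![u 1 * v 2 - u 2 * v 1, u 2 * v 0 - u 0 * v 2, u 0 * v 1 - u 1 * v 0] i) ^ 2 =
      (∑ i, C (C (![a, b, c] i)) * u i ^ 2) * g -
        (∑ i, C (C (![a, b, c] i)) * (u i * v i)) ^ 2 := by
      rw [hgdef]
      simp only [Fin.sum_univ_three, Matrix.cons_val_zero, Matrix.cons_val_one, Matrix.cons_val,
        C_mul]
      ring
    rw [e1, hb]
    simp only [C_mul, C_add]  at h ⊢
    linear_combination g * h
  obtain ⟨w₀, w₁, w₂, e0, e1, e2, e01, e02, e12⟩ := hθ.exists_orthogonal h2 _ _ _ _ g hg hw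
  simp only [Fin.sum_univ_three, Matrix.cons_val_zero, Matrix.cons_val_one, Matrix.cons_val]
    at e0 e1 e2 e01 e02 e12
  set D := w₀ 0 * (w₁ 1 * w₂ 2 - w₁ 2 * w₂ 1) - w₀ 1 * (w₁ 0 * w₂ 2 - w₁ 2 * w₂ 0) +
    w₀ 2 * (w₁ 0 * w₂ 1 - w₁ 1 * w₂ 0) with hD
  have gram : (D * (a * b * c)) ^ 2 = (f₃ * f₀) * (f₃ * f₁) * (f₃ * f₂) := by
    have : (D * (a * b * c)) ^ 2 = Matrix.det !![f₃ * f₀, 0, 0; 0, f₃ * f₁, 0; 0, 0, f₃ * f₂] := by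
      have hm : (!![w₀ 0, w₀ 1, w₀ 2; w₁ 0, w₁ 1, w₁ 2; w₂ 0, w₂ 1, w₂ 2] : Matrix _ _ K) *
          !![b * c, 0, 0; 0, a * c, 0; 0, 0, a * b] *
          !![w₀ 0, w₁ 0, w₂ 0; w₀ 1, w₁ 1, w₂ 1; w₀ 2, w₁ 2, w₂ 2] =
          !![f₃ * f₀, 0, 0; 0, f₃ * f₁, 0; 0, 0, f₃ * f₂] := by
        ext i j
        fin_cases i <;> fin_cases j <;> simp [Matrix.mul_apply, Fin.sum_univ_three] <;>
          first
          | linear_combination e0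
          | linear_combination e1
          | linear_combination e2
          | linear_combination e01
          | linear_combination e02
          | linear_combination e12
      rw [← hm, Matrix.det_mul, Matrix.det_mul]
      simp only [Matrix.det_fin_three, Matrix.of_apply, Matrix.cons_val', Matrix.cons_val_zero,
        Matrix.cons_val_one, Matrix.cons_val, hD]
      ring
    rw [this, Matrix.det_fin_three]
    simp
  refine ⟨D * (a * b * c) / f₃, ?_⟩
  field_simp
  linear_combination -gram

/-- `-f₃(f₀ + f₁s² + f₂t²)` is not a square. -/
theorem not_sq_eq_quadratic_mul_sq {K : Type*} [Field K] (h2 : (2 : K) ≠ 0) {c₀ c₂ : K} (c₁ : K)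
    (h₀ : c₀ ≠ 0) (h₂ : c₂ ≠ 0) (u v : K[X][X]) (hv : v ≠ 0) :
    u ^ 2 ≠ (C (C c₀ + C c₁ * X ^ 2) + C (C c₂) * X ^ 2) * v ^ 2 := by
  intro h
  have hθ : DiagAniso (fun _ : Unit => (1 : K)) := by
    intro w hw
    ext
    simpa using hw
  obtain ⟨w₀, w₁, w₂, e0, e1, e2, e01, e02, e12⟩ :=
    hθ.exists_orthogonal h2 c₀ c₁ c₂ (fun _ => u) v hv (by simpa using h)
  simp only [Fintype.sum_unique, one_mul] at e0 e2 e02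
  rcases mul_eq_zero.1 e02 with e | e
  · rw [e] at e0; exact h₀ (by rw [← e0]; ring)
  · rw [e] at e2; exact h₂ (by rw [← e2]; ring)

end CasselsPfister

/-! ### Places on function fields of quadric bundles -/

section Places

open IsLocalRing

/-- A ring homomorphism to a domain whose kernel contains that of `ev : S → F` extends to a
place of `F`. -/
theorem exists_valuationSubring_of_ker_le {S F E : Type*} [CommRing S] [Field F] [CommRing E]
    [IsDomain E] (ev : S →+* F) (red : S →+* E) (h : ∀ s, ev s = 0 → red s = 0) :
    ∃ A : ValuationSubring F, (∀ s, ev s ∈ A) ∧ (∀ s, red s = 0 → A.valuation (ev s) < 1) ∧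
      ∀ s, red s ≠ 0 → A.valuation (ev s) = 1 := by
  let 𝔭 : Ideal S := RingHom.ker red
  have hp : 𝔭.IsPrime := RingHom.ker_isPrime red
  have hunit : ∀ s : 𝔭.primeCompl, IsUnit (ev s) := fun s => by
    rw [isUnit_iff_ne_zero]
    exact fun h0 => s.2 (h _ h0)
  let g : Localization.AtPrime 𝔭 →+* F := IsLocalization.lift (M := 𝔭.primeCompl) hunit
  have hg : ∀ s, g (algebraMap S _ s) = ev s := fun s => IsLocalization.lift_eq hunit s
  obtain ⟨A, hA, hloc⟩ := IsLocalRing.exists_factor_valuationRing g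
  have hmem : ∀ s, ev s ∈ A := fun s => by
    have := hA (algebraMap S _ s)
    rw [hg] at this
    exact this
  have hU : ∀ s, A.valuation (ev s) = 1 ↔ s ∉ 𝔭 := by
    intro s
    have h1 := A.valuation_eq_one_iff ⟨ev s, hmem s⟩
    rw [← h1]
    have h2 : (g.codRestrict A.toSubring hA) (algebraMap S _ s) = ⟨ev s, hmem s⟩ :=
      Subtype.ext (hg s)
    have h3 : IsUnit (⟨ev s, hmem s⟩ : A) ↔ IsUnit (algebraMap S (Localization.AtPrime 𝔭) s) := by
      constructor
      · intro h
        rw [← h2] at h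
        exact hloc.map_nonunit _ h
      · intro h
        rw [← h2]
        exact h.map _
    rw [h3]
    exact IsLocalization.AtPrime.isUnit_to_map_iff (Localization.AtPrime 𝔭) 𝔭 s
  refine ⟨A, hmem, fun s hs => ?_, fun s hs => (hU s).2 hs⟩
  refine lt_of_le_of_ne ((A.valuation_le_one_iff _).2 (hmem s)) fun h1 => ?_
  exact (hU s).1 h1 hs

/-- A finite family of polynomials over a valued field is a constant times a family of integral
polynomials with nonzero reduction. -/
theorem exists_primitive_scaling {k : Type*} [Field k] (O : ValuationSubring k) {ι σ : Type*}
    [Fintype ι] (P : ι → MvPolynomial σ k) (hP : P ≠ 0) :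
    ∃ (c : k) (Q : ι → MvPolynomial σ O), c ≠ 0 ∧
      (∀ i, P i = MvPolynomial.C c * MvPolynomial.map O.subtype (Q i)) ∧
      ∃ i, MvPolynomial.map (residue O) (Q i) ≠ 0 := by
  classical
  let U : Finset (σ →₀ ℕ) := Finset.univ.biUnion fun i => (P i).support
  obtain ⟨i0, hi0⟩ := Function.ne_iff.1 hP
  obtain ⟨m0, hm0⟩ := MvPolynomial.ne_zero_iff.1 hi0
  have hm0U : m0 ∈ U := Finset.mem_biUnion.2
    ⟨i0, Finset.mem_univ _, MvPolynomial.mem_support_iff.2 hm0⟩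
  obtain ⟨⟨i1, m1⟩, u, hc, hu, hu1⟩ := exists_common_scale O
    (fun x : ι × U => (P x.1).coeff x.2) ⟨⟨i0, ⟨m0, hm0U⟩⟩, hm0⟩
  have hcoeff : ∀ i (m : U), MvPolynomial.coeff (m : σ →₀ ℕ)
      (∑ n : U, MvPolynomial.monomial (n : σ →₀ ℕ) (u (i, n))) = u (i, m) := by
    intro i m
    rw [MvPolynomial.coeff_sum, Finset.sum_eq_single m]
    · rw [MvPolynomial.coeff_monomial, if_pos rfl]
    · intro n _ hn
      rw [MvPolynomial.coeff_monomial, if_neg (fun h => hn (Subtype.ext h))]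
    · simp
  have hcoeff0 : ∀ i m, m ∉ U → MvPolynomial.coeff m
      (∑ n : U, MvPolynomial.monomial (n : σ →₀ ℕ) (u (i, n))) = 0 := by
    intro i m hm
    rw [MvPolynomial.coeff_sum]
    refine Finset.sum_eq_zero fun n _ => ?_
    rw [MvPolynomial.coeff_monomial, if_neg (fun h : (n : σ →₀ ℕ) = m => hm (h ▸ n.2))]
  refine ⟨(P i1).coeff m1, fun i => ∑ n : U, MvPolynomial.monomial n (u (i, n)), hc, ?_, i1, ?_⟩
  · intro i
    ext m
    rw [MvPolynomial.coeff_C_mul, MvPolynomial.coeff_map]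
    by_cases hm : m ∈ U
    · rw [hcoeff i ⟨m, hm⟩]
      exact hu (i, ⟨m, hm⟩)
    · rw [hcoeff0 i m hm, map_zero, mul_zero]
      by_contra h
      exact hm (Finset.mem_biUnion.2 ⟨i, Finset.mem_univ _, MvPolynomial.mem_support_iff.2 h⟩)
  · intro h
    have := congrArg (MvPolynomial.coeff (m1 : σ →₀ ℕ)) h
    rw [MvPolynomial.coeff_map, hcoeff, hu1, map_one, MvPolynomial.coeff_zero] at this
    exact one_ne_zero this

open Polynomial

/-- Pseudo-division by a quadratic polynomial. -/
theorem exists_pseudo_remainder {D : Type*} [CommRing D] (α β γ : D) (P : D[X]) :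
    ∃ (n : ℕ) (a b : D), C α * X ^ 2 + C β * X + C γ ∣ C α ^ n * P - (C b + C a * X) := by
  induction P using Polynomial.induction_on with
  | C c => exact ⟨0, 0, c, by simp⟩
  | add p q hp hq =>
    obtain ⟨n, a, b, h⟩ := hp
    obtain ⟨m, a', b', h'⟩ := hq
    refine ⟨n + m, α ^ m * a + α ^ n * a', α ^ m * b + α ^ n * b', ?_⟩
    convert! dvd_add (h.mul_left (C α ^ m)) (h'.mul_left (C α ^ n)) using 1
    simp only [C_add, C_mul, C_pow]
    ring
  | monomial m c h =>
    obtain ⟨n, a, b, h⟩ := h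
    refine ⟨n + 1, α * b - β * a, -(γ * a), ?_⟩
    convert! dvd_add (h.mul_left (C α * X)) (Dvd.intro (C a) rfl) using 1
    simp only [C_sub, C_mul, C_neg]
    ring

end Places

/-! ### Places on double covers -/

section DoubleCover

open IsLocalRing Polynomial

variable {k : Type} [Field k] {O : ValuationSubring k} {σ : Type}

/-- Gauss's lemma for divisibility by a polynomial with nonzero reduction. -/
theorem dvd_map_of_dvd_map {E : Type*} [CommRing E] [IsDomain E]
    (ρ : MvPolynomial σ O →+* E)
    (hρ : ∀ a, ρ a = 0 ↔ MvPolynomial.map (residue O) a = 0)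
    (f P : (MvPolynomial σ O)[X]) (hf : f.map ρ ≠ 0)
    (h : f.map (MvPolynomial.map O.subtype) ∣ P.map (MvPolynomial.map O.subtype)) :
    f.map ρ ∣ P.map ρ := by
  have hinj : Function.Injective (MvPolynomial.map O.subtype : MvPolynomial σ O →+* _) :=
    MvPolynomial.map_injective _ Subtype.val_injective
  have hinj' := Polynomial.map_injective _ hinj
  obtain ⟨g, hg⟩ := h
  by_cases hg0 : g = 0
  · rw [hg0, mul_zero, ← Polynomial.map_zero (MvPolynomial.map O.subtype)] at hg
    rw [hinj' hg]
    simp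
  have hco : (fun i : Fin (g.natDegree + 1) => g.coeff i) ≠ 0 := by
    intro h0
    exact hg0 (leadingCoeff_eq_zero.1 (congrFun h0 ⟨g.natDegree, by omega⟩))
  obtain ⟨c, Q, hc, hQ, i, hi⟩ := exists_primitive_scaling O
    (fun i : Fin (g.natDegree + 1) => g.coeff i) hco
  set g' : (MvPolynomial σ O)[X] := ∑ i : Fin (g.natDegree + 1), monomial i (Q i) with hg'
  have hcoeff : ∀ i : Fin (g.natDegree + 1), g'.coeff i = Q i := by
    intro i
    rw [hg', finsetSum_coeff, Finset.sum_eq_single i]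
    · simp
    · intro j _ hj
      rw [coeff_monomial, if_neg (fun h => hj (Fin.ext h))]
    · simp
  have hgg : g = C (MvPolynomial.C c) * g'.map (MvPolynomial.map O.subtype) := by
    conv_lhs => rw [g.as_sum_range' (g.natDegree + 1) (Nat.lt_succ_self _)]
    rw [hg', Polynomial.map_sum, Finset.mul_sum, Finset.sum_range]
    refine Finset.sum_congr rfl fun j _ => ?_
    rw [Polynomial.map_monomial, C_mul_monomial, ← hQ j]
  rcases O.mem_or_inv_mem c with hcO | hcO
  · have : P = f * (C (MvPolynomial.C ⟨c, hcO⟩) * g') := by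
      apply hinj'
      rw [hg, hgg]
      simp
    rw [this, Polynomial.map_mul]
    exact dvd_mul_right _ _
  · by_cases hres : residue O ⟨c⁻¹, hcO⟩ = 0
    · exfalso
      have : C (MvPolynomial.C ⟨c⁻¹, hcO⟩) * P = f * g' := by
        apply hinj'
        rw [Polynomial.map_mul, Polynomial.map_mul, hg, hgg, mul_left_comm, map_C,
          MvPolynomial.map_C, ← mul_assoc (C (MvPolynomial.C _)), ← C_mul, ← MvPolynomial.C_mul,
          show O.subtype ⟨c⁻¹, hcO⟩ * c = 1 from inv_mul_cancel₀ hc, MvPolynomial.C_1, C_1, one_mul]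
      have h2 := congrArg (Polynomial.map ρ) this
      have h3 : ρ (MvPolynomial.C ⟨c⁻¹, hcO⟩) = 0 := by
        rw [hρ, MvPolynomial.map_C, hres, map_zero]
      rw [Polynomial.map_mul, Polynomial.map_mul, map_C, h3, map_zero, zero_mul, eq_comm,
        mul_eq_zero] at h2
      rcases h2 with h2 | h2
      · exact hf h2
      · apply hi
        rw [← hρ, ← hcoeff i, ← coeff_map, h2, coeff_zero]
    · have hu : IsUnit (⟨c⁻¹, hcO⟩ : O) := by
        by_contra hu
        exact hres ((residue_eq_zero_iff _).2 ((mem_maximalIdeal _).2 hu))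
      obtain ⟨u, hu⟩ := hu
      have hcO' : c ∈ O := by
        have h1 : ((u : O) : k) * ((↑u⁻¹ : O) : k) = 1 := by
          rw [← MulMemClass.coe_mul, Units.mul_inv]; rfl
        rw [hu] at h1
        have : ((↑u⁻¹ : O) : k) = c := by
          have h2 : c⁻¹ * ((↑u⁻¹ : O) : k) = 1 := h1
          field_simp at h2
          exact h2
        rw [← this]
        exact (↑u⁻¹ : O).2
      have : P = f * (C (MvPolynomial.C ⟨c, hcO'⟩) * g') := by
        apply hinj'
        rw [hg, hgg]
        simp
      rw [this, Polynomial.map_mul]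
      exact dvd_mul_right _ _


/-- The place of the function field `F` of a double cover induced by the reduction `ρ`. -/
theorem exists_valuationSubring_doubleCover [IsAlgClosed k] {E F : Type} [Field E] [Field F]
    (ρ : MvPolynomial σ O →+* E)
    (hρ : ∀ a, ρ a = 0 ↔ MvPolynomial.map (residue O) a = 0)
    (α β γ : MvPolynomial σ O) (hα : ρ α ≠ 0) (hβ : ρ β = 0)
    (hirr : Irreducible (C (ρ α) * X ^ 2 + C (ρ γ)))
    (ev : (MvPolynomial σ k)[X] →+* F)
    (hev : ∀ P, ev P = 0 ↔
      (C α * X ^ 2 + C β * X + C γ).map (MvPolynomial.map O.subtype) ∣ P)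
    (hfrac : ∀ l : F, ∃ P Q, ev Q ≠ 0 ∧ l = ev P / ev Q) :
    ∃ A : ValuationSubring F, (∀ c : O, ev (C (MvPolynomial.C (c : k))) ∈ A) ∧
      (∀ c : O, residue O c = 0 → A.valuation (ev (C (MvPolynomial.C (c : k)))) < 1) ∧
      (∀ x : F, x ≠ 0 → ∀ n, 0 < n → ∃ y : F, A.valuation y ^ n = A.valuation x) ∧
      ∀ φ : Fin 3 → MvPolynomial σ O,
        (∀ b a : Fin 3 → MvPolynomial σ O, (∃ i, ρ (b i) ≠ 0 ∨ ρ (a i) ≠ 0) →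
          ρ α * ∑ i, ρ (φ i) * ρ (b i) ^ 2 = ρ γ * ∑ i, ρ (φ i) * ρ (a i) ^ 2 →
          2 * ∑ i, ρ (φ i) * (ρ (b i) * ρ (a i)) ≠ 0) →
        RedAniso A (fun i => ev (C (MvPolynomial.map O.subtype (φ i)))) := by
  set ι : MvPolynomial σ O →+* MvPolynomial σ k := MvPolynomial.map O.subtype with hι
  set f : (MvPolynomial σ O)[X] := C α * X ^ 2 + C β * X + C γ with hf
  have hfρ : f.map ρ = C (ρ α) * X ^ 2 + C (ρ γ) := by
    rw [hf]; simp [hβ]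
  have : Fact (Irreducible (f.map ρ)) := ⟨hfρ ▸ hirr⟩
  have hdeg : (f.map ρ).natDegree = 2 := by
    rw [hfρ]; compute_degree!
  set red : (MvPolynomial σ O)[X] →+* AdjoinRoot (f.map ρ) :=
    (AdjoinRoot.mk (f.map ρ)).comp (Polynomial.mapRingHom ρ) with hred
  have hred0 : ∀ P, red P = 0 ↔ f.map ρ ∣ P.map ρ := fun P => AdjoinRoot.mk_eq_zero
  have hlin : ∀ b a : MvPolynomial σ O, red (C b + C a * X) = 0 → ρ b = 0 ∧ ρ a = 0 := by
    intro b a h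
    rw [hred0] at h
    have h0 : (C b + C a * X).map ρ = 0 := by
      refine eq_zero_of_dvd_of_natDegree_lt h ?_
      rw [hdeg]
      simp only [Polynomial.map_add, Polynomial.map_mul, map_C, map_X]
      refine lt_of_le_of_lt (natDegree_add_le _ _) (max_lt (by simp) ?_)
      exact lt_of_le_of_lt (natDegree_C_mul_le _ _) (by simp)
    have h1 := congrArg (fun p => p.coeff 0) h0
    have h2 := congrArg (fun p => p.coeff 1) h0
    simp at h1 h2
    exact ⟨h1, h2⟩
  have hker : ∀ P, (ev.comp (Polynomial.mapRingHom ι)) P = 0 → red P = 0 := by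
    intro P hP
    rw [hred0]
    exact dvd_map_of_dvd_map ρ hρ f P (Fact.out : Irreducible (f.map ρ)).ne_zero ((hev _).1 hP)
  obtain ⟨A, hA1, hA2, hA3⟩ := exists_valuationSubring_of_ker_le
    (S := (MvPolynomial σ O)[X]) (F := F) (E := AdjoinRoot (f.map ρ)) _ _ hker
  have hcC : ∀ c : O, (ev.comp (Polynomial.mapRingHom ι)) (C (MvPolynomial.C c)) =
      ev (C (MvPolynomial.C (c : k))) := by
    intro c
    simp [hι]
  have hcC0 : ∀ c : k, c ≠ 0 → ev (C (MvPolynomial.C c)) ≠ 0 := by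
    intro c hc h
    have : IsUnit (C (MvPolynomial.C c) : (MvPolynomial σ k)[X]) :=
      (IsUnit.map _ (IsUnit.map _ (isUnit_iff_ne_zero.2 hc)))
    exact (this.map ev).ne_zero h
  have hαv : A.valuation (ev (C (ι α))) = 1 := by
    have := hA3 (C α) (fun h => hα (hlin α 0 (by simpa using h)).1)
    simpa using this
  have hα0 : ev (C (ι α)) ≠ 0 := by
    intro h; rw [h, map_zero] at hαv; exact zero_ne_one hαv
  have hpr : ∀ P : (MvPolynomial σ k)[X], ∃ (n : ℕ) (a b : MvPolynomial σ k),
      ev (C (ι α)) ^ n * ev P = ev (C b + C a * X) := by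
    intro P
    obtain ⟨n, a, b, h⟩ := exists_pseudo_remainder (ι α) (ι β) (ι γ) P
    refine ⟨n, a, b, ?_⟩
    have := (hev (C (ι α) ^ n * P - (C b + C a * X))).2 (by
      convert! h using 1
      rw [hf]; simp)
    rw [map_sub, sub_eq_zero, map_mul, map_pow] at this
    exact this
  have hprim : ∀ {κ : Type} [Fintype κ] (b a : κ → MvPolynomial σ k), (∃ i, b i ≠ 0 ∨ a i ≠ 0) →
      ∃ (c : k) (b' a' : κ → MvPolynomial σ O), c ≠ 0 ∧ (∀ i, ev (C (b i) + C (a i) * X) =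
        ev (C (MvPolynomial.C c)) * ev ((C (b' i) + C (a' i) * X).map ι)) ∧
        ∃ i, ρ (b' i) ≠ 0 ∨ ρ (a' i) ≠ 0 := by
    intro κ _ b a hba
    obtain ⟨c, Q, hc, hQ, i, hi⟩ := exists_primitive_scaling O (Sum.elim b a) (by
      obtain ⟨i, hi⟩ := hba
      intro h0
      rcases hi with hi | hi
      · exact hi (congrFun h0 (Sum.inl i))
      · exact hi (congrFun h0 (Sum.inr i)))
    refine ⟨c, fun i => Q (Sum.inl i), fun i => Q (Sum.inr i), hc, fun i => ?_, ?_⟩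
    · rw [← map_mul]
      congr 1
      have h1 := hQ (Sum.inl i)
      have h2 := hQ (Sum.inr i)
      simp only [Sum.elim_inl, Sum.elim_inr] at h1 h2
      rw [h1, h2]
      simp only [Polynomial.map_add, Polynomial.map_mul, map_C, map_X, C_mul]
      ring
    · rcases i with i | i
      · exact ⟨i, Or.inl fun h => hi ((hρ _).1 h)⟩
      · exact ⟨i, Or.inr fun h => hi ((hρ _).1 h)⟩
  have hval : ∀ P : (MvPolynomial σ k)[X], ev P ≠ 0 → ∃ c : k, c ≠ 0 ∧
      A.valuation (ev P) = A.valuation (ev (C (MvPolynomial.C c))) := by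
    intro P hP
    obtain ⟨n, a, b, h⟩ := hpr P
    obtain ⟨c, b', a', hc, h', i, hi⟩ := hprim (fun _ : Unit => b) (fun _ : Unit => a) (by
      refine ⟨(), ?_⟩
      by_contra hcon
      push Not at hcon
      rw [hcon.1, hcon.2] at h
      simp at h
      exact (h.resolve_left fun h => hα0 h.1) |> hP)
    refine ⟨c, hc, ?_⟩
    have h1 := congrArg A.valuation (h.trans (h' i))
    rw [map_mul, map_pow, hαv, one_pow, one_mul, map_mul] at h1
    rw [h1]
    have h2 := hA3 (C (b' i) + C (a' i) * X) (fun h0 => by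
      have := hlin _ _ h0
      tauto)
    rw [RingHom.comp_apply, coe_mapRingHom] at h2
    rw [h2, mul_one]
  refine ⟨A, fun c => hcC c ▸ hA1 _, fun c hc => ?_, ?_, ?_⟩
  · rw [← hcC]
    apply hA2
    have : ρ (MvPolynomial.C c) = 0 := by rw [hρ, MvPolynomial.map_C, hc, map_zero]
    simp [hred, this]
  · intro l hl n hn
    obtain ⟨P, Q, hQ, rfl⟩ := hfrac l
    obtain ⟨c, hc, h1⟩ := hval P (fun h => hl (by rw [h, zero_div]))
    obtain ⟨c', hc', h2⟩ := hval Q hQ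
    obtain ⟨z, hz⟩ := IsAlgClosed.exists_pow_nat_eq c hn
    obtain ⟨z', hz'⟩ := IsAlgClosed.exists_pow_nat_eq c' hn
    refine ⟨ev (C (MvPolynomial.C z)) / ev (C (MvPolynomial.C z')), ?_⟩
    have hpow : ∀ z : k, ev (C (MvPolynomial.C z)) ^ n = ev (C (MvPolynomial.C (z ^ n))) :=
      fun z => by simp only [map_pow]
    rw [← map_pow, div_pow, hpow, hpow, hz, hz', map_div₀, map_div₀, h1, h2]
  · intro φ hφ
    have hφO : ∀ i, ev (C (ι (φ i))) ∈ A := fun i => by simpa using hA1 (C (φ i))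
    refine ⟨1, fun i => ⟨_, hφO i⟩, one_ne_zero, by simp, ?_⟩
    rintro ⟨u, v, w, h0, e⟩
    choose s hs using fun i => residue_surjective (R := A) (![u, v, w] i)
    have hs0 : ∃ i, residue A (s i) ≠ 0 := by
      by_contra hcon
      push Not at hcon
      exact h0 ⟨(hs 0).symm.trans (hcon 0), (hs 1).symm.trans (hcon 1),
        (hs 2).symm.trans (hcon 2)⟩
    have hsum : A.valuation (∑ i, ev (C (ι (φ i))) * (s i : F) ^ 2) < 1 := by
      have h1 : residue A (∑ i, (⟨_, hφO i⟩ : A) * s i ^ 2) = 0 := by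
        rw [map_sum, Fin.sum_univ_three]
        simp only [map_mul, map_pow, hs]
        exact e
      rw [residue_eq_zero_iff] at h1
      have h2 := (A.valuation_lt_one_iff _).1 h1
      convert! h2 using 2
    choose P Q hQ hPQ using fun i => hfrac (s i : F)
    choose n a b hab using fun i => hpr (P i * ∏ j ∈ Finset.univ.erase i, Q j)
    set N := ∑ i, n i with hN
    set t₀ := ev (C (ι α)) ^ N * ∏ j, ev (Q j) with ht₀
    have ht₀0 : t₀ ≠ 0 := mul_ne_zero (pow_ne_zero _ hα0) (Finset.prod_ne_zero_iff.2 fun j _ => hQ j)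
    have hst : ∀ i, (s i : F) * t₀ =
        ev (C (ι α ^ (N - n i) * b i) + C (ι α ^ (N - n i) * a i) * X) := by
      intro i
      have hle : n i ≤ N := Finset.single_le_sum (f := n) (fun _ _ => Nat.zero_le _)
        (Finset.mem_univ i)
      have h1 : C (ι α ^ (N - n i) * b i) + C (ι α ^ (N - n i) * a i) * X =
          C (ι α) ^ (N - n i) * (C (b i) + C (a i) * X) := by
        simp only [C_mul, C_pow]; ring
      rw [h1, map_mul, ← hab, map_pow, ← mul_assoc (ev _ ^ _), ← pow_add,
        Nat.sub_add_cancel hle, ht₀, map_mul, map_prod, ← Finset.mul_prod_erase _ _ (Finset.mem_univ i), hPQ i]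
      have := hQ i
      field_simp
    obtain ⟨i₀, hi₀⟩ := hs0
    have hs1 : A.valuation (s i₀ : F) = 1 := by
      rw [← A.valuation_eq_one_iff]
      by_contra hu
      exact hi₀ ((residue_eq_zero_iff _).2 ((mem_maximalIdeal _).2 hu))
    obtain ⟨c, b', a', hc, h', j, hj⟩ := hprim (fun i => ι α ^ (N - n i) * b i)
      (fun i => ι α ^ (N - n i) * a i) (by
        refine ⟨i₀, ?_⟩
        by_contra hcon
        push Not at hcon
        have h1 := hst i₀
        rw [hcon.1, hcon.2] at h1
        simp only [zero_mul, add_zero, map_zero, mul_eq_zero, ht₀0, or_false] at h1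
        rw [h1, map_zero] at hs1
        exact zero_ne_one hs1)
    set p : Fin 3 → (MvPolynomial σ O)[X] := fun i => C (b' i) + C (a' i) * X with hp
    set t := t₀ / ev (C (MvPolynomial.C c)) with ht
    have hst' : ∀ i, (s i : F) * t = ev ((p i).map ι) := by
      intro i
      have h1 := (hst i).trans (h' i)
      have h2 := hcC0 c hc
      rw [ht, mul_div_assoc', h1, mul_div_cancel_left₀ _ h2]
    have hvt : A.valuation t = 1 := by
      refine le_antisymm ?_ ?_
      · have h1 := congrArg A.valuation (hst' i₀)
        rw [map_mul, hs1, one_mul] at h1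
        rw [h1, A.valuation_le_one_iff]
        exact hA1 (p i₀)
      · have h1 := congrArg A.valuation (hst' j)
        have h2 : A.valuation (ev ((p j).map ι)) = 1 := hA3 (p j) (fun h => by
          have := hlin _ _ h
          tauto)
        rw [map_mul, h2] at h1
        rw [← h1]
        exact mul_le_of_le_one_left' ((A.valuation_le_one_iff _).2 (s j).2)
    have hpsum : red (∑ i, C (φ i) * p i ^ 2) = 0 := by
      by_contra hne
      have h1 := hA3 _ hne
      have h2 : (ev.comp (Polynomial.mapRingHom ι)) (∑ i, C (φ i) * p i ^ 2) =
          (∑ i, ev (C (ι (φ i))) * (s i : F) ^ 2) * t ^ 2 := by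
        rw [map_sum, Finset.sum_mul]
        refine Finset.sum_congr rfl fun i _ => ?_
        rw [mul_assoc, ← mul_pow, hst' i]
        simp
      rw [h2, map_mul, map_pow, hvt, one_pow, mul_one] at h1
      exact hsum.ne h1
    rw [hred0] at hpsum
    have hexp : (∑ i, C (φ i) * p i ^ 2).map ρ = C (∑ i, ρ (φ i) * ρ (b' i) ^ 2) +
        C (2 * ∑ i, ρ (φ i) * (ρ (b' i) * ρ (a' i))) * X +
        C (∑ i, ρ (φ i) * ρ (a' i) ^ 2) * X ^ 2 := by
      simp only [hp, Polynomial.map_sum, Polynomial.map_mul, Polynomial.map_pow, map_C,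
        Polynomial.map_add, map_X, Finset.mul_sum, map_sum, Finset.sum_mul,
        ← Finset.sum_add_distrib]
      refine Finset.sum_congr rfl fun i _ => ?_
      simp only [C_mul, C_pow, map_ofNat]
      ring
    rw [hexp, hfρ] at hpsum
    obtain ⟨q, hq⟩ := hpsum
    have hq0 : q.natDegree = 0 := by
      by_contra hcon
      have hqne : q ≠ 0 := by rintro rfl; simp at hcon
      have h1 : ((C (ρ α) * X ^ 2 + C (ρ γ)) * q).natDegree = 2 + q.natDegree := by
        rw [natDegree_mul hirr.ne_zero hqne, ← hfρ, hdeg]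
      rw [← hq] at h1
      have h2 : (C (∑ i, ρ (φ i) * ρ (b' i) ^ 2) +
        C (2 * ∑ i, ρ (φ i) * (ρ (b' i) * ρ (a' i))) * X +
        C (∑ i, ρ (φ i) * ρ (a' i) ^ 2) * X ^ 2).natDegree ≤ 2 := by compute_degree
      omega
    rw [eq_C_of_natDegree_eq_zero hq0] at hq
    refine hφ b' a' ⟨j, hj⟩ ?_ ?_ <;>
    generalize (∑ i, ρ (φ i) * ρ (b' i) ^ 2) = r₀ at hq ⊢ <;>
    generalize (∑ i, ρ (φ i) * ρ (a' i) ^ 2) = r₂ at hq ⊢ <;>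
    generalize (2 * ∑ i, ρ (φ i) * (ρ (b' i) * ρ (a' i))) = r₁ at hq ⊢
    · have e0 := congrArg (fun p => p.coeff 0) hq
      have e2 := congrArg (fun p => p.coeff 2) hq
      simp [coeff_X, coeff_C] at e0 e2
      rw [e0, e2]; ring
    · have e1 := congrArg (fun p => p.coeff 1) hq
      simpa [coeff_X, coeff_C] using e1

end DoubleCover

/-! ### The reference form over the rational function field in two variables -/

section Reference

open Polynomial

theorem DiagAniso.eq_zero_of_X_mul {R : Type*} [CommRing R] [IsDomain R] {ι : Type} [Fintype ι]
    {θ : ι → R} (h : DiagAniso θ) (r : R[X]) (w : ι → R[X])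
    (e : X * r ^ 2 + ∑ i, C (θ i) * w i ^ 2 = 0) : r = 0 ∧ w = 0 := by
  have hr : r = 0 := by
    by_contra hr
    have hw : w ≠ 0 := by
      rintro rfl
      simp [hr] at e
    obtain ⟨n, hn, i, hi⟩ := exists_natDegree_bound w hw
    have h1 : (∑ i, C (θ i) * w i ^ 2).coeff (2 * n) ≠ 0 := by
      rw [coeff_two_mul_sum_sq θ w n hn]
      intro h0
      exact hi (congrFun (h _ h0) i)
    have h2 : (∑ i, C (θ i) * w i ^ 2).natDegree ≤ 2 * n := by
      refine natDegree_sum_le_of_forall_le _ _ fun i _ => ?_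
      refine (natDegree_C_mul_le _ _).trans (natDegree_pow_le.trans ?_)
      exact Nat.mul_le_mul_left _ (hn i)
    have h3 := le_antisymm h2 (le_natDegree_of_ne_zero h1)
    have h4 : ∑ i, C (θ i) * w i ^ 2 = -(X * r ^ 2) := by linear_combination e
    rw [h4, natDegree_neg, natDegree_X_mul (pow_ne_zero _ hr), natDegree_pow] at h3
    omega
  subst hr
  refine ⟨rfl, h.polynomial w ?_⟩
  simpa using e

theorem diagAniso_reference (κ : Type*) [Field κ] : DiagAniso ![(C X : κ[X][X]), X, 1] := by
  have h1 : DiagAniso (fun _ : Unit => (1 : κ)) := by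
    intro w hw
    ext
    simpa using hw
  have h2 : DiagAniso ![(X : κ[X]), 1] := by
    intro w hw
    have := h1.eq_zero_of_X_mul (w 0) (fun _ => w 1) (by
      simpa [Fin.sum_univ_two] using hw)
    ext i : 1
    fin_cases i
    · exact this.1
    · exact congrFun this.2 ()
  intro w hw
  have := h2.eq_zero_of_X_mul (w 1) ![w 0, w 2] (by
    rw [Fin.sum_univ_three] at hw
    simp only [Fin.sum_univ_two, Matrix.cons_val_zero, Matrix.cons_val_one, Matrix.cons_val,
      map_one] at hw ⊢
    linear_combination hw)
  ext i : 1
  fin_cases i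
  · exact congrFun this.2 0
  · exact this.1
  · exact congrFun this.2 1

theorem not_isSquare_conicForm {κ K : Type*} [Field κ] (h2 : (2 : κ) ≠ 0) [Field K]
    [Algebra κ[X][X] K] [IsFractionRing κ[X][X] K] :
    ¬ IsSquare (algebraMap κ[X][X] K (conicForm (C X : κ[X][X]) X 1 * (C X * X) ^ 2)) := by
  rintro ⟨s, hs⟩
  have hne : algebraMap κ[X][X] K (C X * X) ≠ 0 := by
    rw [Ne, FaithfulSMul.algebraMap_eq_zero_iff]
    exact mul_ne_zero (by simp) X_ne_zero
  have hsq : (s / algebraMap κ[X][X] K (C X * X)) ^ 2 =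
      algebraMap κ[X][X] K (conicForm (C X : κ[X][X]) X 1) := by
    rw [div_pow, sq s, ← hs, map_mul, map_pow]
    field_simp
  obtain ⟨g, hg⟩ := IsIntegrallyClosed.exists_algebraMap_eq_of_isIntegral_pow (R := κ[X][X])
    two_pos (hsq ▸ isIntegral_algebraMap)
  rw [← hg, ← map_pow] at hsq
  have h := IsFractionRing.injective κ[X][X] K hsq
  have h1 := congrArg (Polynomial.map (evalRingHom (1 : κ))) h
  simp [conicForm] at h1
  set q := g.map (evalRingHom (1 : κ))
  have h3 : q ^ 2 = X * (X - 4) := by rw [h1]; ring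
  have h4 : X ∣ q := prime_X.dvd_of_dvd_pow (h3 ▸ dvd_mul_right _ _)
  obtain ⟨p, hp⟩ := h4
  rw [hp] at h3
  have h5 : X * p ^ 2 = X - 4 := mul_left_cancel₀ X_ne_zero (by linear_combination h3)
  have h6 := congrArg (eval 0) h5
  simp at h6
  apply h2
  have : (2 : κ) * 2 = 0 := by norm_num; exact h6
  simpa using this

/-- Multivariate polynomials as univariate polynomials in the last variable. -/
noncomputable def lastVarEquiv (R : Type*) [CommRing R] (n : ℕ) :
    MvPolynomial (Fin (n + 1)) R ≃ₐ[R] (MvPolynomial (Fin n) R)[X] :=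
  (MvPolynomial.renameEquiv R finSuccEquivLast).trans (MvPolynomial.optionEquivLeft R (Fin n))

variable {R : Type*} [CommRing R] {n : ℕ}

@[simp] theorem lastVarEquiv_C (r : R) :
    lastVarEquiv R n (MvPolynomial.C r) = C (MvPolynomial.C r) := by
  simp [lastVarEquiv, MvPolynomial.optionEquivLeft_C]

@[simp] theorem lastVarEquiv_X_castSucc (i : Fin n) :
    lastVarEquiv R n (MvPolynomial.X i.castSucc) = C (MvPolynomial.X i) := by
  simp [lastVarEquiv, MvPolynomial.optionEquivLeft_X_some]

@[simp] theorem lastVarEquiv_X_last :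
    lastVarEquiv R n (MvPolynomial.X (Fin.last n)) = X := by
  simp [lastVarEquiv, MvPolynomial.optionEquivLeft_X_none]

/-- Extension of a homomorphism by a new last variable. -/
noncomputable def extendLastVar {S : Type*} [CommRing S] (φ : MvPolynomial (Fin n) R →+* S) :
    MvPolynomial (Fin (n + 1)) R →+* S[X] :=
  (mapRingHom φ).comp (lastVarEquiv R n : MvPolynomial (Fin (n + 1)) R →+* _)

section

variable {S : Type*} [CommRing S] (φ : MvPolynomial (Fin n) R →+* S)

theorem extendLastVar_injective (h : Function.Injective φ) :
    Function.Injective (extendLastVar φ) :=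
  (Polynomial.map_injective _ h).comp (lastVarEquiv R n).injective

@[simp] theorem extendLastVar_C (r : R) :
    extendLastVar φ (MvPolynomial.C r) = C (φ (MvPolynomial.C r)) := by
  simp [extendLastVar]

@[simp] theorem extendLastVar_X_castSucc (i : Fin n) :
    extendLastVar φ (MvPolynomial.X i.castSucc) = C (φ (MvPolynomial.X i)) := by
  simp [extendLastVar]

@[simp] theorem extendLastVar_X_last :
    extendLastVar φ (MvPolynomial.X (Fin.last n)) = X := by
  simp [extendLastVar]

end

/-- The reference field: rational functions in two variables. -/
abbrev RefField (κ : Type) [Field κ] : Type := FractionRing κ[X][X]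

/-- The embedding of polynomials in four variables into iterated polynomials over the field of
rational functions in the first two variables. -/
noncomputable def refEmbed (κ : Type) [Field κ] : MvPolynomial (Fin 4) κ →+* (RefField κ)[X][X] :=
  extendLastVar (extendLastVar ((algebraMap κ[X][X] (RefField κ)).comp
    (extendLastVar (extendLastVar
      (MvPolynomial.isEmptyRingEquiv κ (Fin 0) : MvPolynomial (Fin 0) κ →+* κ)))))

theorem refEmbed_injective (κ : Type) [Field κ] : Function.Injective (refEmbed κ) := by
  refine extendLastVar_injective _ (extendLastVar_injective _ ?_)
  rw [RingHom.coe_comp]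
  refine (IsFractionRing.injective κ[X][X] (RefField κ)).comp ?_
  exact extendLastVar_injective _ (extendLastVar_injective _ (RingEquiv.injective _))

variable {κ : Type} [Field κ]

theorem refEmbed_C (c : κ) :
    refEmbed κ (MvPolynomial.C c) = C (C (algebraMap κ[X][X] _ (C (C c)))) := by
  have h : MvPolynomial.isEmptyRingEquiv κ (Fin 0) (MvPolynomial.C c) = c :=
    (MvPolynomial.isEmptyRingEquiv κ (Fin 0)).apply_symm_apply c
  simp [refEmbed, h]

theorem refEmbed_X_zero :
    refEmbed κ (MvPolynomial.X 0) = C (C (algebraMap κ[X][X] _ (C X))) := by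
  have : (0 : Fin 4) = (Fin.last 0).castSucc.castSucc.castSucc := rfl
  rw [this, refEmbed, extendLastVar_X_castSucc, extendLastVar_X_castSucc, RingHom.comp_apply, extendLastVar_X_castSucc, extendLastVar_X_last]

theorem refEmbed_X_one :
    refEmbed κ (MvPolynomial.X 1) = C (C (algebraMap κ[X][X] _ X)) := by
  have : (1 : Fin 4) = (Fin.last 1).castSucc.castSucc := rfl
  rw [this, refEmbed, extendLastVar_X_castSucc, extendLastVar_X_castSucc, RingHom.comp_apply, extendLastVar_X_last]

theorem refEmbed_X_two : refEmbed κ (MvPolynomial.X 2) = C X := by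
  have : (2 : Fin 4) = (Fin.last 2).castSucc := rfl
  rw [this, refEmbed, extendLastVar_X_castSucc, extendLastVar_X_last]

theorem refEmbed_X_three : refEmbed κ (MvPolynomial.X 3) = X := by
  have : (3 : Fin 4) = (Fin.last 3) := rfl
  rw [this, refEmbed, extendLastVar_X_last]

end Reference

/-! ### Places on function fields of specialisable quadric bundles -/

section Reference

open Polynomial IsLocalRing

theorem irreducible_quadratic_fraction {K : Type} [Field K] (h2 : (2 : K) ≠ 0) {g₀ g₁ g₂ g₃ : K}
    (h₀ : g₀ ≠ 0) (h₂ : g₂ ≠ 0) (h₃ : g₃ ≠ 0) :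
    Irreducible (C (algebraMap K[X][X] (FractionRing K[X][X]) (C (C g₃))) * X ^ 2 +
      C (algebraMap K[X][X] (FractionRing K[X][X])
        (C (C g₀ + C g₁ * X ^ 2) + C (C g₂) * X ^ 2))) := by
  set E := FractionRing K[X][X]
  set ψ := algebraMap K[X][X] E with hψ
  have hinj : Function.Injective ψ := IsFractionRing.injective K[X][X] E
  have hψ3 : ψ (C (C g₃)) ≠ 0 := by
    rw [Ne, ← map_zero ψ, hinj.eq_iff]
    simpa using h₃
  set γ := ψ (C (C g₀ + C g₁ * X ^ 2) + C (C g₂) * X ^ 2) with hγ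
  have hdeg : (C (ψ (C (C g₃))) * X ^ 2 + C γ).natDegree = 2 := by compute_degree!
  refine (irreducible_iff_roots_eq_zero_of_degree_le_three hdeg.ge (by omega)).2 ?_
  rw [Multiset.eq_zero_iff_forall_notMem]
  intro r hr
  rw [mem_roots'] at hr
  have hr2 := hr.2
  simp only [IsRoot.def, eval_add, eval_mul, eval_C, eval_pow, eval_X] at hr2
  obtain ⟨N, D, hD, rfl⟩ := IsFractionRing.div_surjective (A := K[X][X]) r
  have hD0 : D ≠ 0 := nonZeroDivisors.ne_zero hD
  have hD1 : ψ D ≠ 0 := by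
    rw [Ne, ← map_zero ψ, hinj.eq_iff]
    exact hD0
  have key : (C (C g₃) * N) ^ 2 =
      (C (C (-(g₃ * g₀)) + C (-(g₃ * g₁)) * X ^ 2) + C (C (-(g₃ * g₂))) * X ^ 2) * D ^ 2 := by
    apply hinj
    have e1 : ψ (C (C g₃)) * ψ N ^ 2 + γ * ψ D ^ 2 = 0 := by
      change ψ (C (C g₃)) * (ψ N / ψ D) ^ 2 + γ = 0 at hr2
      have e : ψ N = ψ N / ψ D * ψ D := (div_mul_cancel₀ _ hD1).symm
      rw [e]
      linear_combination ψ D ^ 2 * hr2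
    have e2 : ψ (C (C (-(g₃ * g₀)) + C (-(g₃ * g₁)) * X ^ 2) + C (C (-(g₃ * g₂))) * X ^ 2) =
        -(ψ (C (C g₃)) * γ) := by
      rw [hγ, ← map_mul, ← map_neg]
      congr 1
      simp only [C_neg, C_mul, C_add, C_pow]
      ring
    rw [map_mul, e2, map_pow, map_mul, map_pow]
    linear_combination ψ (C (C g₃)) * e1
  exact not_sq_eq_quadratic_mul_sq h2 _ (neg_ne_zero.2 (mul_ne_zero h₃ h₀))
    (neg_ne_zero.2 (mul_ne_zero h₃ h₂)) _ _ hD0 key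

theorem exists_valuationSubring_of_diagAniso {k K : Type} [Field k] [IsAlgClosed k] [Field K]
    {O : ValuationSubring k} (h2K : (2 : K) ≠ 0) (J : MvPolynomial (Fin 4) O →+* K[X][X])
    (hJ : ∀ a, J a = 0 ↔ MvPolynomial.map (residue O) a = 0) {x y : K}
    (hφ : DiagAniso ![x, y, 1]) (hJx : J (MvPolynomial.X 0) = C (C x))
    (hJy : J (MvPolynomial.X 1) = C (C y)) (α β γ : MvPolynomial (Fin 4) O)
    (g : Fin 4 → K) (hg : ∀ i, g i ≠ 0)
    (hsq : ¬ IsSquare (g 0 * g 1 * g 2 * g 3))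
    (hJα : J α = C (C (g 3))) (hβ : J β = 0)
    (hJγ : J γ = C (C (g 0) + C (g 1) * X ^ 2) + C (C (g 2)) * X ^ 2)
    {F : Type} [Field F] (ev : (MvPolynomial (Fin 4) k)[X] →+* F)
    (hev : ∀ P, ev P = 0 ↔
      (C α * X ^ 2 + C β * X + C γ).map (MvPolynomial.map O.subtype) ∣ P)
    (hfrac : ∀ l : F, ∃ P Q, ev Q ≠ 0 ∧ l = ev P / ev Q) :
    ∃ A : ValuationSubring F, (∀ c : O, ev (C (MvPolynomial.C (c : k))) ∈ A) ∧
      (∀ c : O, residue O c = 0 → A.valuation (ev (C (MvPolynomial.C (c : k)))) < 1) ∧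
      (∀ x : F, x ≠ 0 → ∀ n, 0 < n → ∃ y : F, A.valuation y ^ n = A.valuation x) ∧
      RedAniso A ![ev (C (MvPolynomial.X 0)), ev (C (MvPolynomial.X 1)), 1] := by
  set ψ : K[X][X] →+* FractionRing K[X][X] := algebraMap K[X][X] (FractionRing K[X][X]) with hψ
  have hψi : Function.Injective ψ := IsFractionRing.injective K[X][X] (FractionRing K[X][X])
  have hρ : ∀ a, (ψ.comp J) a = 0 ↔ MvPolynomial.map (residue O) a = 0 := by
    intro a
    rw [RingHom.comp_apply, ← map_zero ψ, hψi.eq_iff, hJ]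
  obtain ⟨A, hA1, hA2, hA3, hA4⟩ := exists_valuationSubring_doubleCover (ψ.comp J) hρ α β γ
    (by
      rw [RingHom.comp_apply, hJα, ← map_zero ψ, hψi.ne_iff]
      simpa using hg 3)
    (by rw [RingHom.comp_apply, hβ, map_zero])
    (by
      rw [RingHom.comp_apply, RingHom.comp_apply, hJα, hJγ]
      exact irreducible_quadratic_fraction h2K (hg 0) (hg 2) (hg 3))
    ev hev hfrac
  refine ⟨A, hA1, hA2, hA3, ?_⟩
  have := hA4 ![MvPolynomial.X 0, MvPolynomial.X 1, 1] (fun b a hba e1 e2 => ?_)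
  · convert! this using 1
    ext i
    fin_cases i <;> simp
  · have hJφ : ∀ i, J (![MvPolynomial.X 0, MvPolynomial.X 1, 1] i) =
        C (C (![x, y, 1] i)) := by
      intro i
      fin_cases i
      · simp [hJx]
      · simp [hJy]
      · simp
    refine hsq (hφ.isSquare_of_isotropic h2K (hg 3) (fun i => C (C (g 3)) * J (b i))
      (fun i => J (a i)) ?_ ?_ ?_)
    · rintro ⟨hu, hv⟩
      obtain ⟨i, hi⟩ := hba
      have h3 : (C (C (g 3)) : K[X][X]) ≠ 0 := by simpa using hg 3
      rcases hi with hi | hi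
      · apply hi
        have := (mul_eq_zero.1 (congrFun hu i)).resolve_left h3
        rw [RingHom.comp_apply, this, map_zero]
      · apply hi
        have := congrFun hv i
        simp only [Pi.zero_apply] at this
        rw [RingHom.comp_apply, this, map_zero]
    · simp only [RingHom.comp_apply, ← map_pow, ← map_mul, ← map_sum] at e1
      have e1 := hψi e1
      simp only [map_mul, map_sum, map_pow, hJα, hJγ, hJφ] at e1
      simp only [mul_pow, mul_left_comm _ (C (C (g 3)) ^ 2), ← Finset.mul_sum]
      linear_combination C (C (g 3)) * e1
    · have h2ψ : (2 : FractionRing K[X][X]) ≠ 0 := by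
        have h := (ψ.comp ((C : K[X] →+* K[X][X]).comp (C : K →+* K[X]))).injective.ne h2K
        simpa only [map_zero, map_ofNat] using h
      have e2 := (mul_eq_zero.1 e2).resolve_left h2ψ
      simp only [RingHom.comp_apply, ← map_mul, ← map_sum] at e2
      rw [← map_zero ψ] at e2
      have e2 := hψi e2
      simp only [map_mul, map_sum, hJφ] at e2
      simp only [mul_assoc, mul_left_comm _ (C (C (g 3))), ← Finset.mul_sum]
      rw [e2, mul_zero]

theorem exists_valuationSubring_reference {k : Type} [Field k] [IsAlgClosed k]
    {O : ValuationSubring k} (h2 : (2 : ResidueField O) ≠ 0) (α β γ : MvPolynomial (Fin 4) O)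
    (g : Fin 4 → RefField (ResidueField O)) (hg : ∀ i, g i ≠ 0)
    (hsq : ¬ IsSquare (g 0 * g 1 * g 2 * g 3))
    (hα : refEmbed _ (MvPolynomial.map (residue O) α) = C (C (g 3)))
    (hβ : MvPolynomial.map (residue O) β = 0)
    (hγ : refEmbed _ (MvPolynomial.map (residue O) γ) =
      C (C (g 0) + C (g 1) * X ^ 2) + C (C (g 2)) * X ^ 2)
    {F : Type} [Field F] (ev : (MvPolynomial (Fin 4) k)[X] →+* F)
    (hev : ∀ P, ev P = 0 ↔
      (C α * X ^ 2 + C β * X + C γ).map (MvPolynomial.map O.subtype) ∣ P)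
    (hfrac : ∀ l : F, ∃ P Q, ev Q ≠ 0 ∧ l = ev P / ev Q) :
    ∃ A : ValuationSubring F, (∀ c : O, ev (C (MvPolynomial.C (c : k))) ∈ A) ∧
      (∀ c : O, residue O c = 0 → A.valuation (ev (C (MvPolynomial.C (c : k)))) < 1) ∧
      (∀ x : F, x ≠ 0 → ∀ n, 0 < n → ∃ y : F, A.valuation y ^ n = A.valuation x) ∧
      RedAniso A ![ev (C (MvPolynomial.X 0)), ev (C (MvPolynomial.X 1)), 1] := by
  have h2K : (2 : RefField (ResidueField O)) ≠ 0 := by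
    have h := ((algebraMap (ResidueField O)[X][X] (RefField (ResidueField O))).comp
      (C.comp C)).injective.ne h2
    simpa only [map_zero, map_ofNat] using h
  have hφ := (diagAniso_reference (ResidueField O)).fractionRing
    (K := RefField (ResidueField O))
  refine exists_valuationSubring_of_diagAniso h2K
    ((refEmbed (ResidueField O)).comp (MvPolynomial.map (residue O))) (fun a => ?_)
    (x := algebraMap (ResidueField O)[X][X] _ (C X))
    (y := algebraMap (ResidueField O)[X][X] _ X) ?_ ?_ ?_ α β γ g hg hsq hα ?_ hγ ev hev hfrac
  · rw [RingHom.comp_apply, ← map_zero (refEmbed _), (refEmbed_injective _).eq_iff]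
  · convert! hφ using 1
    ext i
    fin_cases i <;> simp
  · simp [refEmbed_X_zero]
  · simp [refEmbed_X_one]
  · rw [RingHom.comp_apply, hβ, map_zero]

end Reference

/-! ### Specialisation of very general parameters -/

section VeryGeneral

open MvPolynomial

theorem isPolynomialFun_aeval {P : Type} [AddCommGroup P] [Module ℂ P] {ι : Type}
    (coord : ι → P →ₗ[ℂ] ℂ) (G : MvPolynomial ι ℤ) :
    IsPolynomialFun fun p => aeval (fun i => coord i p) G := by
  obtain ⟨N, f, -, q, rfl⟩ := exists_fin_rename G
  refine ⟨N, fun i => coord (f i), map (Int.castRingHom ℂ) q, fun p => ?_⟩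
  change aeval (fun i => coord i p) (rename f q) = _
  rw [aeval_rename, eval_map, aeval_def]
  rfl

theorem veryGeneral_of_specialization {P : Type} [AddCommGroup P] [Module ℂ P] {ι : Type}
    [Countable ι] (coord : ι → P →ₗ[ℂ] ℂ) (p₀ : P) {Q : P → Prop} (m : ι → ℤ)
    (hm : ∀ i, coord i p₀ = m i)
    (h : ∀ p, (∀ G : MvPolynomial ι ℤ, aeval (fun i => coord i p) G = 0 → aeval m G = 0) →
      Q p) : VeryGeneral Q := by
  have hp₀ : ∀ G : MvPolynomial ι ℤ, aeval (fun i => coord i p₀) G = ((aeval m G : ℤ) : ℂ) := by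
    intro G
    have : (fun i => coord i p₀) = fun i => algebraMap ℤ ℂ (m i) := funext fun i => by simp [hm]
    rw [this]
    exact aeval_algebraMap_apply ℂ m G
  have : Countable (MvPolynomial ι ℤ) := by
    rw [← Cardinal.mk_le_aleph0_iff]
    refine MvPolynomial.cardinalMk_le_max.trans ?_
    simp
  refine ⟨(fun G : MvPolynomial ι ℤ => fun p : P => aeval (fun i => coord i p) G) ''
    {G | aeval m G ≠ 0}, (Set.to_countable _).image _, ?_, fun p hp => h p fun G hG => ?_⟩
  · rintro _ ⟨G, hG, rfl⟩
    refine ⟨isPolynomialFun_aeval coord G, fun h0 => hG ?_⟩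
    have := congrFun h0 p₀
    simp only [hp₀, Pi.zero_apply] at this
    exact_mod_cast this
  · by_contra hne
    exact hp _ ⟨G, hne, rfl⟩ hG

/-- A quadric bundle matrix over `ℂ` that has integral coefficients with respect to a valuation
ring and whose reduction is the diagonal matrix with entries `f`. -/
def SpecializesTo (p : Fin 4 → Fin 4 → MvPolynomial (Fin 3) ℂ) (d : Fin 4 → ℕ)
    (f : Fin 4 → MvPolynomial (Fin 3) ℤ) : Prop :=
  ∃ (O : ValuationSubring ℂ) (a : Fin 4 → Fin 4 → MvPolynomial (Fin 3) O),
    (2 : IsLocalRing.ResidueField O) ≠ 0 ∧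
    (∀ i j, (a i j).IsHomogeneous ((d i + d j) / 2)) ∧
    (∀ i j, map O.subtype (a i j) = p i j) ∧
    ∀ i j, map (IsLocalRing.residue O) (a i j) =
      if i = j then map (Int.castRingHom _) (f i) else 0

theorem veryGeneral_of_specializesTo (d : Fin 4 → ℕ) (f : Fin 4 → MvPolynomial (Fin 3) ℤ)
    (hf : ∀ k, (f k).IsHomogeneous (d k))
    {Q : (Π i : Fin 4, Π j : Fin 4, (homogeneousSubmodule (Fin 3) ℂ ((d i + d j) / 2))) → Prop}
    (h : ∀ p, SpecializesTo (fun i j => (p i j : MvPolynomial (Fin 3) ℂ)) d f → Q p) :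
    VeryGeneral Q := by
  classical
  let m : Fin 4 × Fin 4 × (Fin 3 →₀ ℕ) → ℤ := fun t =>
    if t.1 = t.2.1 then coeff t.2.2 (f t.1) else 0
  let coord : Fin 4 × Fin 4 × (Fin 3 →₀ ℕ) →
      (Π i : Fin 4, Π j : Fin 4, (homogeneousSubmodule (Fin 3) ℂ ((d i + d j) / 2))) →ₗ[ℂ] ℂ :=
    fun t =>
      { toFun := fun p => coeff t.2.2 (p t.1 t.2.1 : MvPolynomial (Fin 3) ℂ)
        map_add' := fun p q => by simp
        map_smul' := fun c p => by simp }
  have hcoord : ∀ i j μ p, coord (i, j, μ) p = coeff μ (p i j : MvPolynomial (Fin 3) ℂ) :=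
    fun _ _ _ _ => rfl
  let p₀ : Π i : Fin 4, Π j : Fin 4, (homogeneousSubmodule (Fin 3) ℂ ((d i + d j) / 2)) :=
    fun i j => ⟨if i = j then map (Int.castRingHom ℂ) (f i) else 0, by
      split_ifs with hij
      · subst hij
        rw [← two_mul, Nat.mul_div_cancel_left _ two_pos]
        exact (hf i).map _
      · exact Submodule.zero_mem _⟩
  refine veryGeneral_of_specialization coord p₀ m ?_ fun p hp => h p ?_
  · rintro ⟨i, j, μ⟩
    rw [hcoord]
    simp only [p₀, m]
    split_ifs with hij <;> simp [coeff_map]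
  · obtain ⟨O, h1, h2, h3⟩ := exists_valuationSubring_of_ker_le
      (aeval (fun t => coord t p) : MvPolynomial _ ℤ →ₐ[ℤ] ℂ).toRingHom
      (aeval m : MvPolynomial _ ℤ →ₐ[ℤ] ℤ).toRingHom hp
    have hmem : ∀ i j μ, coeff μ (p i j : MvPolynomial (Fin 3) ℂ) ∈ O := fun i j μ => by
      simpa [hcoord] using h1 (X (i, j, μ))
    have hres : ∀ c : O, O.valuation c < 1 → IsLocalRing.residue O c = 0 := fun c hc => by
      rw [IsLocalRing.residue_eq_zero_iff, ValuationSubring.valuation_lt_one_iff]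
      exact hc
    have hcoef : ∀ i j μ, IsLocalRing.residue O ⟨_, hmem i j μ⟩ = (m (i, j, μ) : ℤ) := by
      intro i j μ
      rw [← sub_eq_zero, ← map_intCast (IsLocalRing.residue O), ← map_sub]
      refine hres _ ?_
      have := h2 (X (i, j, μ) - C (m (i, j, μ))) (by simp)
      simpa [hcoord] using this
    have hlift : ∀ i j, ∃ a : MvPolynomial (Fin 3) O,
        map O.subtype a = (p i j : MvPolynomial (Fin 3) ℂ) := by
      intro i j
      have : (p i j : MvPolynomial (Fin 3) ℂ) ∈ Set.range (map O.subtype) := by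
        rw [mem_range_map_iff_coeffs_subset]
        intro c hc
        obtain ⟨μ, -, rfl⟩ := mem_coeffs_iff.mp hc
        exact ⟨⟨_, hmem i j μ⟩, rfl⟩
      exact this
    choose a ha using hlift
    have hcoe : ∀ i j μ, coeff μ (a i j) = ⟨_, hmem i j μ⟩ := by
      intro i j μ
      apply Subtype.ext
      change O.subtype (coeff μ (a i j)) = _
      rw [← coeff_map, ha]
    refine ⟨O, a, ?_, fun i j => ?_, ha, fun i j => ?_⟩
    · intro h20
      have h21 : IsLocalRing.residue O 2 = 0 := by rw [map_ofNat]; exact h20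
      rw [IsLocalRing.residue_eq_zero_iff, ValuationSubring.valuation_lt_one_iff] at h21
      have := h3 2 (by simp)
      simp only [map_ofNat] at this
      exact h21.ne this
    · refine IsHomogeneous.of_map (f := O.subtype) Subtype.val_injective ?_
      rw [ha]
      exact (p i j).2
    · ext μ
      rw [coeff_map, hcoe, hcoef]
      split_ifs with hij
      · simp [m, hij, coeff_map]
      · simp [m, hij]

end VeryGeneral

/-! ### Restricting a unirational parametrisation to a line -/

section Extraction

open MvPolynomial

section Line

variable {σ F : Type} [CommRing F]

/-- Restriction of a polynomial to the line through `s` with direction `t`. -/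
noncomputable def lineEval (s t : σ → F) : MvPolynomial σ F →ₐ[F] Polynomial F :=
  aeval fun i => Polynomial.C (s i) + Polynomial.C (t i) * Polynomial.X

theorem coeff_zero_lineEval (s t : σ → F) (p : MvPolynomial σ F) :
    (lineEval s t p).coeff 0 = eval s p := by
  rw [Polynomial.coeff_zero_eq_eval_zero, ← Polynomial.coe_evalRingHom, lineEval, aeval_def,
    hom_eval₂]
  have : (Polynomial.evalRingHom (0 : F)).comp (algebraMap F (Polynomial F)) = RingHom.id F := by
    ext; simp
  rw [this]
  simp only [Polynomial.coe_evalRingHom, Polynomial.eval_add, Polynomial.eval_C,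
    Polynomial.eval_mul, Polynomial.eval_X, mul_zero, add_zero]
  rfl

theorem natDegree_lineEval_le (s t : σ → F) (p : MvPolynomial σ F) :
    (lineEval s t p).natDegree ≤ p.totalDegree := by
  have := aeval_natDegree_le p le_rfl
    (fun i => Polynomial.C (s i) + Polynomial.C (t i) * Polynomial.X) (n := 1) (fun i => by
      rw [add_comm]; exact Polynomial.natDegree_linear_le)
  rw [mul_one] at this
  exact this

theorem coeff_prod_linear_pow (s t : σ → F) (μ : σ → ℕ) (S : Finset σ) :
    (∏ i ∈ S, (Polynomial.C (s i) + Polynomial.C (t i) * Polynomial.X) ^ μ i).natDegree ≤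
        ∑ i ∈ S, μ i ∧
      (∏ i ∈ S, (Polynomial.C (s i) + Polynomial.C (t i) * Polynomial.X) ^ μ i).coeff
        (∑ i ∈ S, μ i) = ∏ i ∈ S, t i ^ μ i := by
  classical
  induction S using Finset.induction_on with
  | empty => simp
  | insert i S hi ih =>
    have hlin : (Polynomial.C (s i) + Polynomial.C (t i) * Polynomial.X).natDegree ≤ 1 := by
      rw [add_comm]; exact Polynomial.natDegree_linear_le
    have hdeg := Polynomial.natDegree_pow_le_of_le (μ i) hlin
    rw [mul_one] at hdeg
    have hcoe := Polynomial.coeff_pow_of_natDegree_le (m := μ i) hlin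
    rw [mul_one] at hcoe
    rw [Finset.prod_insert hi, Finset.sum_insert hi, Finset.prod_insert hi]
    refine ⟨Polynomial.natDegree_mul_le_of_le hdeg ih.1, ?_⟩
    rw [Polynomial.coeff_mul_add_eq_of_natDegree_le hdeg ih.1, ih.2, hcoe]
    simp

theorem coeff_lineEval (s t : σ → F) (p : MvPolynomial σ F) {N : ℕ} (hN : p.totalDegree ≤ N) :
    (lineEval s t p).coeff N = eval t (homogeneousComponent N p) := by
  classical
  have hmon : ∀ μ : σ →₀ ℕ, μ.degree ≤ N → ∀ c : F,
      (lineEval s t (monomial μ c)).coeff N =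
        eval t (homogeneousComponent N (monomial μ c)) := by
    intro μ hμ c
    rcases hμ.lt_or_eq with hlt | heq
    · rw [homogeneousComponent_of_mem (isHomogeneous_monomial c rfl), if_neg hlt.ne', map_zero]
      refine Polynomial.coeff_eq_zero_of_natDegree_lt ((natDegree_lineEval_le _ _ _).trans_lt ?_)
      refine lt_of_le_of_lt ?_ hlt
      exact (isHomogeneous_monomial c rfl).totalDegree_le
    · rw [homogeneousComponent_of_mem (isHomogeneous_monomial c rfl), if_pos heq.symm,
        eval_monomial, lineEval, aeval_monomial, Polynomial.algebraMap_eq, Polynomial.coeff_C_mul]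
      congr 1
      rw [← heq]
      exact (coeff_prod_linear_pow s t μ μ.support).2
  rw [p.as_sum, map_sum, map_sum, map_sum, Polynomial.finsetSum_coeff]
  exact Finset.sum_congr rfl fun μ hμ => hmon μ ((le_totalDegree hμ).trans hN) _

end Line

theorem exists_evaluation_point {F : Type} [Field F] [Infinite F] {n m : ℕ}
    (s : Fin n → FractionRing (MvPolynomial (Fin m) F)) (G₀ : MvPolynomial (Fin n) F)
    (h₀ : aeval s G₀ ≠ 0) :
    ∃ s₀ : Fin n → F, (∀ G : MvPolynomial (Fin n) F, aeval s G = 0 → eval s₀ G = 0) ∧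
      eval s₀ G₀ ≠ 0 := by
  obtain ⟨τ, σ, hτ, hσ⟩ := exists_clear_denominators (R := MvPolynomial (Fin m) F) s
  set alg := algebraMap (MvPolynomial (Fin m) F) (FractionRing (MvPolynomial (Fin m) F)) with halg
  have hinj : Function.Injective alg := IsFractionRing.injective _ _
  have key : ∀ G : MvPolynomial (Fin n) F, ∃ N H, alg τ ^ N * aeval s G = alg H ∧
      ∀ t, eval t τ ≠ 0 → eval t τ ^ N * eval (fun i => eval t (σ i) / eval t τ) G = eval t H := by
    intro G
    induction G using MvPolynomial.induction_on with
    | C a =>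
      refine ⟨0, C a, ?_, fun t _ => by simp⟩
      rw [pow_zero, one_mul, aeval_C]
      exact IsScalarTower.algebraMap_apply F (MvPolynomial (Fin m) F) _ a
    | add p q hp hq =>
      obtain ⟨N, H, h1, h2⟩ := hp
      obtain ⟨N', H', h1', h2'⟩ := hq
      refine ⟨N + N', τ ^ N' * H + τ ^ N * H', ?_, fun t ht => ?_⟩
      · simp only [map_add, map_mul, map_pow, ← h1, ← h1']; ring
      · simp only [map_add, map_mul, map_pow, ← h2 t ht, ← h2' t ht]; ring
    | mul_X p i hp =>
      obtain ⟨N, H, h1, h2⟩ := hp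
      refine ⟨N + 1, H * σ i, ?_, fun t ht => ?_⟩
      · simp only [map_mul, aeval_X, ← h1, hσ]; ring
      · simp only [map_mul, eval_X, ← h2 t ht, pow_succ]
        linear_combination eval t τ ^ N * eval (fun i => eval t (σ i) / eval t τ) p *
          mul_div_cancel₀ (eval t (σ i)) ht
  obtain ⟨N, H, h1, h2⟩ := key G₀
  have hH : H ≠ 0 := by
    rintro rfl
    rw [map_zero, mul_eq_zero] at h1
    refine h1.elim (fun h => ?_) h₀
    exact pow_ne_zero _ ((map_ne_zero_iff _ hinj).mpr hτ) h
  obtain ⟨t, ht⟩ : ∃ t, eval t (τ * H) ≠ 0 := by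
    by_contra! h
    exact mul_ne_zero hτ hH (MvPolynomial.funext fun t => by simpa using h t)
  rw [map_mul] at ht
  have htτ := left_ne_zero_of_mul ht
  refine ⟨fun i => eval t (σ i) / eval t τ, fun G hG => ?_, fun h => ?_⟩
  · obtain ⟨N, H, h1, h2⟩ := key G
    rw [hG, mul_zero] at h1
    have hH0 : H = 0 := hinj (by rw [← h1, map_zero])
    have := h2 t htτ
    rw [hH0, map_zero] at this
    exact (mul_eq_zero.mp this).resolve_left (pow_ne_zero _ htτ)
  · have := h2 t htτ
    rw [h, mul_zero] at this
    exact right_ne_zero_of_mul ht this.symm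

end Extraction

section Extraction

open MvPolynomial

theorem quadric_relation_rescale {F L : Type} [Field F] [Field L] {R : Type} [CommRing R]
    {d : Fin 4 → ℕ} (hpar : ∀ i j, Even (d i + d j))
    {a : Fin 4 → Fin 4 → MvPolynomial (Fin 3) R}
    (hom : ∀ i j, (a i j).IsHomogeneous ((d i + d j) / 2)) (c : R →+* F) (v : Fin 3 → F)
    (Z : Fin 4 → F) (h : ∑ i, ∑ j, eval₂ c v (a i j) * Z i * Z j = 0) (φ : F →+* L) (g : L) :
    ∑ i, ∑ j, eval₂ (φ.comp c) (fun k => g ^ 2 * φ (v k)) (a i j) *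
      (φ (Z i) * g ^ ((∑ k, d k) - d i)) * (φ (Z j) * g ^ ((∑ k, d k) - d j)) = 0 := by
  have hle : ∀ i, d i ≤ ∑ k, d k := fun i =>
    Finset.single_le_sum (f := d) (fun _ _ => Nat.zero_le _) (Finset.mem_univ i)
  have : ∀ i j, eval₂ (φ.comp c) (fun k => g ^ 2 * φ (v k)) (a i j) *
      (φ (Z i) * g ^ ((∑ k, d k) - d i)) * (φ (Z j) * g ^ ((∑ k, d k) - d j)) =
      (g ^ (∑ k, d k)) ^ 2 * φ (eval₂ c v (a i j) * Z i * Z j) := by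
    intro i j
    rw [eval₂_mul_left_of_isHomogeneous _ _ _ (hom i j), map_mul, map_mul, hom_eval₂, ← pow_mul,
      Nat.mul_div_cancel' (hpar i j).two_dvd]
    obtain ⟨e, he⟩ := Nat.exists_eq_add_of_le (hle i)
    obtain ⟨e', he'⟩ := Nat.exists_eq_add_of_le (hle j)
    have h1 : (g ^ (∑ k, d k)) ^ 2 = g ^ (d i + d j) * g ^ e * g ^ e' := by
      rw [sq]
      nth_rw 1 [he]
      nth_rw 1 [he']
      ring
    rw [h1, he, Nat.add_sub_cancel_left, ← he, he', Nat.add_sub_cancel_left]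
    ring
  simp only [this, ← Finset.mul_sum, ← map_sum, h, map_zero, mul_zero]

theorem totalDegree_map_le_of_ringHom {σ R S : Type} [CommRing R] [CommRing S] (f : R →+* S)
    (p : MvPolynomial σ R) : (map f p).totalDegree ≤ p.totalDegree :=
  Finset.sup_mono (support_map_subset _ _)

theorem homogeneousComponent_totalDegree_ne_zero {σ R : Type} [CommRing R] {p : MvPolynomial σ R}
    (hp : p ≠ 0) : homogeneousComponent p.totalDegree p ≠ 0 := by
  obtain ⟨μ, hμ, h⟩ := Finset.exists_mem_eq_sup p.support (support_nonempty.mpr hp)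
    fun s => s.sum fun _ e => e
  intro h0
  have := congrArg (coeff μ) h0
  rw [coeff_homogeneousComponent, coeff_zero, if_pos] at this
  · exact mem_support_iff.mp hμ this
  · exact h.symm

/-- A stable rational parametrisation of a quadric bundle yields a polynomial arc joining a
multiple of the generic point to a constant vector. -/
theorem exists_arc_of_stablyRational {F : Type} [Field F] (c : ℂ →+* F) {m n : ℕ}
    (e : FractionRing (MvPolynomial (Fin m) F) ≃+* FractionRing (MvPolynomial (Fin n) ℂ))
    (he : (e : FractionRing (MvPolynomial (Fin m) F) →+*
      FractionRing (MvPolynomial (Fin n) ℂ)).comp (adjoinIndetsMap c m) =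
        (algebraMap (MvPolynomial (Fin n) ℂ) (FractionRing (MvPolynomial (Fin n) ℂ))).comp C)
    {d : Fin 4 → ℕ} (hpar : ∀ i j, Even (d i + d j))
    {a : Fin 4 → Fin 4 → MvPolynomial (Fin 3) ℂ}
    (hom : ∀ i j, (a i j).IsHomogeneous ((d i + d j) / 2)) (x y : F) (Z : Fin 4 → F) (hZ : Z ≠ 0)
    (h : ∑ i, ∑ j, eval₂ c ![x, y, 1] (a i j) * Z i * Z j = 0) :
    ∃ (B : Fin 3 → Polynomial F) (W : Fin 4 → Polynomial F), W ≠ 0 ∧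
      ∑ i, ∑ j, eval₂ (Polynomial.C.comp c) B (a i j) * W i * W j = 0 ∧
      (∃ g, g ≠ 0 ∧ ∀ k, (B k).coeff 0 = g * ![x, y, 1] k) ∧
      ∃ N, (∀ k, (B k).natDegree ≤ N) ∧ ∃ v : Fin 3 → ℂ, v ≠ 0 ∧
        ∀ k, (B k).coeff N = c (v k) := by
  classical
  set S := MvPolynomial (Fin n) ℂ
  set L := FractionRing S
  set K := FractionRing (MvPolynomial (Fin m) F)
  set alg : S →+* L := algebraMap S L with halg
  have hinj : Function.Injective alg := IsFractionRing.injective S L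
  let j : F →+* K := (algebraMap (MvPolynomial (Fin m) F) K).comp C
  let φ : F →+* L := (e : K →+* L).comp j
  have hφc : φ.comp c = alg.comp C := by rw [← he]; rfl
  -- clear denominators over the polynomial ring
  obtain ⟨g, w, hg, hw⟩ := exists_clear_denominators (R := S) (fun k => φ (![x, y, 1] k))
  have hrel := quadric_relation_rescale hpar hom c _ Z h φ (alg g)
  set Z' : Fin 4 → L := fun i => φ (Z i) * alg g ^ ((∑ k, d k) - d i) with hZ'
  have hZ'0 : Z' ≠ 0 := by
    obtain ⟨i, hi⟩ := Function.ne_iff.mp hZ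
    refine Function.ne_iff.mpr ⟨i, mul_ne_zero ?_ (pow_ne_zero _ ?_)⟩
    · exact (map_ne_zero φ).mpr hi
    · exact (map_ne_zero_iff _ hinj).mpr hg
  obtain ⟨q, z, hq, hz⟩ := exists_clear_denominators (R := S) Z'
  have hq0 : alg q ≠ 0 := (map_ne_zero_iff _ hinj).mpr hq
  obtain ⟨b, hbg⟩ : ∃ b : Fin 3 → S, ∀ k, b k = g * w k := ⟨_, fun _ => rfl⟩
  have hb : ∀ k, alg (b k) = alg g ^ 2 * φ (![x, y, 1] k) := fun k => by
    have h1 : alg (w k) = alg g * φ (![x, y, 1] k) := hw k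
    rw [hbg, map_mul, h1]; ring
  have hb2 : b 2 ≠ 0 := by
    intro h0
    have := hb 2
    rw [h0, map_zero] at this
    refine mul_ne_zero (pow_ne_zero 2 ((map_ne_zero_iff _ hinj).mpr hg)) ?_ this.symm
    exact (map_ne_zero φ).mpr one_ne_zero
  have hz0 : ∃ i, z i ≠ 0 := by
    obtain ⟨i, hi⟩ := Function.ne_iff.mp hZ'0
    refine ⟨i, fun h0 => ?_⟩
    have := hz i
    rw [h0, map_zero] at this
    exact mul_ne_zero hq0 hi this.symm
  have hrelS : ∑ i, ∑ j, eval₂ C b (a i j) * z i * z j = 0 := by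
    have hz' : ∀ i, alg (z i) = alg q * Z' i := hz
    have hb' : (fun k => alg (b k)) = fun k => alg g ^ 2 * φ (![x, y, 1] k) := _root_.funext hb
    have hterm : ∀ i j, alg (eval₂ C b (a i j) * z i * z j) = alg q ^ 2 *
        (eval₂ (φ.comp c) (fun k => alg g ^ 2 * φ (![x, y, 1] k)) (a i j) * Z' i * Z' j) := by
      intro i j
      rw [map_mul, map_mul, hom_eval₂, hz', hz', hφc, ← hb']
      ring
    apply hinj
    rw [map_zero, map_sum]
    simp only [map_sum, hterm, ← Finset.mul_sum]
    exact (congrArg (alg q ^ 2 * ·) hrel).trans (mul_zero _)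
  -- specialise the parametrisation to a point over the generic point
  let s : Fin n → K := fun i => e.symm (alg (X i))
  have hs : ∀ P : S, aeval s (map c P) = e.symm (alg P) := by
    intro P
    have : ((aeval s : MvPolynomial (Fin n) F →ₐ[F] K) : MvPolynomial (Fin n) F →+* K).comp
        (map c) = ((e.symm : L ≃+* K) : L →+* K).comp alg := by
      apply MvPolynomial.ringHom_ext
      · intro r
        have h1 := RingHom.congr_fun he r
        simp only [RingHom.comp_apply, map_C]
        change aeval s (C (c r)) = e.symm (alg (C r))
        rw [RingEquiv.eq_symm_apply, aeval_C]
        exact h1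
      · intro i
        simp [s]
    exact RingHom.congr_fun this P
  have : Infinite F := Infinite.of_injective c c.injective
  obtain ⟨s₀, hs₀, hs₀2⟩ := exists_evaluation_point s (map c (b 2)) (by
    rw [hs]
    exact (map_ne_zero_iff _ e.symm.injective).mpr ((map_ne_zero_iff _ hinj).mpr hb2))
  have hpt : ∀ k, eval s₀ (map c (b k)) = eval s₀ (map c (b 2)) * ![x, y, 1] k := by
    intro k
    have := hs₀ (map c (b k) - C (![x, y, 1] k) * map c (b 2)) (by
      rw [map_sub, map_mul, hs, hs, aeval_C, sub_eq_zero, RingEquiv.symm_apply_eq, map_mul,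
        RingEquiv.apply_symm_apply, hb, hb]
      change _ = φ (![x, y, 1] k) * _
      simp
      ring)
    rw [map_sub, map_mul, eval_C, sub_eq_zero] at this
    rw [this, mul_comm]
  -- restrict to a line with general direction
  obtain ⟨i₀, hi₀⟩ := hz0
  obtain ⟨k₀, hk₀mem, hk₀⟩ := Finset.exists_max_image (Finset.univ.filter fun k => b k ≠ 0)
    (fun k => (b k).totalDegree) ⟨2, by simpa using hb2⟩
  have hN : ∀ k, (b k).totalDegree ≤ (b k₀).totalDegree := fun k => by
    by_cases hk : b k = 0
    · simp [hk]
    · exact hk₀ k (by simpa using hk)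
  obtain ⟨t, ht⟩ : ∃ t : Fin n → ℂ, eval t (homogeneousComponent (b k₀).totalDegree (b k₀) *
      homogeneousComponent (z i₀).totalDegree (z i₀)) ≠ 0 := by
    by_contra! h
    refine mul_ne_zero (homogeneousComponent_totalDegree_ne_zero ?_)
      (homogeneousComponent_totalDegree_ne_zero hi₀) (MvPolynomial.funext fun t => by
        simpa using h t)
    simpa using hk₀mem
  rw [map_mul] at ht
  let ψ : S →+* Polynomial F :=
    ((lineEval s₀ (fun i => c (t i)) : MvPolynomial (Fin n) F →ₐ[F] Polynomial F) :
      MvPolynomial (Fin n) F →+* Polynomial F).comp (map c)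
  have hψN : ∀ (P : S) (N : ℕ), P.totalDegree ≤ N →
      (ψ P).coeff N = c (eval t (homogeneousComponent N P)) := by
    intro P N hPN
    change (lineEval s₀ _ (map c P)).coeff N = _
    rw [coeff_lineEval _ _ _ ((totalDegree_map_le_of_ringHom _ _).trans hPN)]
    have : homogeneousComponent N (map c P) = map c (homogeneousComponent N P) := by
      ext μ
      rw [coeff_homogeneousComponent, coeff_map, coeff_map, coeff_homogeneousComponent]
      split_ifs <;> simp
    rw [this, eval_map, eval, coe_eval₂Hom, hom_eval₂]
    rfl
  refine ⟨fun k => ψ (b k), fun i => ψ (z i), ?_, ?_, ⟨_, hs₀2, fun k => ?_⟩,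
    (b k₀).totalDegree, fun k => ?_,
    fun k => eval t (homogeneousComponent (b k₀).totalDegree (b k)), ?_, fun k => ?_⟩
  · refine Function.ne_iff.mpr ⟨i₀, fun h0 => ?_⟩
    have := hψN (z i₀) _ le_rfl
    rw [h0] at this
    simp only [Pi.zero_apply, Polynomial.coeff_zero] at this
    exact right_ne_zero_of_mul ht ((map_eq_zero c).mp this.symm)
  · have hψc : ψ.comp C = Polynomial.C.comp c := by
      refine RingHom.ext fun r => ?_
      change lineEval s₀ _ (map c (C r)) = Polynomial.C (c r)
      rw [map_C, lineEval, aeval_C]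
      rfl
    rw [← hψc]
    have := congrArg ψ hrelS
    simpa only [map_sum, map_mul, hom_eval₂, map_zero] using this
  · rw [← hpt, ← coeff_zero_lineEval]
    rfl
  · exact (natDegree_lineEval_le _ _ _).trans ((totalDegree_map_le_of_ringHom _ _).trans (hN k))
  · exact Function.ne_iff.mpr ⟨k₀, left_ne_zero_of_mul ht⟩
  · exact hψN _ _ (hN k)

end Extraction

section AffineChart

open Polynomial

variable {R S : Type} [CommRing R] [CommRing S]

/-- Dehomogenisation at the last coordinate, with values in a polynomial ring having two further
variables for the fibre coordinates. -/
noncomputable def chartHom (R : Type) [CommRing R] :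
    MvPolynomial (Fin 3) R →+* MvPolynomial (Fin 4) R :=
  (MvPolynomial.aeval ![MvPolynomial.X 0, MvPolynomial.X 1, 1]).toRingHom

theorem chartHom_C (r : R) : chartHom R (MvPolynomial.C r) = MvPolynomial.C r := by
  simp [chartHom, MvPolynomial.algebraMap_eq]

theorem chartHom_X (i : Fin 3) : chartHom R (MvPolynomial.X i) =
    ![MvPolynomial.X 0, MvPolynomial.X 1, 1] i := by
  simp [chartHom]

theorem map_chartHom (g : R →+* S) (q : MvPolynomial (Fin 3) R) :
    MvPolynomial.map g (chartHom R q) = chartHom S (MvPolynomial.map g q) := by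
  have : (MvPolynomial.map g).comp (chartHom R) = (chartHom S).comp (MvPolynomial.map g) := by
    apply MvPolynomial.ringHom_ext
    · intro r; simp [chartHom_C]
    · intro i; fin_cases i <;> simp [chartHom_X]
  exact RingHom.congr_fun this q

theorem lastVarEquiv_dehomP2 (q : MvPolynomial (Fin 3) ℂ) :
    lastVarEquiv ℂ 4 (dehomP2 q) = C (chartHom ℂ q) := by
  have : ((lastVarEquiv ℂ 4 : MvPolynomial (Fin 5) ℂ ≃ₐ[ℂ] _) :
      MvPolynomial (Fin 5) ℂ →+* _).comp dehomP2 = (C : _ →+* _).comp (chartHom ℂ) := by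
    apply MvPolynomial.ringHom_ext
    · intro r; simp [chartHom_C, dehomP2, MvPolynomial.algebraMap_eq]
    · intro i
      have h0 := lastVarEquiv_X_castSucc (R := ℂ) (0 : Fin 4)
      have h1 := lastVarEquiv_X_castSucc (R := ℂ) (1 : Fin 4)
      fin_cases i
      · simpa [chartHom_X, dehomP2] using h0
      · simpa [chartHom_X, dehomP2] using h1
      · simp [chartHom_X, dehomP2]
  exact RingHom.congr_fun this q

theorem refEmbed_chartHom {κ : Type} [Field κ] (q : MvPolynomial (Fin 3) κ) :
    refEmbed κ (chartHom κ q) =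
      C (C (algebraMap κ[X][X] _ (MvPolynomial.eval₂ (C.comp C) ![C X, X, 1] q))) := by
  have : (refEmbed κ).comp (chartHom κ) = (C.comp (C.comp (algebraMap κ[X][X] (RefField κ)))).comp
      (MvPolynomial.eval₂Hom (C.comp C) ![C X, X, 1]) := by
    apply MvPolynomial.ringHom_ext
    · intro r; simp [chartHom_C, refEmbed_C]
    · intro i
      fin_cases i <;> simp [chartHom_X, refEmbed_X_zero, refEmbed_X_one]
  exact RingHom.congr_fun this q

/-- The chart equation of a quadric bundle as a polynomial in the last fibre coordinate. -/
theorem lastVarEquiv_quadricBundleChartPoly (p : Fin 4 → Fin 4 → MvPolynomial (Fin 3) ℂ) :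
    lastVarEquiv ℂ 4 (quadricBundleChartPoly p) = C (chartHom ℂ (p 3 3)) * X ^ 2 +
      C (∑ i : Fin 3, (chartHom ℂ (p i.castSucc 3) + chartHom ℂ (p 3 i.castSucc)) *
        ![1, MvPolynomial.X 2, MvPolynomial.X 3] i) * X +
      C (∑ i : Fin 3, ∑ j : Fin 3, chartHom ℂ (p i.castSucc j.castSucc) *
        ![1, MvPolynomial.X 2, MvPolynomial.X 3] i *
        ![1, MvPolynomial.X 2, MvPolynomial.X 3] j) := by
  have h2 : lastVarEquiv ℂ 4 (MvPolynomial.X 2) = C (MvPolynomial.X 2) :=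
    lastVarEquiv_X_castSucc (R := ℂ) (2 : Fin 4)
  have h3 : lastVarEquiv ℂ 4 (MvPolynomial.X 3) = C (MvPolynomial.X 3) :=
    lastVarEquiv_X_castSucc (R := ℂ) (3 : Fin 4)
  have h4 : lastVarEquiv ℂ 4 (MvPolynomial.X 4) = X := lastVarEquiv_X_last (R := ℂ) (n := 4)
  have hz : ∀ i : Fin 4, lastVarEquiv ℂ 4 ((![1, MvPolynomial.X 2, MvPolynomial.X 3,
      MvPolynomial.X 4] : Fin 4 → MvPolynomial (Fin 5) ℂ) i) =
      ![1, C (MvPolynomial.X 2), C (MvPolynomial.X 3), X] i := by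
    intro i
    fin_cases i
    · exact map_one _
    · exact h2
    · exact h3
    · exact h4
  simp only [quadricBundleChartPoly, map_sum, map_mul, lastVarEquiv_dehomP2, hz]
  simp only [Fin.sum_univ_four, Fin.sum_univ_three, map_add]
  have e0 : (Fin.castSucc (0 : Fin 3)) = (0 : Fin 4) := rfl
  have e1 : (Fin.castSucc (1 : Fin 3)) = (1 : Fin 4) := rfl
  have e2 : (Fin.castSucc (2 : Fin 3)) = (2 : Fin 4) := rfl
  simp only [e0, e1, e2, Matrix.cons_val_zero, Matrix.cons_val_one, Matrix.cons_val, map_one]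
  ring

end AffineChart

section NotStablyRational

open Polynomial IsLocalRing

theorem ternIso_of_isAlgClosed {k : Type} [Field k] [IsAlgClosed k] (a b c : k) :
    TernIso a b c := by
  by_cases ha : a = 0
  · exact ⟨1, 0, 0, by simp, by simp [ha]⟩
  · obtain ⟨t, ht⟩ := IsAlgClosed.exists_pow_nat_eq (-b / a) two_pos
    refine ⟨t, 1, 0, by simp, ?_⟩
    rw [ht]
    field_simp
    ring

theorem TernIso.map {k F : Type} [Field k] [Field F] (c : k →+* F) {a b d : k}
    (h : TernIso a b d) : TernIso (c a) (c b) (c d) := by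
  obtain ⟨u, v, w, h0, e⟩ := h
  refine ⟨c u, c v, c w, fun ⟨h1, h2, h3⟩ => h0 ⟨?_, ?_, ?_⟩, ?_⟩
  · exact (map_eq_zero c).mp h1
  · exact (map_eq_zero c).mp h2
  · exact (map_eq_zero c).mp h3
  · rw [← map_zero c, ← e]
    simp only [map_add, map_mul, map_pow]

theorem RedAniso.smul {L : Type} [Field L] {A : ValuationSubring L} {w : Fin 3 → L}
    (h : RedAniso A w) {g : L} (hg : g ≠ 0) : RedAniso A fun m => g * w m := by
  obtain ⟨e, u, he, hw, hu⟩ := h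
  exact ⟨g * e, u, mul_ne_zero hg he, fun m => by simp only [hw, mul_assoc], hu⟩

/-- The entries of the reference diagonal form multiply to a nonsquare discriminant. -/
def HasReferenceDiscriminant (f : Fin 4 → MvPolynomial (Fin 3) ℤ) : Prop :=
  ∀ (R : Type) [CommRing R] (x y : R),
    ∏ k, MvPolynomial.eval₂ (Int.castRingHom R) ![x, y, 1] (f k) = conicForm x y 1 * (x * y) ^ 2

variable {d : Fin 4 → ℕ} {f : Fin 4 → MvPolynomial (Fin 3) ℤ}
  {p : Fin 4 → Fin 4 → MvPolynomial (Fin 3) ℂ}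

/-- The value of a form at the generic point of the plane. -/
noncomputable def refValue (κ : Type) [Field κ] (f : MvPolynomial (Fin 3) ℤ) : RefField κ :=
  algebraMap κ[X][X] _ (MvPolynomial.eval₂ (Int.castRingHom _) ![C X, X, 1] f)

theorem not_isSquare_refValue {κ : Type} [Field κ] (h2 : (2 : κ) ≠ 0)
    (hdisc : HasReferenceDiscriminant f) :
    ¬ IsSquare (refValue κ (f 0) * refValue κ (f 1) * refValue κ (f 2) * refValue κ (f 3)) := by
  simp only [refValue, ← map_mul]
  have := hdisc κ[X][X] (C X) X
  rw [Fin.prod_univ_four] at this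
  rw [this]
  exact not_isSquare_conicForm h2

theorem refValue_ne_zero {κ : Type} [Field κ] (h2 : (2 : κ) ≠ 0)
    (hdisc : HasReferenceDiscriminant f) (i : Fin 4) : refValue κ (f i) ≠ 0 := by
  intro hi
  refine not_isSquare_refValue h2 hdisc ⟨0, ?_⟩
  rw [mul_zero]
  fin_cases i <;> simp_all

theorem refEmbed_chartHom_map {κ : Type} [Field κ] (q : MvPolynomial (Fin 3) ℤ) :
    refEmbed κ (chartHom κ (MvPolynomial.map (Int.castRingHom κ) q)) = C (C (refValue κ q)) := by
  rw [refEmbed_chartHom, MvPolynomial.eval₂_map, refValue]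
  congr 4

theorem exists_valuationSubring_chart (hdisc : HasReferenceDiscriminant f)
    {O : ValuationSubring ℂ} {a : Fin 4 → Fin 4 → MvPolynomial (Fin 3) O}
    (h2 : (2 : ResidueField O) ≠ 0)
    (hap : ∀ i j, MvPolynomial.map O.subtype (a i j) = p i j)
    (har : ∀ i j, MvPolynomial.map (residue O) (a i j) =
      if i = j then MvPolynomial.map (Int.castRingHom _) (f i) else 0)
    {F : Type} [Field F] (π : MvPolynomial (Fin 5) ℂ →+* F)
    (hπ : ∀ P, π P = 0 ↔ quadricBundleChartPoly p ∣ P)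
    (hfrac : ∀ l : F, ∃ P Q, π Q ≠ 0 ∧ l = π P / π Q) :
    ∃ A : ValuationSubring F, (∀ c : O, π (MvPolynomial.C (c : ℂ)) ∈ A) ∧
      (∀ c : O, residue O c = 0 → A.valuation (π (MvPolynomial.C (c : ℂ))) < 1) ∧
      (∀ x : F, x ≠ 0 → ∀ n, 0 < n → ∃ y : F, A.valuation y ^ n = A.valuation x) ∧
      RedAniso A ![π (MvPolynomial.X 0), π (MvPolynomial.X 1), 1] := by
  set κ := ResidueField O with hκ
  let g : Fin 4 → RefField κ := fun k => refValue κ (f k)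
  have hsq : ¬ IsSquare (g 0 * g 1 * g 2 * g 3) := not_isSquare_refValue h2 hdisc
  have hg : ∀ i, g i ≠ 0 := refValue_ne_zero h2 hdisc
  have hred : ∀ i j, refEmbed κ (MvPolynomial.map (residue O) (chartHom O (a i j))) =
      if i = j then C (C (g i)) else 0 := by
    intro i j
    rw [map_chartHom, har]
    split_ifs
    · exact refEmbed_chartHom_map _
    · rw [map_zero, map_zero]
  have hev0 := lastVarEquiv_quadricBundleChartPoly p
  let ev : (MvPolynomial (Fin 4) ℂ)[X] →+* F :=
    π.comp ((lastVarEquiv ℂ 4).symm : (MvPolynomial (Fin 4) ℂ)[X] →+* MvPolynomial (Fin 5) ℂ)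
  have hevC : ∀ c, ev (C (MvPolynomial.C c)) = π (MvPolynomial.C c) := fun c => by
    simp only [ev, RingHom.comp_apply]
    congr 1
    change (lastVarEquiv ℂ 4).symm _ = _
    rw [AlgEquiv.symm_apply_eq, lastVarEquiv_C]
  have hevX : ∀ i : Fin 4, ev (C (MvPolynomial.X i)) = π (MvPolynomial.X i.castSucc) := fun c => by
    simp only [ev, RingHom.comp_apply]
    congr 1
    change (lastVarEquiv ℂ 4).symm _ = _
    rw [AlgEquiv.symm_apply_eq, lastVarEquiv_X_castSucc]
  have hlift : ∀ i j, MvPolynomial.map O.subtype (chartHom O (a i j)) = chartHom ℂ (p i j) :=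
    fun i j => by rw [map_chartHom, hap]
  have hα : refEmbed κ (MvPolynomial.map (residue O) (chartHom O (a 3 3))) = C (C (g 3)) := by
    rw [hred, if_pos rfl]
  have hβ : MvPolynomial.map (residue O)
      (∑ i : Fin 3, (chartHom O (a i.castSucc 3) + chartHom O (a 3 i.castSucc)) *
        ![1, MvPolynomial.X 2, MvPolynomial.X 3] i) = 0 := by
    apply refEmbed_injective
    rw [map_zero]
    simp only [map_sum, map_mul, map_add]
    refine Finset.sum_eq_zero fun i _ => ?_
    have hi : i.castSucc ≠ (3 : Fin 4) := i.castSucc_ne_last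
    rw [hred, hred, if_neg hi, if_neg hi.symm, add_zero, zero_mul]
  have hγ : refEmbed κ (MvPolynomial.map (residue O) (∑ i : Fin 3, ∑ j : Fin 3,
      chartHom O (a i.castSucc j.castSucc) * ![1, MvPolynomial.X 2, MvPolynomial.X 3] i *
        ![1, MvPolynomial.X 2, MvPolynomial.X 3] j)) =
      C (C (g 0) + C (g 1) * X ^ 2) + C (C (g 2)) * X ^ 2 := by
    simp only [map_sum, map_mul]
    simp only [hred, Fin.sum_univ_three]
    simp [refEmbed_X_two, refEmbed_X_three]
    ring
  have hev : ∀ P, ev P = 0 ↔ (C (chartHom O (a 3 3)) * X ^ 2 +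
      C (∑ i : Fin 3, (chartHom O (a i.castSucc 3) + chartHom O (a 3 i.castSucc)) *
        ![1, MvPolynomial.X 2, MvPolynomial.X 3] i) * X +
      C (∑ i : Fin 3, ∑ j : Fin 3, chartHom O (a i.castSucc j.castSucc) *
        ![1, MvPolynomial.X 2, MvPolynomial.X 3] i *
        ![1, MvPolynomial.X 2, MvPolynomial.X 3] j)).map (MvPolynomial.map O.subtype) ∣ P := by
    intro P
    have h1 : ev P = 0 ↔ quadricBundleChartPoly p ∣ (lastVarEquiv ℂ 4).symm P := hπ _
    rw [h1, ← map_dvd_iff (lastVarEquiv ℂ 4), AlgEquiv.apply_symm_apply, hev0]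
    simp only [Polynomial.map_add, Polynomial.map_mul, Polynomial.map_pow, Polynomial.map_C,
      Polynomial.map_X]
    have hv : ∀ i : Fin 3, MvPolynomial.map O.subtype
        ((![1, MvPolynomial.X 2, MvPolynomial.X 3] : Fin 3 → MvPolynomial (Fin 4) O) i) =
        ![1, MvPolynomial.X 2, MvPolynomial.X 3] i := by
      intro i; fin_cases i <;> simp
    simp only [map_sum, map_mul, map_add, hlift, hv]
  have hfrac' : ∀ l : F, ∃ P Q, ev Q ≠ 0 ∧ l = ev P / ev Q := by
    intro l
    obtain ⟨P, Q, hQ, rfl⟩ := hfrac l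
    refine ⟨lastVarEquiv ℂ 4 P, lastVarEquiv ℂ 4 Q, ?_, ?_⟩ <;> simp [ev, hQ]
  obtain ⟨A, hA1, hA2, hA3, hA4⟩ := exists_valuationSubring_reference h2 _ _ _ g hg hsq
    hα hβ hγ ev hev hfrac'
  · refine ⟨A, fun c => ?_, fun c hc => ?_, hA3, ?_⟩
    · rw [← hevC]; exact hA1 c
    · rw [← hevC]; exact hA2 c hc
    · rw [hevX, hevX] at hA4
      exact hA4

end NotStablyRational

section NotStablyRational

open Polynomial IsLocalRing

variable {d : Fin 4 → ℕ} {f : Fin 4 → MvPolynomial (Fin 3) ℤ}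
  {p : Fin 4 → Fin 4 → MvPolynomial (Fin 3) ℂ}

theorem eval₂_eq_map_dehomP2 {F : Type} [CommRing F] (π : MvPolynomial (Fin 5) ℂ →+* F)
    (q : MvPolynomial (Fin 3) ℂ) :
    π (dehomP2 q) = MvPolynomial.eval₂ (π.comp MvPolynomial.C)
      ![π (MvPolynomial.X 0), π (MvPolynomial.X 1), 1] q := by
  have : π.comp dehomP2 = MvPolynomial.eval₂Hom (π.comp MvPolynomial.C)
      ![π (MvPolynomial.X 0), π (MvPolynomial.X 1), 1] := by
    apply MvPolynomial.ringHom_ext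
    · intro r; simp [dehomP2, MvPolynomial.algebraMap_eq]
    · intro i; fin_cases i <;> simp [dehomP2]
  exact RingHom.congr_fun this q

theorem not_stablyRational_of_specializesTo (hpar : ∀ i j, Even (d i + d j)) (hf : SpecialIso f)
    (hdisc : HasReferenceDiscriminant f) (hspec : SpecializesTo p d f)
    {F : Type} [Field F] (π : MvPolynomial (Fin 5) ℂ →+* F)
    (hπ : ∀ P, π P = 0 ↔ quadricBundleChartPoly p ∣ P)
    (hfrac : ∀ l : F, ∃ P Q, π Q ≠ 0 ∧ l = π P / π Q) {m n : ℕ}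
    (e : FractionRing (MvPolynomial (Fin m) F) ≃+* FractionRing (MvPolynomial (Fin n) ℂ))
    (he : (e : FractionRing (MvPolynomial (Fin m) F) →+*
      FractionRing (MvPolynomial (Fin n) ℂ)).comp
        (adjoinIndetsMap (π.comp MvPolynomial.C) m) =
        (algebraMap (MvPolynomial (Fin n) ℂ) (FractionRing (MvPolynomial (Fin n) ℂ))).comp
          MvPolynomial.C) : False := by
  classical
  obtain ⟨O, a, h2, hom, hap, har⟩ := hspec
  obtain ⟨A, hA1, hA2, hdiv, hA4⟩ := exists_valuationSubring_chart hdisc h2 hap har π hπ hfrac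
  set c : ℂ →+* F := π.comp MvPolynomial.C with hc
  have homp : ∀ i j, (p i j).IsHomogeneous ((d i + d j) / 2) := fun i j => by
    rw [← hap]; exact (hom i j).map _
  let ζ : Fin 4 → MvPolynomial (Fin 5) ℂ :=
    ![1, MvPolynomial.X 2, MvPolynomial.X 3, MvPolynomial.X 4]
  obtain ⟨B, W, hW, hrel, ⟨g, hg, hB0⟩, N, hN, v, hv, hBN⟩ := exists_arc_of_stablyRational c e he
    hpar homp (π (MvPolynomial.X 0)) (π (MvPolynomial.X 1)) (fun i => π (ζ i))
    (Function.ne_iff.mpr ⟨0, by simp [ζ]⟩) (by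
      have h0 := (hπ (quadricBundleChartPoly p)).mpr dvd_rfl
      simp only [quadricBundleChartPoly, map_sum, map_mul, eval₂_eq_map_dehomP2] at h0
      exact h0)
  -- the induced homomorphism of valuation rings
  let ι : O →+* A := (c.comp O.subtype).codRestrict A.toSubring hA1
  have hι : ∀ x : O, (ι x : F) = c x := fun x => rfl
  have hιres : ∀ x : O, residue O x = 0 → residue A (ι x) = 0 := by
    intro x hx
    rw [residue_eq_zero_iff, ValuationSubring.valuation_lt_one_iff]
    exact hA2 x hx
  have hI : (Complex.I) ∈ O := by
    rcases O.mem_or_inv_mem Complex.I with h | h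
    · exact h
    · rw [Complex.inv_I] at h
      exact (neg_neg Complex.I) ▸ O.neg_mem _ h
  have hIsq : residue A (ι ⟨_, hI⟩) ^ 2 = -1 := by
    have : (⟨_, hI⟩ : O) ^ 2 = -1 := Subtype.ext (by simp)
    rw [← map_pow, ← map_pow, this]
    simp
  have hred : ∀ i j, MvPolynomial.map (residue A) (MvPolynomial.map ι (a i j)) =
      if i = j then MvPolynomial.map (Int.castRingHom _) (f i) else 0 := by
    intro i j
    have key : ∀ (x : O) (k : ℤ), residue O x = k → residue A (ι x) = k := by
      intro x k hx
      rw [← sub_eq_zero, ← map_intCast (residue A), ← map_intCast ι, ← map_sub, ← map_sub]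
      refine hιres _ ?_
      rw [map_sub, hx, map_intCast, sub_self]
    ext μ
    have hμ := congrArg (MvPolynomial.coeff μ) (har i j)
    rw [MvPolynomial.coeff_map, MvPolynomial.coeff_map]
    rw [MvPolynomial.coeff_map] at hμ
    split_ifs at hμ ⊢ with hij
    · rw [MvPolynomial.coeff_map] at hμ ⊢
      exact key _ _ hμ
    · rw [MvPolynomial.coeff_zero] at hμ ⊢
      simpa using key _ 0 (by simpa using hμ)
  have hrel' : ∑ i, ∑ j, MvPolynomial.eval₂ (C.comp A.subtype) B
      (MvPolynomial.map ι (a i j)) * W i * W j = 0 := by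
    rw [← hrel]
    refine Finset.sum_congr rfl fun i _ => Finset.sum_congr rfl fun j _ => ?_
    rw [← hap, MvPolynomial.eval₂_map, MvPolynomial.eval₂_map]
    rfl
  have hlow : RedAniso A fun k => (B k).coeff 0 := by
    have := hA4.smul hg
    simpa only [hB0] using this
  obtain ⟨k, hk⟩ := Function.ne_iff.mp hv
  have htop := RedAniso.of_coeff_zero A hdiv hIsq hpar hf (fun i j => (hom i j).map ι) hred B W hW
    hrel' N hN ⟨k, by rw [hBN]; exact (map_ne_zero c).mpr hk⟩ hlow
  refine htop.not_ternIso ?_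
  simp only [hBN]
  exact (ternIso_of_isAlgClosed _ _ _).map c

theorem not_isStablyRational_quadricBundle (hpar : ∀ i j, Even (d i + d j)) (hf : SpecialIso f)
    (hdisc : HasReferenceDiscriminant f) (hspec : SpecializesTo p d f) :
    ¬ IsStablyRationalFunctionField (quadricBundleFFMap p) := by
  rintro ⟨m, n, e, he⟩
  let R := MvPolynomial (Fin 5) ℂ ⧸ Ideal.span {quadricBundleChartPoly p}
  have hinj : Function.Injective (algebraMap R (FractionRing R)) :=
    IsLocalization.injective _ le_rfl
  have hinj' : Function.Injective (algebraMap (MvPolynomial (Fin m) (FractionRing R))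
      (FractionRing (MvPolynomial (Fin m) (FractionRing R)))) := IsLocalization.injective _ le_rfl
  let Φ : R →+* ratFuncField ℂ n :=
    (e : FractionRing (MvPolynomial (Fin m) (quadricBundleFunctionField p)) →+* _).comp
      (((algebraMap (MvPolynomial (Fin m) (FractionRing R))
      (FractionRing (MvPolynomial (Fin m) (FractionRing R)))).comp
        MvPolynomial.C).comp (algebraMap R (FractionRing R)))
  have hΦ : Function.Injective Φ :=
    e.injective.comp ((hinj'.comp (MvPolynomial.C_injective _ _)).comp hinj)
  have : IsDomain R := hΦ.isDomain Φ
  let π : MvPolynomial (Fin 5) ℂ →+* FractionRing R :=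
    (algebraMap R (FractionRing R)).comp (Ideal.Quotient.mk _)
  refine not_stablyRational_of_specializesTo hpar hf hdisc hspec π (fun P => ?_) (fun l => ?_) e he
  · rw [RingHom.comp_apply, map_eq_zero_iff _ hinj, Ideal.Quotient.eq_zero_iff_mem,
      Ideal.mem_span_singleton]
  · obtain ⟨P, Q, hQ, rfl⟩ := IsFractionRing.div_surjective (A := R) l
    obtain ⟨P, rfl⟩ := Ideal.Quotient.mk_surjective P
    obtain ⟨Q, rfl⟩ := Ideal.Quotient.mk_surjective Q
    exact ⟨P, Q, (map_ne_zero_iff _ hinj).mpr (nonZeroDivisors.ne_zero hQ), rfl⟩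

end NotStablyRational

/-! ### Diagonal reference quadric bundles -/

section ReferenceMembers

open MvPolynomial

/-- A diagonal form suitable as a specialisation of very general quadric bundles. -/
def IsReferenceForm (d : Fin 4 → ℕ) (f : Fin 4 → MvPolynomial (Fin 3) ℤ) : Prop :=
  (∀ k, (f k).IsHomogeneous (d k)) ∧ SpecialIso f ∧ HasReferenceDiscriminant f

theorem IsReferenceForm.of_perm {d : Fin 4 → ℕ} {f : Fin 4 → MvPolynomial (Fin 3) ℤ}
    (σ : Equiv.Perm (Fin 4)) (h : IsReferenceForm (d ∘ σ) f) : IsReferenceForm d (f ∘ σ.symm) := by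
  obtain ⟨h1, h2, h3⟩ := h
  refine ⟨fun k => by simpa using h1 (σ.symm k), ?_, ?_⟩
  · intro R _ _ b Z hb0 hb1 hb2 hZ h
    refine h2 R b (Z ∘ σ) hb0 hb1 hb2 (fun h0 => hZ ?_) ?_
    · funext k
      simpa using congrFun h0 (σ.symm k)
    · rw [← h, ← Equiv.sum_comp σ (fun k => aeval b ((f ∘ σ.symm) k) * Z k ^ 2)]
      simp
  · intro R _ x y
    rw [← h3 R x y, ← Equiv.prod_comp σ]
    simp

theorem isHomogeneous_conicForm :
    (conicForm (X 0) (X 1) (X 2) : MvPolynomial (Fin 3) ℤ).IsHomogeneous 2 := by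
  have hX : ∀ i : Fin 3, (X i : MvPolynomial (Fin 3) ℤ).IsHomogeneous 1 := isHomogeneous_X ℤ
  have hm : ∀ i j : Fin 3, (2 * X i * X j : MvPolynomial (Fin 3) ℤ).IsHomogeneous 2 := by
    intro i j
    have h2 : (2 : MvPolynomial (Fin 3) ℤ) = C 2 := by simp
    rw [h2]
    exact ((isHomogeneous_C _ (2 : ℤ)).mul (hX i)).mul (hX j)
  have hs : ∀ i : Fin 3, (X i ^ 2 : MvPolynomial (Fin 3) ℤ).IsHomogeneous 2 := fun i =>
    (hX i).pow 2
  exact (((((hs 0).add (hs 1)).add (hs 2)).sub (hm 0 1)).sub (hm 0 2)).sub (hm 1 2)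

/-- The reference form of a quadric bundle one of whose degrees is at least `4`. -/
noncomputable def refFormA (p q r s : ℕ) : Fin 4 → MvPolynomial (Fin 3) ℤ :=
  ![X 2 ^ p, X 0 * X 2 ^ q, X 1 * X 2 ^ r, X 0 * X 1 * X 2 ^ s * conicForm (X 0) (X 1) (X 2)]

/-- The reference form of a quadric bundle two of whose degrees are at least `2`. -/
noncomputable def refFormB (p q r s : ℕ) : Fin 4 → MvPolynomial (Fin 3) ℤ :=
  ![X 2 ^ p * conicForm (X 0) (X 1) (X 2), X 0 * X 2 ^ q, X 1 * X 2 ^ r, X 0 * X 1 * X 2 ^ s]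

theorem refFormA_isHomogeneous (p q r s : ℕ) (k : Fin 4) :
    (refFormA p q r s k).IsHomogeneous (![p, q + 1, r + 1, s + 4] k) := by
  have hX : ∀ (i : Fin 3), (X i : MvPolynomial (Fin 3) ℤ).IsHomogeneous 1 := isHomogeneous_X ℤ
  have hp : ∀ n, (X 2 ^ n : MvPolynomial (Fin 3) ℤ).IsHomogeneous n := fun n => by
    simpa using (hX 2).pow n
  fin_cases k
  · exact hp p
  · simpa [refFormA, add_comm] using (hX 0).mul (hp q)
  · simpa [refFormA, add_comm] using (hX 1).mul (hp r)
  · convert! (((hX 0).mul (hX 1)).mul (hp s)).mul isHomogeneous_conicForm using 1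
    simp; ring

theorem refFormB_isHomogeneous (p q r s : ℕ) (k : Fin 4) :
    (refFormB p q r s k).IsHomogeneous (![p + 2, q + 1, r + 1, s + 2] k) := by
  have hX : ∀ (i : Fin 3), (X i : MvPolynomial (Fin 3) ℤ).IsHomogeneous 1 := isHomogeneous_X ℤ
  have hp : ∀ n, (X 2 ^ n : MvPolynomial (Fin 3) ℤ).IsHomogeneous n := fun n => by
    simpa using (hX 2).pow n
  fin_cases k
  · exact (hp p).mul isHomogeneous_conicForm
  · simpa [refFormB, add_comm] using (hX 0).mul (hp q)
  · simpa [refFormB, add_comm] using (hX 1).mul (hp r)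
  · convert! ((hX 0).mul (hX 1)).mul (hp s) using 1
    simp; ring

theorem aeval_conicForm {R : Type} [CommRing R] (b : Fin 3 → R) :
    aeval b (conicForm (X 0) (X 1) (X 2) : MvPolynomial (Fin 3) ℤ) =
      conicForm (b 0) (b 1) (b 2) := by
  simp [conicForm]

theorem exists_ne_zero_of_ne {R : Type} [CommRing R] [IsDomain R] {Z m : Fin 4 → R} (hZ : Z ≠ 0)
    (hm : ∀ k, m k ≠ 0) :
    ¬ (m 0 * Z 0 = 0 ∧ m 1 * Z 1 = 0 ∧ m 2 * Z 2 = 0 ∧ m 3 * Z 3 = 0) := by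
  rintro ⟨h0, h1, h2, h3⟩
  refine hZ (_root_.funext fun k => ?_)
  have : m k * Z k = 0 := by fin_cases k <;> assumption
  exact (mul_eq_zero.mp this).resolve_left (hm k)

theorem refFormA_specialIso (p q r s : ℕ) (hq : Odd (p + q)) (hr : Odd (p + r))
    (hs : Even (p + s)) : SpecialIso (refFormA p q r s) := by
  intro R _ _ b Z hx hy hz hZ h
  simp only [Fin.sum_univ_four, refFormA, Matrix.cons_val_zero, Matrix.cons_val_one,
    Matrix.cons_val, map_mul, map_pow, aeval_X, aeval_conicForm] at h
  rcases Nat.even_or_odd' p with ⟨a, rfl | rfl⟩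
  · obtain ⟨β, rfl⟩ : ∃ β, q = 2 * β + 1 := ⟨q / 2, by grind⟩
    obtain ⟨γ, rfl⟩ : ∃ γ, r = 2 * γ + 1 := ⟨r / 2, by grind⟩
    obtain ⟨δ, rfl⟩ : ∃ δ, s = 2 * δ := ⟨s / 2, by grind⟩
    have h0 := exists_ne_zero_of_ne hZ (m := ![b 2 ^ a, b 2 ^ (β + 1), b 2 ^ (γ + 1), b 2 ^ δ])
      (by intro k; fin_cases k <;> exact pow_ne_zero _ hz)
    refine ⟨b 2 ^ (β + 1) * Z 1, b 2 ^ (γ + 1) * Z 2, b 2 ^ a * Z 0, b 2 ^ δ * Z 3,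
      fun ⟨h1, h2, h3, h4⟩ => h0 ⟨h3, h1, h2, h4⟩, ?_⟩
    linear_combination b 2 * h
  · obtain ⟨β, rfl⟩ : ∃ β, q = 2 * β := ⟨q / 2, by grind⟩
    obtain ⟨γ, rfl⟩ : ∃ γ, r = 2 * γ := ⟨r / 2, by grind⟩
    obtain ⟨δ, rfl⟩ : ∃ δ, s = 2 * δ + 1 := ⟨s / 2, by grind⟩
    have h0 := exists_ne_zero_of_ne hZ (m := ![b 2 ^ a, b 2 ^ β, b 2 ^ γ, b 2 ^ δ])
      (by intro k; fin_cases k <;> exact pow_ne_zero _ hz)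
    refine ⟨b 2 ^ β * Z 1, b 2 ^ γ * Z 2, b 2 ^ a * Z 0, b 2 ^ δ * Z 3,
      fun ⟨h1, h2, h3, h4⟩ => h0 ⟨h3, h1, h2, h4⟩, ?_⟩
    linear_combination h

theorem refFormB_specialIso (p q r s : ℕ) (hq : Odd (p + q)) (hr : Odd (p + r))
    (hs : Even (p + s)) : SpecialIso (refFormB p q r s) := by
  intro R _ _ b Z hx hy hz hZ h
  simp only [Fin.sum_univ_four, refFormB, Matrix.cons_val_zero, Matrix.cons_val_one,
    Matrix.cons_val, map_mul, map_pow, aeval_X, aeval_conicForm] at h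
  rcases Nat.even_or_odd' p with ⟨a, rfl | rfl⟩
  · obtain ⟨β, rfl⟩ : ∃ β, q = 2 * β + 1 := ⟨q / 2, by grind⟩
    obtain ⟨γ, rfl⟩ : ∃ γ, r = 2 * γ + 1 := ⟨r / 2, by grind⟩
    obtain ⟨δ, rfl⟩ : ∃ δ, s = 2 * δ := ⟨s / 2, by grind⟩
    have h0 := exists_ne_zero_of_ne hZ
      (m := ![b 2 ^ a, b 0 * b 2 ^ (β + 1), b 1 * b 2 ^ (γ + 1), b 0 * b 1 * b 2 ^ δ])
      (by intro k; fin_cases k <;> simp [hx, hy, hz])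
    refine ⟨b 1 * b 2 ^ (γ + 1) * Z 2, b 0 * b 2 ^ (β + 1) * Z 1, b 0 * b 1 * b 2 ^ δ * Z 3,
      b 2 ^ a * Z 0, fun ⟨h1, h2, h3, h4⟩ => h0 ⟨h4, h2, h1, h3⟩, ?_⟩
    linear_combination b 0 * b 1 * b 2 * h
  · obtain ⟨β, rfl⟩ : ∃ β, q = 2 * β := ⟨q / 2, by grind⟩
    obtain ⟨γ, rfl⟩ : ∃ γ, r = 2 * γ := ⟨r / 2, by grind⟩
    obtain ⟨δ, rfl⟩ : ∃ δ, s = 2 * δ + 1 := ⟨s / 2, by grind⟩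
    have h0 := exists_ne_zero_of_ne hZ
      (m := ![b 2 ^ a, b 0 * b 2 ^ β, b 1 * b 2 ^ γ, b 0 * b 1 * b 2 ^ δ])
      (by intro k; fin_cases k <;> simp [hx, hy, hz])
    refine ⟨b 1 * b 2 ^ γ * Z 2, b 0 * b 2 ^ β * Z 1, b 0 * b 1 * b 2 ^ δ * Z 3,
      b 2 ^ a * Z 0, fun ⟨h1, h2, h3, h4⟩ => h0 ⟨h4, h2, h1, h3⟩, ?_⟩
    linear_combination b 0 * b 1 * h

theorem refFormA_hasReferenceDiscriminant (p q r s : ℕ) :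
    HasReferenceDiscriminant (refFormA p q r s) := by
  intro R _ x y
  simp only [Fin.prod_univ_four, refFormA, ← coe_eval₂Hom]
  simp [conicForm]
  ring

theorem refFormB_hasReferenceDiscriminant (p q r s : ℕ) :
    HasReferenceDiscriminant (refFormB p q r s) := by
  intro R _ x y
  simp only [Fin.prod_univ_four, refFormB, ← coe_eval₂Hom]
  simp [conicForm]
  ring

theorem exists_isReferenceForm_of_four_le {d : Fin 4 → ℕ} (hpar : ∀ i j, Even (d i + d j))
    (h1 : 1 ≤ d 1) (h2 : 1 ≤ d 2) (h3 : 4 ≤ d 3) : ∃ f, IsReferenceForm d f := by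
  obtain ⟨q, hq⟩ := Nat.exists_eq_add_of_le' h1
  obtain ⟨r, hr⟩ := Nat.exists_eq_add_of_le' h2
  obtain ⟨s, hs⟩ := Nat.exists_eq_add_of_le' h3
  have e1 := hpar 0 1
  have e2 := hpar 0 2
  have e3 := hpar 0 3
  refine ⟨refFormA (d 0) q r s, fun k => ?_, refFormA_specialIso _ _ _ _ (by grind) (by grind)
    (by grind), refFormA_hasReferenceDiscriminant _ _ _ _⟩
  have := refFormA_isHomogeneous (d 0) q r s k
  rw [← hq, ← hr, ← hs] at this
  fin_cases k <;> exact this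

theorem exists_isReferenceForm_of_two_le {d : Fin 4 → ℕ} (hpar : ∀ i j, Even (d i + d j))
    (h0 : 2 ≤ d 0) (h1 : 1 ≤ d 1) (h2 : 1 ≤ d 2) (h3 : 2 ≤ d 3) : ∃ f, IsReferenceForm d f := by
  obtain ⟨p, hp⟩ := Nat.exists_eq_add_of_le' h0
  obtain ⟨q, hq⟩ := Nat.exists_eq_add_of_le' h1
  obtain ⟨r, hr⟩ := Nat.exists_eq_add_of_le' h2
  obtain ⟨s, hs⟩ := Nat.exists_eq_add_of_le' h3
  have e1 := hpar 0 1
  have e2 := hpar 0 2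
  have e3 := hpar 0 3
  refine ⟨refFormB p q r s, fun k => ?_, refFormB_specialIso _ _ _ _ (by grind) (by grind)
    (by grind), refFormB_hasReferenceDiscriminant _ _ _ _⟩
  have := refFormB_isHomogeneous p q r s k
  rw [← hp, ← hq, ← hr, ← hs] at this
  fin_cases k <;> exact this

theorem exists_perm_of_ne {i j : Fin 4} (h : i ≠ j) :
    ∃ σ : Equiv.Perm (Fin 4), σ 0 = i ∧ σ 3 = j := by
  refine ⟨Equiv.swap (Equiv.swap 0 i 3) j * Equiv.swap 0 i, ?_, ?_⟩ <;> revert i j <;> decide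

theorem exists_isReferenceForm {d : Fin 4 → ℕ} (hpar : ∀ i j, Even (d i + d j))
    (hsum : 8 ≤ ∑ i, d i) (hzero : ∀ i j, i ≠ j → d i = 0 → d j ≠ 0) :
    ∃ f, IsReferenceForm d f := by
  have key : ∀ σ : Equiv.Perm (Fin 4), 1 ≤ d (σ 1) → 1 ≤ d (σ 2) →
      (4 ≤ d (σ 3) ∨ 2 ≤ d (σ 0) ∧ 2 ≤ d (σ 3)) → ∃ f, IsReferenceForm d f := by
    intro σ h1 h2 h
    have : ∃ f, IsReferenceForm (d ∘ σ) f := by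
      rcases h with h3 | ⟨h0, h3⟩
      · exact exists_isReferenceForm_of_four_le (fun i j => hpar _ _) h1 h2 h3
      · exact exists_isReferenceForm_of_two_le (fun i j => hpar _ _) h0 h1 h2 h3
    obtain ⟨f, hf⟩ := this
    exact ⟨_, hf.of_perm σ⟩
  by_cases h4 : ∃ j, 4 ≤ d j
  · obtain ⟨j, hj⟩ := h4
    obtain ⟨i, hij, hi⟩ : ∃ i, i ≠ j ∧ ∀ k, k ≠ i → d k ≠ 0 := by
      by_cases h0 : ∃ i, d i = 0
      · obtain ⟨i, hi⟩ := h0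
        exact ⟨i, by rintro rfl; omega, fun k hk => hzero i k hk.symm hi⟩
      · push Not at h0
        obtain ⟨i, hi⟩ := exists_ne j
        exact ⟨i, hi, fun k _ => h0 k⟩
    obtain ⟨σ, hσ0, hσ3⟩ := exists_perm_of_ne hij
    refine key σ (Nat.one_le_iff_ne_zero.mpr (hi _ ?_)) (Nat.one_le_iff_ne_zero.mpr (hi _ ?_))
      (Or.inl (hσ3 ▸ hj)) <;> rw [← hσ0] <;> exact σ.injective.ne (by decide)
  · push Not at h4
    obtain ⟨i, j, hij, hi, hj, hk⟩ : ∃ i j, i ≠ j ∧ 2 ≤ d i ∧ 2 ≤ d j ∧ ∀ k, 1 ≤ d k := by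
      have e1 := hpar 0 1
      have e2 := hpar 0 2
      have e3 := hpar 0 3
      have b0 := h4 0
      have b1 := h4 1
      have b2 := h4 2
      have b3 := h4 3
      have z01 := hzero 0 1 (by decide)
      have z02 := hzero 0 2 (by decide)
      have z03 := hzero 0 3 (by decide)
      rw [Fin.sum_univ_four] at hsum
      have hk : ∀ k, 1 ≤ d k := by
        intro k
        fin_cases k <;> simp <;> grind
      by_cases c0 : 2 ≤ d 0
      · by_cases c1 : 2 ≤ d 1
        · exact ⟨0, 1, by decide, c0, c1, hk⟩
        · by_cases c2 : 2 ≤ d 2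
          · exact ⟨0, 2, by decide, c0, c2, hk⟩
          · exact ⟨0, 3, by decide, c0, by omega, hk⟩
      · by_cases c1 : 2 ≤ d 1
        · by_cases c2 : 2 ≤ d 2
          · exact ⟨1, 2, by decide, c1, c2, hk⟩
          · exact ⟨1, 3, by decide, c1, by omega, hk⟩
        · exact ⟨2, 3, by decide, by omega, by omega, hk⟩
    obtain ⟨σ, hσ0, hσ3⟩ := exists_perm_of_ne hij
    exact key σ (hk _) (hk _) (Or.inr ⟨hσ0 ▸ hi, hσ3 ▸ hj⟩)

end ReferenceMembers

/-! ### Rational hypersurfaces in affine five-space -/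

section RationalHypersurface

/-- The hypersurface `f = 0` in affine space has a rational parametrisation that is generically
injective. -/
def IsRationalHypersurface (f : MvPolynomial (Fin 5) ℂ) : Prop :=
  ∃ π : MvPolynomial (Fin 5) ℂ →ₐ[ℂ] FractionRing (MvPolynomial (Fin 4) ℂ),
    (∀ g, π g = 0 ↔ f ∣ g) ∧ ∀ e, ∃ a b, e = π a / π b

theorem IsRationalHypersurface.of_algEquiv {f : MvPolynomial (Fin 5) ℂ}
    (φ : MvPolynomial (Fin 5) ℂ ≃ₐ[ℂ] MvPolynomial (Fin 5) ℂ)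
    (h : IsRationalHypersurface (φ f)) : IsRationalHypersurface f := by
  obtain ⟨π, h1, h2⟩ := h
  refine ⟨π.comp (φ : MvPolynomial (Fin 5) ℂ →ₐ[ℂ] _), fun g => ?_, fun e => ?_⟩
  · rw [← map_dvd_iff φ, ← h1]
    rfl
  · obtain ⟨a, b, rfl⟩ := h2 e
    exact ⟨φ.symm a, φ.symm b, by simp⟩

theorem IsRationalHypersurface.isRationalFunctionField
    {A : Fin 4 → Fin 4 → MvPolynomial (Fin 3) ℂ}
    (h : IsRationalHypersurface (quadricBundleChartPoly A)) :
    IsRationalFunctionField (quadricBundleFFMap A) := by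
  obtain ⟨π, h1, h2⟩ := h
  let R := MvPolynomial (Fin 5) ℂ ⧸ Ideal.span {quadricBundleChartPoly A}
  let L := FractionRing (MvPolynomial (Fin 4) ℂ)
  let φ : R →+* L := Ideal.Quotient.lift _ (π : MvPolynomial (Fin 5) ℂ →+* L) (by
    intro a ha
    exact (h1 a).2 (Ideal.mem_span_singleton.1 ha))
  have hφ : ∀ a, φ (Ideal.Quotient.mk _ a) = π a := fun a => rfl
  have hinj : Function.Injective φ := by
    rw [injective_iff_map_eq_zero]
    intro a ha
    obtain ⟨a, rfl⟩ := Ideal.Quotient.mk_surjective a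
    rw [hφ, h1] at ha
    exact Ideal.Quotient.eq_zero_iff_mem.2 (Ideal.mem_span_singleton.2 ha)
  let : Algebra R L := φ.toAlgebra
  have : FaithfulSMul R L := (faithfulSMul_iff_algebraMap_injective R L).2 hinj
  have : IsFractionRing R L := by
    refine IsFractionRing.of_field R L fun e => ?_
    obtain ⟨a, b, rfl⟩ := h2 e
    exact ⟨Ideal.Quotient.mk _ a, Ideal.Quotient.mk _ b, rfl⟩
  let e : FractionRing R ≃ₐ[R] L := FractionRing.algEquiv R L
  have he : (e.toRingEquiv : FractionRing R →+* L).comp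
      ((algebraMap R (FractionRing R)).comp ((Ideal.Quotient.mk _).comp MvPolynomial.C)) =
      (algebraMap (MvPolynomial (Fin 4) ℂ) L).comp MvPolynomial.C := by
    ext c
    change e (algebraMap R (FractionRing R) (Ideal.Quotient.mk _ (MvPolynomial.C c))) = _
    rw [e.commutes]
    change π (MvPolynomial.C c) = _
    exact π.commutes c
  exact ⟨4, e.toRingEquiv, he⟩

open Polynomial in
theorem IsRationalHypersurface.of_linear {f : MvPolynomial (Fin 5) ℂ}
    {u w : MvPolynomial (Fin 4) ℂ} (hf : lastVarEquiv ℂ 4 f = C u * X + C w) (hu : u ≠ 0)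
    (huw : IsRelPrime u w) : IsRationalHypersurface f := by
  let A := MvPolynomial (Fin 4) ℂ
  let L := FractionRing A
  let ι : A →+* L := algebraMap A L
  have hι : Function.Injective ι := IsFractionRing.injective A L
  have hu' : ι u ≠ 0 := (map_ne_zero_iff ι hι).2 hu
  let r : L := -(ι w / ι u)
  let π : MvPolynomial (Fin 5) ℂ →ₐ[ℂ] L :=
    ((aeval r : A[X] →ₐ[A] L).restrictScalars ℂ).comp
      (lastVarEquiv ℂ 4 : MvPolynomial (Fin 5) ℂ →ₐ[ℂ] _)
  have hπ : ∀ g, π g = aeval r (lastVarEquiv ℂ 4 g) := fun g => rfl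
  refine ⟨π, fun g => ?_, fun e => ?_⟩
  · rw [hπ, ← map_dvd_iff (lastVarEquiv ℂ 4), hf]
    generalize lastVarEquiv ℂ 4 g = G
    constructor
    · intro hG
      have h1 : (X - C r) ∣ G.map ι := by
        rw [dvd_iff_isRoot, IsRoot.def, eval_map]
        exact hG
      obtain ⟨k, hk⟩ := h1
      obtain ⟨s, hs, hs'⟩ := IsLocalization.integerNormalization_spec
        (nonZeroDivisors A) (C (ι u)⁻¹ * k)
      set K := IsLocalization.integerNormalization (nonZeroDivisors A) (C (ι u)⁻¹ * k)
      have h2 : (C u * X + C w) * K = C s * G := by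
        apply map_injective ι hι
        have h3 : K.map ι = C (ι s) * (C (ι u)⁻¹ * k) := by
          rw [hs', Algebra.smul_def]
          rfl
        have h4 : (C (ι u) * X + C (ι w)) = C (ι u) * (X - C r) := by
          rw [mul_sub, ← C_mul, mul_neg, mul_div_cancel₀ _ hu']
          simp
        have h5 : C (ι u) * C (ι u)⁻¹ = 1 := by rw [← C_mul, mul_inv_cancel₀ hu', C_1]
        simp only [Polynomial.map_mul, Polynomial.map_add, map_C, map_X, h3, hk, h4]
        linear_combination (X - C r) * C (ι s) * k * h5
      have h6 : IsRelPrime (C u * X + C w) (C s) := by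
        intro c h7 h8
        have hs0 : (C s : A[X]) ≠ 0 := C_ne_zero.2 (nonZeroDivisors.ne_zero hs)
        have h9 : c.natDegree = 0 := by
          have := natDegree_le_of_dvd h8 hs0
          rwa [natDegree_C, Nat.le_zero] at this
        rw [eq_C_of_natDegree_eq_zero h9] at h7 ⊢
        rw [C_dvd_iff_dvd_coeff] at h7
        exact (huw (by simpa using h7 1) (by simpa using h7 0)).map C
      exact h6.dvd_of_dvd_mul_left ⟨K, h2.symm⟩
    · rintro ⟨k, rfl⟩
      have : aeval r (C u * X + C w : A[X]) = 0 := by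
        simp only [map_add, map_mul, aeval_C, aeval_X]
        change ι u * -(ι w / ι u) + ι w = 0
        rw [mul_neg, mul_div_cancel₀ _ hu', neg_add_cancel]
      rw [map_mul, this, zero_mul]
  · obtain ⟨a, b, hb, rfl⟩ := IsFractionRing.div_surjective (A := A) e
    refine ⟨(lastVarEquiv ℂ 4).symm (C a), (lastVarEquiv ℂ 4).symm (C b), ?_⟩
    rw [hπ, hπ, AlgEquiv.apply_symm_apply, AlgEquiv.apply_symm_apply, aeval_C, aeval_C]

open Polynomial in
theorem IsRelPrime.of_isCoprime_map {R k : Type*} [CommRing R] [IsDomain R] [Field k] {u w : R[X]}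
    (ε : R →+* k) (hu : IsUnit u.leadingCoeff) (h : IsCoprime (u.map ε) (w.map ε)) :
    IsRelPrime u w := by
  intro c hcu hcw
  have hlc : IsUnit c.leadingCoeff := by
    obtain ⟨e, rfl⟩ := hcu
    rw [leadingCoeff_mul] at hu
    exact isUnit_of_mul_isUnit_left hu
  have hc : IsUnit (c.map ε) :=
    h.isRelPrime (Polynomial.map_dvd ε hcu) (Polynomial.map_dvd ε hcw)
  have hdeg : c.natDegree = 0 := by
    rw [← natDegree_map_of_leadingCoeff_ne_zero ε (hlc.map ε).ne_zero]
    exact natDegree_eq_zero_of_isUnit hc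
  rw [eq_C_of_natDegree_eq_zero hdeg]
  rw [leadingCoeff, hdeg] at hlc
  exact hlc.map C

end RationalHypersurface

/-! ### Permuting the fibre coordinates -/

section PermuteCoordinates

open MvPolynomial

/-- The homogeneous fibre coordinates of a point of an affine chart. -/
def fibreCoord {E : Type} [One E] (v : Fin 5 → E) : Fin 4 → E := ![1, v 2, v 3, v 4]

/-- The point of an affine chart obtained by permuting the homogeneous fibre coordinates. -/
def permPoint {E : Type} [Field E] (τ : Equiv.Perm (Fin 4)) (v : Fin 5 → E) : Fin 5 → E :=
  ![v 0, v 1, fibreCoord v (τ 1) / fibreCoord v (τ 0), fibreCoord v (τ 2) / fibreCoord v (τ 0),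
    fibreCoord v (τ 3) / fibreCoord v (τ 0)]

variable {E : Type} [Field E]

theorem fibreCoord_permPoint {τ : Equiv.Perm (Fin 4)} {v : Fin 5 → E}
    (hv : fibreCoord v (τ 0) ≠ 0) (i : Fin 4) :
    fibreCoord (permPoint τ v) i = fibreCoord v (τ i) / fibreCoord v (τ 0) := by
  fin_cases i
  · exact (div_self hv).symm
  · rfl
  · rfl
  · rfl

theorem permPoint_symm_permPoint {τ : Equiv.Perm (Fin 4)} {v : Fin 5 → E}
    (hv : fibreCoord v (τ 0) ≠ 0) : permPoint τ.symm (permPoint τ v) = v := by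
  have h : ∀ i, fibreCoord (permPoint τ v) (τ.symm i) / fibreCoord (permPoint τ v) (τ.symm 0) =
      fibreCoord v i := by
    intro i
    rw [fibreCoord_permPoint hv, fibreCoord_permPoint hv, τ.apply_symm_apply, τ.apply_symm_apply,
      div_div_div_cancel_right₀ hv]
    exact div_one _
  funext i
  fin_cases i
  · rfl
  · rfl
  · exact h 1
  · exact h 2
  · exact h 3

theorem aeval_fibreCoord_X [Algebra ℂ E] (v : Fin 5 → E) (i : Fin 4) :
    aeval v (fibreCoord (X : Fin 5 → MvPolynomial (Fin 5) ℂ) i) = fibreCoord v i := by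
  fin_cases i
  · exact map_one _
  · exact aeval_X v 2
  · exact aeval_X v 3
  · exact aeval_X v 4

theorem aeval_dehomP2 {S : Type} [CommRing S] [Algebra ℂ S] (v : Fin 5 → S)
    (a : MvPolynomial (Fin 3) ℂ) : aeval v (dehomP2 a) = aeval ![v 0, v 1, 1] a := by
  have : (aeval v).comp (aeval ![X 0, X 1, 1] : MvPolynomial (Fin 3) ℂ →ₐ[ℂ] MvPolynomial (Fin 5) ℂ)
      = aeval ![v 0, v 1, 1] := by
    apply algHom_ext
    intro i
    fin_cases i <;> simp
  exact AlgHom.congr_fun this a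

theorem aeval_quadricBundleChartPoly {S : Type} [CommRing S] [Algebra ℂ S] (v : Fin 5 → S)
    (A : Fin 4 → Fin 4 → MvPolynomial (Fin 3) ℂ) :
    aeval v (quadricBundleChartPoly A) =
      ∑ i, ∑ j, aeval ![v 0, v 1, 1] (A i j) * fibreCoord v i * fibreCoord v j := by
  have h : ∀ i, aeval v (![1, X 2, X 3, X 4] i : MvPolynomial (Fin 5) ℂ) = fibreCoord v i := by
    intro i
    fin_cases i <;> simp [fibreCoord]
  simp only [quadricBundleChartPoly, map_sum, map_mul, aeval_dehomP2, h]

theorem aeval_permPoint_quadricBundleChartPoly [Algebra ℂ E] (τ : Equiv.Perm (Fin 4))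
    (v : Fin 5 → E) (hv : fibreCoord v (τ 0) ≠ 0)
    (A B : Fin 4 → Fin 4 → MvPolynomial (Fin 3) ℂ) (hAB : ∀ i j, B (τ i) (τ j) = A i j) :
    aeval (permPoint τ v) (quadricBundleChartPoly A) * fibreCoord v (τ 0) ^ 2 =
      aeval v (quadricBundleChartPoly B) := by
  rw [aeval_quadricBundleChartPoly, aeval_quadricBundleChartPoly, Finset.sum_mul]
  conv_rhs => rw [← Equiv.sum_comp τ]
  refine Finset.sum_congr rfl fun i _ => ?_
  rw [Finset.sum_mul]
  conv_rhs => rw [← Equiv.sum_comp τ]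
  refine Finset.sum_congr rfl fun j _ => ?_
  rw [fibreCoord_permPoint hv, fibreCoord_permPoint hv, hAB]
  have : (![permPoint τ v 0, permPoint τ v 1, 1] : Fin 3 → E) = ![v 0, v 1, 1] := rfl
  rw [this]
  field_simp

theorem exists_aeval_permPoint (τ : Equiv.Perm (Fin 4)) (g : MvPolynomial (Fin 5) ℂ) :
    ∃ (N : ℕ) (g' : MvPolynomial (Fin 5) ℂ), ∀ (E : Type) [Field E] [Algebra ℂ E] (v : Fin 5 → E),
      fibreCoord v (τ 0) ≠ 0 →
        aeval (permPoint τ v) g * fibreCoord v (τ 0) ^ N = aeval v g' := by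
  induction g using MvPolynomial.induction_on with
  | C a => exact ⟨0, C a, fun E _ _ v hv => by simp⟩
  | add g h hg hh =>
    obtain ⟨N, g', hg⟩ := hg
    obtain ⟨M, h', hh⟩ := hh
    refine ⟨N + M, g' * fibreCoord X (τ 0) ^ M + h' * fibreCoord X (τ 0) ^ N,
      fun E _ _ v hv => ?_⟩
    simp only [map_add, map_mul, map_pow, aeval_fibreCoord_X, ← hg E v hv, ← hh E v hv]
    ring
  | mul_X g i hg =>
    obtain ⟨N, g', hg⟩ := hg
    have hX : ∃ x' : MvPolynomial (Fin 5) ℂ, ∀ (E : Type) [Field E] [Algebra ℂ E] (v : Fin 5 → E),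
        fibreCoord v (τ 0) ≠ 0 → permPoint τ v i * fibreCoord v (τ 0) = aeval v x' := by
      fin_cases i
      · refine ⟨X 0 * fibreCoord X (τ 0), fun E _ _ v hv => ?_⟩
        rw [map_mul, aeval_fibreCoord_X, aeval_X]
        rfl
      · refine ⟨X 1 * fibreCoord X (τ 0), fun E _ _ v hv => ?_⟩
        rw [map_mul, aeval_fibreCoord_X, aeval_X]
        rfl
      · exact ⟨fibreCoord X (τ 1), fun E _ _ v hv => by
          rw [aeval_fibreCoord_X]; exact div_mul_cancel₀ _ hv⟩
      · exact ⟨fibreCoord X (τ 2), fun E _ _ v hv => by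
          rw [aeval_fibreCoord_X]; exact div_mul_cancel₀ _ hv⟩
      · exact ⟨fibreCoord X (τ 3), fun E _ _ v hv => by
          rw [aeval_fibreCoord_X]; exact div_mul_cancel₀ _ hv⟩
    obtain ⟨x', hx⟩ := hX
    refine ⟨N + 1, g' * x', fun E _ _ v hv => ?_⟩
    rw [map_mul, map_mul, aeval_X, ← hg E v hv, ← hx E v hv]
    ring

theorem fibreCoord_X_eq (i : Fin 4) :
    fibreCoord (X : Fin 5 → MvPolynomial (Fin 5) ℂ) i = 1 ∧ i = 0 ∨
      ∃ k, fibreCoord (X : Fin 5 → MvPolynomial (Fin 5) ℂ) i = X k := by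
  fin_cases i
  · exact Or.inl ⟨rfl, rfl⟩
  · exact Or.inr ⟨2, rfl⟩
  · exact Or.inr ⟨3, rfl⟩
  · exact Or.inr ⟨4, rfl⟩

theorem isRelPrime_fibreCoord_X (i : Fin 4) {f : MvPolynomial (Fin 5) ℂ} (hf : eval 0 f ≠ 0) :
    IsRelPrime (fibreCoord (X : Fin 5 → MvPolynomial (Fin 5) ℂ) i) f := by
  obtain ⟨h, -⟩ | ⟨k, h⟩ := fibreCoord_X_eq i
  · rw [h]
    exact isRelPrime_one_left
  · rw [h, (X_prime (R := ℂ) (i := k)).irreducible.isRelPrime_iff_not_dvd]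
    rintro ⟨g, rfl⟩
    simp at hf

theorem IsRationalHypersurface.of_perm (τ : Equiv.Perm (Fin 4))
    {A B : Fin 4 → Fin 4 → MvPolynomial (Fin 3) ℂ} (hAB : ∀ i j, B (τ i) (τ j) = A i j)
    (hA : eval 0 (quadricBundleChartPoly A) ≠ 0) (hB : eval 0 (quadricBundleChartPoly B) ≠ 0)
    (h : IsRationalHypersurface (quadricBundleChartPoly B)) :
    IsRationalHypersurface (quadricBundleChartPoly A) := by
  obtain ⟨π, h1, h2⟩ := h
  let L := FractionRing (MvPolynomial (Fin 4) ℂ)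
  let v : Fin 5 → L := fun i => π (X i)
  have hπ : ∀ g, π g = aeval v g := fun g => by
    rw [aeval_unique π]
    rfl
  have hne : ∀ i, fibreCoord v i ≠ 0 := by
    intro i hi
    rw [← aeval_fibreCoord_X, ← hπ, h1] at hi
    have hu := isRelPrime_fibreCoord_X i hB hi dvd_rfl
    have h0 := (hu.map π).ne_zero
    exact h0 ((h1 _).2 dvd_rfl)
  refine ⟨aeval (permPoint τ v), fun g => ⟨fun hg => ?_, ?_⟩, fun e => ?_⟩
  · obtain ⟨N, g', hg'⟩ := exists_aeval_permPoint τ g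
    have h3 : quadricBundleChartPoly B ∣ g' := by
      rw [← h1, hπ, ← hg' L v (hne _), hg, zero_mul]
    obtain ⟨k, rfl⟩ := h3
    obtain ⟨M, k', hk'⟩ := exists_aeval_permPoint τ.symm k
    let E := FractionRing (MvPolynomial (Fin 5) ℂ)
    let ι : MvPolynomial (Fin 5) ℂ →ₐ[ℂ] E := IsScalarTower.toAlgHom ℂ _ _
    have hι : Function.Injective ι := IsFractionRing.injective _ _
    let x : Fin 5 → E := fun i => ι (X i)
    have hx : ∀ g, ι g = aeval x g := fun g => by
      rw [aeval_unique ι]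
      rfl
    have hxne : ∀ i, fibreCoord x i ≠ 0 := by
      intro i hi
      rw [← aeval_fibreCoord_X, ← hx, map_eq_zero_iff ι hι] at hi
      obtain ⟨h4, -⟩ | ⟨k, h4⟩ := fibreCoord_X_eq i
      · exact one_ne_zero (h4.symm.trans hi)
      · exact X_ne_zero _ (h4.symm.trans hi)
    let y := permPoint τ.symm x
    have hyx : permPoint τ y = x := by
      have := permPoint_symm_permPoint (τ := τ.symm) (v := x) (hxne _)
      rwa [Equiv.symm_symm] at this
    have hy : fibreCoord y (τ 0) * fibreCoord x (τ.symm 0) = 1 := by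
      rw [fibreCoord_permPoint (hxne _), div_mul_cancel₀ _ (hxne _), Equiv.symm_apply_apply]
      rfl
    have hyne : fibreCoord y (τ 0) ≠ 0 := left_ne_zero_of_mul_eq_one hy
    have e1 := hg' E y hyne
    rw [hyx, map_mul] at e1
    have e2 := aeval_permPoint_quadricBundleChartPoly τ.symm x (hxne _) B A
      (fun i j => by rw [← hAB]; simp)
    have e3 := hk' E x (hxne _)
    set H := fibreCoord x (τ.symm 0)
    have e4 : aeval x g * H ^ (M + 2) =
        aeval x (quadricBundleChartPoly A) * (aeval x k' * H ^ N) := by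
      rw [← e2, ← e3]
      have : aeval x g = aeval x g * (fibreCoord y (τ 0) ^ N * H ^ N) := by
        rw [← mul_pow, hy, one_pow, mul_one]
      rw [this, ← mul_assoc, e1]
      ring
    have e5 : H = ι (fibreCoord X (τ.symm 0)) := by rw [hx, aeval_fibreCoord_X]
    rw [e5, ← hx, ← hx, ← hx, ← map_pow, ← map_pow, ← map_mul, ← map_mul, ← map_mul] at e4
    have e6 := hι e4
    have e7 : IsRelPrime (quadricBundleChartPoly A) (fibreCoord X (τ.symm 0) ^ (M + 2)) :=
      (isRelPrime_fibreCoord_X _ hA).symm.pow_right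
    exact e7.dvd_of_dvd_mul_right ⟨_, e6⟩
  · rintro ⟨k, rfl⟩
    have := aeval_permPoint_quadricBundleChartPoly τ v (hne _) A B hAB
    rw [← hπ, (h1 _).2 dvd_rfl] at this
    rw [map_mul, (mul_eq_zero.1 this).resolve_right (pow_ne_zero _ (hne _)), zero_mul]
  · obtain ⟨a, b, rfl⟩ := h2 e
    have hw : fibreCoord (permPoint τ v) (τ.symm 0) ≠ 0 := by
      rw [fibreCoord_permPoint (hne _)]
      exact div_ne_zero (hne _) (hne _)
    obtain ⟨N, a', ha⟩ := exists_aeval_permPoint τ.symm a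
    obtain ⟨M, b', hb⟩ := exists_aeval_permPoint τ.symm b
    have ha := ha L _ hw
    have hb := hb L _ hw
    rw [permPoint_symm_permPoint (hne _), ← hπ] at ha hb
    refine ⟨a' * fibreCoord X (τ.symm 0) ^ M, b' * fibreCoord X (τ.symm 0) ^ N, ?_⟩
    simp only [map_mul, map_pow, aeval_fibreCoord_X, ← ha, ← hb]
    rw [mul_assoc, mul_assoc, mul_comm (_ ^ M), mul_div_mul_right]
    exact mul_ne_zero (pow_ne_zero _ hw) (pow_ne_zero _ hw)

end PermuteCoordinates

/-! ### Quadric bundles containing a constant isotropic section -/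

section IsotropicSection

open MvPolynomial

theorem IsRelPrime.of_map_mulEquiv {M N F : Type*} [CommMonoid M] [CommMonoid N] [EquivLike F M N]
    [MulEquivClass F M N] (e : F) {u w : M} (h : IsRelPrime (e u) (e w)) : IsRelPrime u w :=
  fun _ hu hw => (MulEquiv.isUnit_map e).1 (h (map_dvd e hu) (map_dvd e hw))

/-- The shear adding a multiple of the last coordinate to the last but one. -/
noncomputable def shearEquiv (ρ : ℂ) : MvPolynomial (Fin 5) ℂ ≃ₐ[ℂ] MvPolynomial (Fin 5) ℂ :=
  AlgEquiv.ofAlgHom (aeval ![X 0, X 1, X 2, X 3 + C ρ * X 4, X 4])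
    (aeval ![X 0, X 1, X 2, X 3 - C ρ * X 4, X 4])
    (by
      apply algHom_ext
      intro i
      fin_cases i <;> simp [algebraMap_eq])
    (by
      apply algHom_ext
      intro i
      fin_cases i <;> simp [algebraMap_eq])

theorem shearEquiv_apply (ρ : ℂ) (f : MvPolynomial (Fin 5) ℂ) :
    shearEquiv ρ f = aeval ![X 0, X 1, X 2, X 3 + C ρ * X 4, X 4] f := rfl

theorem lastVarEquiv_chartHom (a : MvPolynomial (Fin 3) ℂ) :
    lastVarEquiv ℂ 3 (chartHom ℂ a) = Polynomial.C (aeval ![X 0, X 1, 1] a) := by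
  have : ((lastVarEquiv ℂ 3 : MvPolynomial (Fin 4) ℂ ≃ₐ[ℂ] _) :
      MvPolynomial (Fin 4) ℂ →+* _).comp (chartHom ℂ) = Polynomial.C.comp
        (aeval ![X 0, X 1, 1] : MvPolynomial (Fin 3) ℂ →ₐ[ℂ] MvPolynomial (Fin 3) ℂ).toRingHom := by
    apply MvPolynomial.ringHom_ext
    · intro r; simp [chartHom_C, algebraMap_eq]
    · intro i
      have h0 := lastVarEquiv_X_castSucc (R := ℂ) (0 : Fin 3)
      have h1 := lastVarEquiv_X_castSucc (R := ℂ) (1 : Fin 3)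
      fin_cases i
      · simpa [chartHom_X] using h0
      · simpa [chartHom_X] using h1
      · simp [chartHom_X]
  exact RingHom.congr_fun this a

theorem eval_zero_aeval (a : MvPolynomial (Fin 3) ℂ) :
    eval 0 (aeval ![X 0, X 1, 1] a : MvPolynomial (Fin 3) ℂ) = eval ![0, 0, 1] a := by
  rw [aeval_def, ← coe_eval₂Hom, ← RingHom.comp_apply, ← eval₂_id]
  have : (eval (0 : Fin 3 → ℂ)).comp (eval₂Hom (algebraMap ℂ (MvPolynomial (Fin 3) ℂ))
      ![X 0, X 1, 1]) = eval₂Hom (RingHom.id ℂ) ![0, 0, 1] := by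
    apply ringHom_ext
    · intro r; simp [algebraMap_eq]
    · intro i; fin_cases i <;> simp
  exact RingHom.congr_fun this a

theorem isCoprime_linear_quadratic {k : Type*} [Field k] {e l a b c : k}
    (h : c * e ^ 2 - b * e * l + a * l ^ 2 ≠ 0) :
    IsCoprime (Polynomial.C l + Polynomial.C e * Polynomial.X)
      (Polynomial.C c + Polynomial.C b * Polynomial.X + Polynomial.C a * Polynomial.X ^ 2) := by
  set R := c * e ^ 2 - b * e * l + a * l ^ 2 with hR
  refine ⟨-Polynomial.C R⁻¹ * (Polynomial.C (a * e) * Polynomial.X + Polynomial.C (b * e - a * l)),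
    Polynomial.C R⁻¹ * Polynomial.C (e ^ 2), ?_⟩
  have h1 : Polynomial.C R⁻¹ * Polynomial.C R = 1 := by
    rw [← Polynomial.C_mul, inv_mul_cancel₀ h, Polynomial.C_1]
  rw [← h1]
  simp only [hR, Polynomial.C_mul, Polynomial.C_sub, Polynomial.C_add, Polynomial.C_pow]
  ring

theorem isRationalHypersurface_of_isotropic {B : Fin 4 → Fin 4 → MvPolynomial (Fin 3) ℂ}
    {a b c : ℂ} (ha : B 2 2 = C a) (hb : B 2 3 + B 3 2 = C b) (hc : B 3 3 = C c) (ha0 : a ≠ 0)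
    (hdisc : b ^ 2 - 4 * a * c ≠ 0)
    (hdet : 4 * eval ![0, 0, 1] (B 0 0) * a * c +
      eval ![0, 0, 1] (B 0 2 + B 2 0) * b * eval ![0, 0, 1] (B 0 3 + B 3 0) -
      eval ![0, 0, 1] (B 0 0) * b ^ 2 - c * eval ![0, 0, 1] (B 0 2 + B 2 0) ^ 2 -
      a * eval ![0, 0, 1] (B 0 3 + B 3 0) ^ 2 ≠ 0) :
    IsRationalHypersurface (quadricBundleChartPoly B) := by
  obtain ⟨ρ, hρ⟩ : ∃ ρ : ℂ, a * ρ ^ 2 + b * ρ + c = 0 := by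
    obtain ⟨s, hs⟩ := IsAlgClosed.exists_pow_nat_eq (b ^ 2 - 4 * a * c) two_pos
    refine ⟨(s - b) / (2 * a), ?_⟩
    field_simp
    linear_combination hs
  set e := 2 * ρ * a + b with he
  have he0 : e ≠ 0 := by
    intro h
    apply hdisc
    linear_combination (-4 * a) * hρ + e * h + (e + 2 * ρ * a + b) * he
  let D : Fin 4 → Fin 4 → MvPolynomial (Fin 4) ℂ := fun i j => chartHom ℂ (B i j)
  have hDa : D 2 2 = C a := by rw [← chartHom_C, ← ha]
  have hDb : D 2 3 + D 3 2 = C b := by rw [← chartHom_C, ← hb, map_add]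
  have hDc : D 3 3 = C c := by rw [← chartHom_C, ← hc]
  let u : MvPolynomial (Fin 4) ℂ := (C ρ * (D 0 2 + D 2 0) + (D 0 3 + D 3 0)) +
    (C ρ * (D 1 2 + D 2 1) + (D 1 3 + D 3 1)) * X 2 + C e * X 3
  let w : MvPolynomial (Fin 4) ℂ := D 0 0 + (D 0 1 + D 1 0) * X 2 + D 1 1 * X 2 ^ 2 +
    (D 0 2 + D 2 0 + (D 1 2 + D 2 1) * X 2) * X 3 + C a * X 3 ^ 2
  let D' : Fin 4 → Fin 4 → MvPolynomial (Fin 3) ℂ := fun i j => aeval ![X 0, X 1, 1] (B i j)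
  have hD' : ∀ i j, lastVarEquiv ℂ 3 (D i j) = Polynomial.C (D' i j) :=
    fun i j => lastVarEquiv_chartHom _
  have h2 : lastVarEquiv ℂ 3 (X 2) = Polynomial.C (X 2) :=
    lastVarEquiv_X_castSucc (R := ℂ) (2 : Fin 3)
  have h3 : lastVarEquiv ℂ 3 (X 3) = Polynomial.X := lastVarEquiv_X_last (R := ℂ) (n := 3)
  have hu : lastVarEquiv ℂ 3 u = Polynomial.C ((C ρ * (D' 0 2 + D' 2 0) + (D' 0 3 + D' 3 0)) +
      (C ρ * (D' 1 2 + D' 2 1) + (D' 1 3 + D' 3 1)) * X 2) +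
      Polynomial.C (C e) * Polynomial.X := by
    simp [u, hD', h2, h3]
  have hrel : IsRelPrime u w := by
    apply IsRelPrime.of_map_mulEquiv (lastVarEquiv ℂ 3)
    have hw : lastVarEquiv ℂ 3 w = Polynomial.C (D' 0 0 + (D' 0 1 + D' 1 0) * X 2 +
        D' 1 1 * X 2 ^ 2) + Polynomial.C (D' 0 2 + D' 2 0 + (D' 1 2 + D' 2 1) * X 2) *
        Polynomial.X + Polynomial.C (C a) * Polynomial.X ^ 2 := by
      simp [w, hD', h2, h3]
    rw [hu, hw]
    apply IsRelPrime.of_isCoprime_map (eval (0 : Fin 3 → ℂ))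
    · rw [add_comm, Polynomial.leadingCoeff_linear (by simpa using he0)]
      exact he0.isUnit.map C
    · simp only [Polynomial.map_add, Polynomial.map_mul, Polynomial.map_C, Polynomial.map_X,
        Polynomial.map_pow, eval_C]
      refine isCoprime_linear_quadratic ?_
      simp only [D', map_add, map_mul, eval_C, eval_zero_aeval, eval_X, Pi.zero_apply, map_pow]
      intro h
      apply hdet
      simp only [map_add]
      linear_combination (4 * a * eval ![0, 0, 1] (B 0 0) -
        (eval ![0, 0, 1] (B 0 2) + eval ![0, 0, 1] (B 2 0)) ^ 2) * hρ - h
  have hu0 : u ≠ 0 := by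
    intro h0
    have := congrArg (fun q => q.coeff 1) hu
    simp only [h0, map_zero, Polynomial.coeff_zero, Polynomial.coeff_add, Polynomial.coeff_C_mul,
      Polynomial.coeff_X_one, mul_one, Polynomial.coeff_C_succ, zero_add] at this
    exact he0 (C_injective _ _ (this.symm.trans C_0.symm))
  refine IsRationalHypersurface.of_algEquiv (shearEquiv ρ) (.of_linear (u := u) (w := w) ?_ hu0 hrel)
  have hd : ∀ a : MvPolynomial (Fin 3) ℂ, lastVarEquiv ℂ 4 (aeval ![X 0, X 1, 1] a) =
      Polynomial.C (chartHom ℂ a) := lastVarEquiv_dehomP2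
  have h2 : lastVarEquiv ℂ 4 (X 2) = Polynomial.C (X 2) :=
    lastVarEquiv_X_castSucc (R := ℂ) (2 : Fin 4)
  have h3 : lastVarEquiv ℂ 4 (X 3) = Polynomial.C (X 3) :=
    lastVarEquiv_X_castSucc (R := ℂ) (3 : Fin 4)
  have h4 : lastVarEquiv ℂ 4 (X 4) = Polynomial.X := lastVarEquiv_X_last (R := ℂ) (n := 4)
  rw [shearEquiv_apply, aeval_quadricBundleChartPoly]
  have hv : ![(![X 0, X 1, X 2, X 3 + C ρ * X 4, X 4] : Fin 5 → MvPolynomial (Fin 5) ℂ) 0,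
      (![X 0, X 1, X 2, X 3 + C ρ * X 4, X 4] : Fin 5 → MvPolynomial (Fin 5) ℂ) 1, 1] =
      ![X 0, X 1, 1] := rfl
  have hz : ∀ i, lastVarEquiv ℂ 4 (fibreCoord ![X 0, X 1, X 2, X 3 + C ρ * X 4, X 4] i) =
      ![1, Polynomial.C (X 2), Polynomial.C (X 3) + Polynomial.C (C ρ) * Polynomial.X,
        Polynomial.X] i := by
    intro i
    fin_cases i
    · exact map_one _
    · exact h2
    · change lastVarEquiv ℂ 4 (X 3 + C ρ * X 4) = _
      rw [map_add, map_mul, h3, h4, lastVarEquiv_C]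
      rfl
    · exact h4
  simp only [hv, map_sum, map_mul, hd, hz]
  simp only [Fin.sum_univ_four, Matrix.cons_val_zero, Matrix.cons_val_one, Matrix.cons_val]
  change Polynomial.C (D 0 0) * _ * _ + Polynomial.C (D 0 1) * _ * _ +
    Polynomial.C (D 0 2) * _ * _ + Polynomial.C (D 0 3) * _ * _ +
    (Polynomial.C (D 1 0) * _ * _ + Polynomial.C (D 1 1) * _ * _ +
    Polynomial.C (D 1 2) * _ * _ + Polynomial.C (D 1 3) * _ * _) +
    (Polynomial.C (D 2 0) * _ * _ + Polynomial.C (D 2 1) * _ * _ +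
    Polynomial.C (D 2 2) * _ * _ + Polynomial.C (D 2 3) * _ * _) +
    (Polynomial.C (D 3 0) * _ * _ + Polynomial.C (D 3 1) * _ * _ +
    Polynomial.C (D 3 2) * _ * _ + Polynomial.C (D 3 3) * _ * _) = _
  have kb : Polynomial.C (D 2 3) + Polynomial.C (D 3 2) = Polynomial.C (C b) := by
    rw [← hDb, Polynomial.C_add]
  have kρ : Polynomial.C (C a) * Polynomial.C (C ρ) ^ 2 + Polynomial.C (C b) * Polynomial.C (C ρ) +
      Polynomial.C (C c) = (0 : Polynomial (MvPolynomial (Fin 4) ℂ)) := by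
    have := congrArg (fun z => Polynomial.C (C z : MvPolynomial (Fin 4) ℂ)) hρ
    simpa using this
  rw [hDa, hDc]
  simp only [u, w, he, Polynomial.C_add, Polynomial.C_mul, Polynomial.C_pow, C_add, C_mul]
  simp only [map_ofNat]
  linear_combination (Polynomial.C (X 3) * Polynomial.X +
    Polynomial.C (C ρ) * Polynomial.X ^ 2) * kb + Polynomial.X ^ 2 * kρ

end IsotropicSection

/-! ### Quadric bundles that are linear in the base coordinates -/

section LinearEntries

open MvPolynomial

theorem MvPolynomial.IsHomogeneous.exists_eq_linear {a : MvPolynomial (Fin 3) ℂ}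
    (ha : a.IsHomogeneous 1) : a = C (eval ![1, 0, 0] a) * X 0 + C (eval ![0, 1, 0] a) * X 1 +
      C (eval ![0, 0, 1] a) * X 2 := by
  have h : ∀ i, ∃ c, pderiv i a = C c := by
    intro i
    have := ha.pderiv (i := i)
    rw [← totalDegree_zero_iff_isHomogeneous, totalDegree_eq_zero_iff_eq_C] at this
    exact ⟨_, this⟩
  choose c hc using h
  have := ha.sum_X_mul_pderiv
  simp only [hc, Fin.sum_univ_three, one_smul] at this
  rw [← this]
  simp
  ring

theorem isCoprime_quadratic {a b c a' b' c' : ℂ}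
    (h : (c * a' - c' * a) ^ 2 - (b * a' - b' * a) * (c * b' - c' * b) ≠ 0) :
    IsCoprime (Polynomial.C c + Polynomial.C b * Polynomial.X + Polynomial.C a * Polynomial.X ^ 2)
      (Polynomial.C c' + Polynomial.C b' * Polynomial.X +
        Polynomial.C a' * Polynomial.X ^ 2) := by
  rw [Polynomial.isCoprime_iff_aeval_ne_zero_of_isAlgClosed ℂ ℂ]
  intro t
  by_contra! h0
  obtain ⟨h1, h2⟩ := h0
  simp only [map_add, map_mul, map_pow, Polynomial.aeval_C, Polynomial.aeval_X,
    Algebra.algebraMap_self, RingHom.id_apply] at h1 h2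
  apply h
  have h3 : (b * a' - b' * a) * t + (c * a' - c' * a) = 0 := by
    linear_combination a' * h1 - a * h2
  have h4 : (c * b' - c' * b) - (b * a' - b' * a) * t ^ 2 = 0 := by
    linear_combination b' * h1 - b * h2
  linear_combination ((c * a' - c' * a) - (b * a' - b' * a) * t) * h3 - (b * a' - b' * a) * h4

theorem isRationalHypersurface_of_linear_entries {B : Fin 4 → Fin 4 → MvPolynomial (Fin 3) ℂ}
    (hB : ∀ i j, (B i j).IsHomogeneous 1) {a b c a' b' c' : ℂ}
    (ha : eval ![1, 0, 0] (B 1 1) = a) (hb : eval ![1, 0, 0] (B 0 1 + B 1 0) = b)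
    (hc : eval ![1, 0, 0] (B 0 0) = c)
    (ha' : eval ![0, 0, 1] (B 1 1) = a') (hb' : eval ![0, 0, 1] (B 0 1 + B 1 0) = b')
    (hc' : eval ![0, 0, 1] (B 0 0) = c') (ha0 : a ≠ 0)
    (hres : (c * a' - c' * a) ^ 2 - (b * a' - b' * a) * (c * b' - c' * b) ≠ 0) :
    IsRationalHypersurface (quadricBundleChartPoly B) := by
  let α := fun i j => eval ![1, 0, 0] (B i j)
  let β := fun i j => eval ![0, 1, 0] (B i j)
  let γ := fun i j => eval ![0, 0, 1] (B i j)
  have hlin : ∀ i j, B i j = C (α i j) * X 0 + C (β i j) * X 1 + C (γ i j) * X 2 := fun i j =>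
    (hB i j).exists_eq_linear
  let Z : Fin 4 → MvPolynomial (Fin 4) ℂ := ![1, X 3, X 1, X 2]
  let u : MvPolynomial (Fin 4) ℂ := ∑ i, ∑ j, C (α i j) * Z i * Z j
  let w : MvPolynomial (Fin 4) ℂ := ∑ i, ∑ j, (C (β i j) * X 0 + C (γ i j)) * Z i * Z j
  let σ : Equiv.Perm (Fin 5) :=
    { toFun := ![4, 0, 3, 1, 2]
      invFun := ![1, 3, 4, 2, 0]
      left_inv := by decide
      right_inv := by decide }
  have k0 : lastVarEquiv ℂ 3 (X 0) = Polynomial.C (X 0) :=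
    lastVarEquiv_X_castSucc (R := ℂ) (0 : Fin 3)
  have k1 : lastVarEquiv ℂ 3 (X 1) = Polynomial.C (X 1) :=
    lastVarEquiv_X_castSucc (R := ℂ) (1 : Fin 3)
  have k2 : lastVarEquiv ℂ 3 (X 2) = Polynomial.C (X 2) :=
    lastVarEquiv_X_castSucc (R := ℂ) (2 : Fin 3)
  have k3 : lastVarEquiv ℂ 3 (X 3) = Polynomial.X := lastVarEquiv_X_last (R := ℂ) (n := 3)
  have hZ : ∀ i, lastVarEquiv ℂ 3 (Z i) =
      ![1, Polynomial.X, Polynomial.C (X 1), Polynomial.C (X 2)] i := by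
    intro i
    fin_cases i <;> simp [Z, k1, k2, k3]
  have hbq : α 0 1 + α 1 0 = b := by rw [← hb, map_add]
  have hbq' : γ 0 1 + γ 1 0 = b' := by rw [← hb', map_add]
  obtain ⟨u₀, u₁, hu⟩ : ∃ u₀ u₁, lastVarEquiv ℂ 3 u =
      Polynomial.C (C a) * Polynomial.X ^ 2 + Polynomial.C u₁ * Polynomial.X +
        Polynomial.C u₀ := by
    refine ⟨C (α 0 0) + C (α 0 2 + α 2 0) * X 1 + C (α 0 3 + α 3 0) * X 2 + C (α 2 2) * X 1 ^ 2 +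
      C (α 2 3 + α 3 2) * X 1 * X 2 + C (α 3 3) * X 2 ^ 2, C (α 0 1 + α 1 0) +
      C (α 1 2 + α 2 1) * X 1 + C (α 1 3 + α 3 1) * X 2, ?_⟩
    simp only [u, map_sum, map_mul, hZ, lastVarEquiv_C, ← ha]
    simp only [Fin.sum_univ_four, Matrix.cons_val_zero, Matrix.cons_val_one, Matrix.cons_val]
    simp only [Polynomial.C_add, Polynomial.C_mul, Polynomial.C_pow, C_add]
    ring
  have hlead : (lastVarEquiv ℂ 3 u).leadingCoeff = C a := by
    rw [hu, Polynomial.leadingCoeff_quadratic (by simpa using ha0)]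
  have hrel : IsRelPrime u w := by
    apply IsRelPrime.of_map_mulEquiv (lastVarEquiv ℂ 3)
    apply IsRelPrime.of_isCoprime_map (eval (0 : Fin 3 → ℂ))
    · rw [hlead]
      exact ha0.isUnit.map C
    · have e1 : (lastVarEquiv ℂ 3 u).map (eval 0) = Polynomial.C c + Polynomial.C b *
          Polynomial.X + Polynomial.C a * Polynomial.X ^ 2 := by
        simp only [u, map_sum, map_mul, hZ, lastVarEquiv_C, Polynomial.map_sum, Polynomial.map_mul]
        simp only [Fin.sum_univ_four, Matrix.cons_val_zero, Matrix.cons_val_one, Matrix.cons_val,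
          Polynomial.map_C, Polynomial.map_X, Polynomial.map_one, eval_C, eval_X, Pi.zero_apply,
          Polynomial.C_0, ← hbq, ← ha, ← hc, Polynomial.C_add]
        ring
      have e2 : (lastVarEquiv ℂ 3 w).map (eval 0) = Polynomial.C c' + Polynomial.C b' *
          Polynomial.X + Polynomial.C a' * Polynomial.X ^ 2 := by
        simp only [w, map_sum, map_mul, map_add, hZ, lastVarEquiv_C, Polynomial.map_sum,
          Polynomial.map_mul, Polynomial.map_add, k0]
        simp only [Fin.sum_univ_four, Matrix.cons_val_zero, Matrix.cons_val_one, Matrix.cons_val,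
          Polynomial.map_C, Polynomial.map_X, Polynomial.map_one, eval_C, eval_X, Pi.zero_apply,
          Polynomial.C_0, ← hbq', ← ha', ← hc', Polynomial.C_add]
        ring
      rw [e1, e2]
      exact isCoprime_quadratic hres
  have hu0 : u ≠ 0 := by
    rintro h0
    rw [h0, map_zero, Polynomial.leadingCoeff_zero] at hlead
    exact ha0 (C_injective _ _ (hlead.symm.trans C_0.symm))
  refine IsRationalHypersurface.of_algEquiv (renameEquiv ℂ σ)
    (.of_linear (u := u) (w := w) ?_ hu0 hrel)
  have l0 : lastVarEquiv ℂ 4 (X 0) = Polynomial.C (X 0) :=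
    lastVarEquiv_X_castSucc (R := ℂ) (0 : Fin 4)
  have l1 : lastVarEquiv ℂ 4 (X 1) = Polynomial.C (X 1) :=
    lastVarEquiv_X_castSucc (R := ℂ) (1 : Fin 4)
  have l2 : lastVarEquiv ℂ 4 (X 2) = Polynomial.C (X 2) :=
    lastVarEquiv_X_castSucc (R := ℂ) (2 : Fin 4)
  have l3 : lastVarEquiv ℂ 4 (X 3) = Polynomial.C (X 3) :=
    lastVarEquiv_X_castSucc (R := ℂ) (3 : Fin 4)
  have l4 : lastVarEquiv ℂ 4 (X 4) = Polynomial.X := lastVarEquiv_X_last (R := ℂ) (n := 4)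
  have hren : renameEquiv ℂ σ (quadricBundleChartPoly B) =
      aeval (X ∘ σ) (quadricBundleChartPoly B) := by
    rw [renameEquiv_apply]
    exact AlgHom.congr_fun (algHom_ext (f := rename σ) (g := aeval (X ∘ σ)) (by simp)) _
  have hv : ![(X ∘ σ : Fin 5 → MvPolynomial (Fin 5) ℂ) 0,
      (X ∘ σ : Fin 5 → MvPolynomial (Fin 5) ℂ) 1, 1] = ![X 4, X 0, 1] := rfl
  have hz : ∀ i, lastVarEquiv ℂ 4 (fibreCoord (X ∘ σ) i) = Polynomial.C (Z i) := by
    intro i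
    fin_cases i
    · exact map_one _
    · exact l3
    · exact l1
    · exact l2
  have hd : ∀ i j, lastVarEquiv ℂ 4 (aeval ![X 4, X 0, 1] (B i j)) = Polynomial.C (C (α i j)) *
      Polynomial.X + Polynomial.C (C (β i j) * X 0 + C (γ i j)) := by
    intro i j
    rw [hlin]
    simp [l0, l4, algebraMap_eq]
    ring
  rw [hren, aeval_quadricBundleChartPoly]
  simp only [hv, map_sum, map_mul, hz, hd, u, w, Finset.sum_mul, ← Finset.sum_add_distrib]
  refine Finset.sum_congr rfl fun i _ => Finset.sum_congr rfl fun j _ => ?_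
  ring

end LinearEntries

/-! ### Very general quadric bundles in the rational cases -/

section VeryGeneralRational

open MvPolynomial

/-- The evaluation of a matrix entry at a point, as a linear functional on the parameter space. -/
noncomputable def entryEval (d : Fin 4 → ℕ) (t : (Fin 3 → ℂ) × Fin 4 × Fin 4) :
    (Π i : Fin 4, Π j : Fin 4, (homogeneousSubmodule (Fin 3) ℂ ((d i + d j) / 2))) →ₗ[ℂ] ℂ where
  toFun p := eval t.1 (p t.2.1 t.2.2 : MvPolynomial (Fin 3) ℂ)
  map_add' p q := by simp
  map_smul' c p := by simp

theorem veryGeneral_of_entryEval {d : Fin 4 → ℕ} {n : ℕ}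
    (G : Fin n → MvPolynomial ((Fin 3 → ℂ) × Fin 4 × Fin 4) ℤ)
    {Q : (Π i : Fin 4, Π j : Fin 4, (homogeneousSubmodule (Fin 3) ℂ ((d i + d j) / 2))) → Prop}
    (p₀ : Π i : Fin 4, Π j : Fin 4, (homogeneousSubmodule (Fin 3) ℂ ((d i + d j) / 2)))
    (h0 : ∀ k, aeval (fun t => entryEval d t p₀) (G k) ≠ 0)
    (h : ∀ p, (∀ k, aeval (fun t => entryEval d t p) (G k) ≠ 0) → Q p) : VeryGeneral Q := by
  refine ⟨Set.range fun k p => aeval (fun t => entryEval d t p) (G k), Set.countable_range _,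
    ?_, fun p hp => h p fun k => hp _ ⟨k, rfl⟩⟩
  rintro _ ⟨k, rfl⟩
  exact ⟨isPolynomialFun_aeval (entryEval d) (G k), fun h1 => h0 k (congrFun h1 p₀)⟩

theorem VeryGeneral.mono {P : Type} [AddCommGroup P] [Module ℂ P] {Q Q' : P → Prop}
    (h : VeryGeneral Q) (hQ : ∀ p, Q p → Q' p) : VeryGeneral Q' := by
  obtain ⟨𝒞, h1, h2, h3⟩ := h
  exact ⟨𝒞, h1, h2, fun p hp => hQ p (h3 p hp)⟩

theorem eval_zero_quadricBundleChartPoly (A : Fin 4 → Fin 4 → MvPolynomial (Fin 3) ℂ) :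
    eval 0 (quadricBundleChartPoly A) = eval ![0, 0, 1] (A 0 0) := by
  have := aeval_quadricBundleChartPoly (0 : Fin 5 → ℂ) A
  simpa [Fin.sum_univ_four, fibreCoord, coe_aeval_eq_eval] using this

theorem MvPolynomial.IsHomogeneous.eq_C_eval {a : MvPolynomial (Fin 3) ℂ}
    (ha : a.IsHomogeneous 0) (v : Fin 3 → ℂ) : a = C (eval v a) := by
  rw [← totalDegree_zero_iff_isHomogeneous, totalDegree_eq_zero_iff_eq_C] at ha
  rw [ha, eval_C]

theorem exists_perm_apply_eq {i j : Fin 4} (hij : i ≠ j) :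
    ∃ τ : Equiv.Perm (Fin 4), τ i = 2 ∧ τ j = 3 := by
  refine ⟨(Equiv.swap i 2).trans (Equiv.swap (Equiv.swap i 2 j) 3), ?_⟩
  revert i j
  decide

theorem veryGeneral_isRationalHypersurface_of_zeros {d : Fin 4 → ℕ} {i j : Fin 4} (hij : i ≠ j)
    (hi : d i = 0) (hj : d j = 0) :
    VeryGeneral (P := Π i : Fin 4, Π j : Fin 4, (homogeneousSubmodule (Fin 3) ℂ ((d i + d j) / 2)))
      (fun p => IsRationalHypersurface (quadricBundleChartPoly fun i j => p i j)) := by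
  obtain ⟨τ, hτi, hτj⟩ := exists_perm_apply_eq hij
  have hτi' : τ.symm 2 = i := by rw [← hτi, τ.symm_apply_apply]
  have hτj' : τ.symm 3 = j := by rw [← hτj, τ.symm_apply_apply]
  set k := τ.symm 0 with hk
  have hki : k ≠ i := by rw [← hτi', hk, τ.symm.injective.ne_iff]; decide
  have hkj : k ≠ j := by rw [← hτj', hk, τ.symm.injective.ne_iff]; decide
  let y : Fin 4 → Fin 4 → MvPolynomial ((Fin 3 → ℂ) × Fin 4 × Fin 4) ℤ := fun i j =>
    X (![0, 0, 1], i, j)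
  refine veryGeneral_of_entryEval ![y 0 0, y k k, y i i, (y i j + y j i) ^ 2 - 4 * y i i * y j j,
    4 * y k k * y i i * y j j + (y k i + y i k) * (y i j + y j i) * (y k j + y j k) -
      y k k * (y i j + y j i) ^ 2 - y j j * (y k i + y i k) ^ 2 - y i i * (y k j + y j k) ^ 2]
    (fun i j => ⟨if i = j then X 2 ^ d i else 0, ?_⟩) ?_ fun p hp => ?_
  · split_ifs with h
    · subst h
      rw [← two_mul, Nat.mul_div_cancel_left _ two_pos]
      exact isHomogeneous_X_pow _ _
    · exact Submodule.zero_mem _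
  · intro l
    fin_cases l <;> simp [y, entryEval, hij, hij.symm, hki, hki.symm, hkj, hkj.symm]
  · have h0 := hp 0
    have h1 := hp 1
    have h2 := hp 2
    have h3 := hp 3
    have h4 := hp 4
    simp only [y, entryEval, Matrix.cons_val_zero, Matrix.cons_val_one, Matrix.cons_val, aeval_X,
      map_sub, map_add, map_mul, map_pow, map_ofNat, LinearMap.coe_mk, AddHom.coe_mk]
      at h0 h1 h2 h3 h4
    obtain ⟨A, hA⟩ : ∃ A : Fin 4 → Fin 4 → MvPolynomial (Fin 3) ℂ, ∀ i j, p i j = A i j :=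
      ⟨fun i j => p i j, fun i j => rfl⟩
    have hhom : ∀ i j, (A i j).IsHomogeneous ((d i + d j) / 2) :=
      fun i j => hA i j ▸ (p i j).2
    have hii := hhom i i
    have hijh := hhom i j
    have hji := hhom j i
    have hjj := hhom j j
    simp only [hi, hj, add_zero, Nat.zero_div] at hii hijh hji hjj
    simp only [hA] at h0 h1 h2 h3 h4 ⊢
    let B : Fin 4 → Fin 4 → MvPolynomial (Fin 3) ℂ := fun i j => A (τ.symm i) (τ.symm j)
    have hB : eval 0 (quadricBundleChartPoly B) ≠ 0 := by
      rw [eval_zero_quadricBundleChartPoly]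
      exact h1
    refine IsRationalHypersurface.of_perm τ (B := B) (fun i j => by simp [B])
      (by rwa [eval_zero_quadricBundleChartPoly]) hB ?_
    refine isRationalHypersurface_of_isotropic (a := eval ![0, 0, 1] (A i i))
      (b := eval ![0, 0, 1] (A i j + A j i)) (c := eval ![0, 0, 1] (A j j)) ?_ ?_ ?_ h2 ?_ ?_
    · simp only [B, hτi']
      exact hii.eq_C_eval _
    · simp only [B, hτi', hτj']
      exact (hijh.add hji).eq_C_eval _
    · simp only [B, hτj']
      exact hjj.eq_C_eval _
    · simpa only [map_add] using h3
    · simpa only [B, hτi', hτj', ← hk, map_add] using h4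

theorem veryGeneral_isRationalHypersurface_of_ones {d : Fin 4 → ℕ} (hd : ∀ i, d i = 1) :
    VeryGeneral (P := Π i : Fin 4, Π j : Fin 4, (homogeneousSubmodule (Fin 3) ℂ ((d i + d j) / 2)))
      (fun p => IsRationalHypersurface (quadricBundleChartPoly fun i j => p i j)) := by
  let y : Fin 4 → Fin 4 → MvPolynomial ((Fin 3 → ℂ) × Fin 4 × Fin 4) ℤ := fun i j =>
    X (![1, 0, 0], i, j)
  let z : Fin 4 → Fin 4 → MvPolynomial ((Fin 3 → ℂ) × Fin 4 × Fin 4) ℤ := fun i j =>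
    X (![0, 0, 1], i, j)
  have hdeg : ∀ i j, (d i + d j) / 2 = 1 := fun i j => by rw [hd, hd]
  refine veryGeneral_of_entryEval ![y 1 1, (y 0 0 * z 1 1 - z 0 0 * y 1 1) ^ 2 -
      ((y 0 1 + y 1 0) * z 1 1 - (z 0 1 + z 1 0) * y 1 1) *
      (y 0 0 * (z 0 1 + z 1 0) - z 0 0 * (y 0 1 + y 1 0))]
    (fun i j => ⟨if i = 1 ∧ j = 1 then X 0 else if i = 0 ∧ j = 0 then X 2 else 0, ?_⟩) ?_
    fun p hp => ?_
  · rw [hdeg]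
    split_ifs
    · exact isHomogeneous_X _ _
    · exact isHomogeneous_X _ _
    · exact Submodule.zero_mem _
  · intro l
    fin_cases l <;> simp [y, z, entryEval]
  · have h0 := hp 0
    have h1 := hp 1
    simp only [y, z, entryEval, Matrix.cons_val_zero, Matrix.cons_val_one, aeval_X,
      map_sub, map_add, map_mul, map_pow, LinearMap.coe_mk, AddHom.coe_mk] at h0 h1
    refine isRationalHypersurface_of_linear_entries (fun i j => ?_) rfl rfl rfl rfl rfl rfl h0 ?_
    · rw [← hdeg i j]
      exact (p i j).2
    · simpa only [map_add] using h1

end VeryGeneralRational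

/-!
STATEMENT 8 (Corollary 1.2): Let `d₀, d₁, d₂, d₃` be non-negative integers of the same
parity and let `X → ℙ²` be a very general complex projective quadric surface bundle of
type `(d₀,d₁,d₂,d₃)`. If `∑ dᵢ ≠ 6` then: (1) `X` is rational if `∑ dᵢ ≤ 4` or if
`dᵢ = d_j = 0` for some `i ≠ j`; (2) `X` is not stably rational otherwise.
-/

theorem very_general_quadric_bundle_P2_stable_rationality
    (d : Fin 4 → ℕ) (hpar : ∀ i j, Even (d i + d j)) (hne : (∑ i, d i) ≠ 6) :
    VeryGeneral
      (P := Π i : Fin 4, Π j : Fin 4,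
        (MvPolynomial.homogeneousSubmodule (Fin 3) ℂ ((d i + d j) / 2)))
      (fun p =>
        IsQuadricBundleP2 (fun i j => (p i j : MvPolynomial (Fin 3) ℂ)) →
          ((((∑ i, d i) ≤ 4) ∨ (∃ i j, i ≠ j ∧ d i = 0 ∧ d j = 0)) →
            IsRationalFunctionField
              (quadricBundleFFMap (fun i j => (p i j : MvPolynomial (Fin 3) ℂ)))) ∧
          (¬ ((((∑ i, d i) ≤ 4) ∨ (∃ i j, i ≠ j ∧ d i = 0 ∧ d j = 0))) →
            ¬ IsStablyRationalFunctionField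
              (quadricBundleFFMap (fun i j => (p i j : MvPolynomial (Fin 3) ℂ))))) := by
  by_cases hz : ∃ i j, i ≠ j ∧ d i = 0 ∧ d j = 0
  · obtain ⟨i, j, hij, hi, hj⟩ := hz
    exact (veryGeneral_isRationalHypersurface_of_zeros hij hi hj).mono fun p hp _ =>
      ⟨fun _ => hp.isRationalFunctionField,
        fun h => absurd (Or.inr ⟨i, j, hij, hi, hj⟩) h⟩
  have hzero : ∀ i j, i ≠ j → d i = 0 → d j ≠ 0 := fun i j hij hi hj => hz ⟨i, j, hij, hi, hj⟩
  have e1 := Nat.even_iff.1 (hpar 0 1)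
  have e2 := Nat.even_iff.1 (hpar 0 2)
  have e3 := Nat.even_iff.1 (hpar 0 3)
  have h01 := hzero 0 1 (by decide)
  have h02 := hzero 0 2 (by decide)
  have h03 := hzero 0 3 (by decide)
  have h12 := hzero 1 2 (by decide)
  have h13 := hzero 1 3 (by decide)
  have h23 := hzero 2 3 (by decide)
  by_cases hs : ∑ i, d i ≤ 4
  · have hd : ∀ i, d i = 1 := by
      rw [Fin.sum_univ_four] at hs
      intro i
      fin_cases i <;> simp <;> omega
    exact (veryGeneral_isRationalHypersurface_of_ones hd).mono fun p hp _ =>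
      ⟨fun _ => hp.isRationalFunctionField, fun h => absurd (Or.inl hs) h⟩
  · have h8 : 8 ≤ ∑ i, d i := by
      rw [Fin.sum_univ_four] at hs hne ⊢
      omega
    obtain ⟨f, h1, h2, h3⟩ := exists_isReferenceForm hpar h8 hzero
    exact veryGeneral_of_specializesTo d f h1 fun p hp _ =>
      ⟨fun h => absurd h (not_or.2 ⟨hs, hz⟩),
        fun _ => not_isStablyRational_quadricBundle hpar h2 h3 hp⟩
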